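/- arXiv:1305.4291 — 2 statements merged into one kernel-verified Lean document; each statement's English description precedes it below -/
import Mathlib

section
/- Integral Ramanujan formula: for complex u, v, w with Im(v + c_𝖻) > 0, Im(c_𝖻 − u) > 0 and Im(v − u) < Im w < 0, the integral Ψ(u, v, w) = ∫_ℝ [Φ_𝖻(x + u)/Φ_𝖻(x + v)] e^{2πiwx} dx converges absolutely and equals ζ_o · [Φ_𝖻(u − v − c_𝖻) Φ_𝖻(w + c_𝖻) / Φ_𝖻(u − v + w − c_𝖻)] · e^{−2πi w (v + c_𝖻)}, which also equals ζ_o⁻¹ · [Φ_𝖻(v − u − w + c_𝖻) / (Φ_𝖻(v − u + c_𝖻) Φ_𝖻(−w − c_𝖻))] · e^{−2πi w (u − c_𝖻)}. -/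
open Real MeasureTheory

noncomputable section

/-- `c_𝖻 = i(𝖻 + 𝖻⁻¹)/2`. -/
def cB (bb : ℝ) : ℂ := Complex.I * (bb + bb⁻¹) / 2

/-- The integrand in the definition of Faddeev's quantum dilogarithm. -/
def phiKer (bb : ℝ) (z w : ℂ) : ℂ :=
  Complex.exp (-2 * Complex.I * z * w) /
    (4 * Complex.sinh (w * bb) * Complex.sinh (w / bb) * w)

/-- Faddeev's quantum dilogarithm on the strip `|Im z| < Im c_𝖻`, defined by the
contour integral over `ℝ + iε` with `ε = π·min(𝖻,𝖻⁻¹)/2`. -/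
def PhiS (bb : ℝ) (z : ℂ) : ℂ :=
  Complex.exp (∫ t : ℝ, phiKer bb z (t + Complex.I * (π * min bb bb⁻¹ / 2)))

/-- The factor appearing in the functional equation:
`Φ_𝖻(z) = Efac 𝖻 z · Φ_𝖻(z + i𝖻)`. -/
def Efac (bb : ℝ) (z : ℂ) : ℂ := 1 + Complex.exp (2 * π * bb * (z + Complex.I * bb / 2))

/-- Number of upward shifts by `i𝖻` needed to bring `z` into the strip. -/
def nUp (bb : ℝ) (z : ℂ) : ℕ := ⌊(-((bb + bb⁻¹) / 2) - z.im) / bb⌋₊ + 1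

/-- Number of downward shifts by `i𝖻` needed to bring `z` into the strip. -/
def nDn (bb : ℝ) (z : ℂ) : ℕ := ⌊(z.im - (bb + bb⁻¹) / 2) / bb⌋₊ + 1

/-- Faddeev's quantum dilogarithm `Φ_𝖻`, extended from the strip `|Im z| < Im c_𝖻`
to all of `ℂ` as a meromorphic function by the functional equation
`Φ_𝖻(z - i𝖻/2) = (1 + e^{2π𝖻z}) Φ_𝖻(z + i𝖻/2)`. -/
def Phi (bb : ℝ) (z : ℂ) : ℂ :=
  if z.im ≤ -((bb + bb⁻¹) / 2) then
    (∏ k ∈ Finset.range (nUp bb z), Efac bb (z + Complex.I * k * bb)) *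
      PhiS bb (z + Complex.I * (nUp bb z) * bb)
  else if (bb + bb⁻¹) / 2 ≤ z.im then
    PhiS bb (z - Complex.I * (nDn bb z) * bb) /
      ∏ k ∈ Finset.range (nDn bb z), Efac bb (z - Complex.I * (k + 1) * bb)
  else PhiS bb z

open Filter Topology Metric

/-- A parametric integral of holomorphic functions with a locally uniform integrable bound can be
differentiated under the integral sign. -/
theorem hasDerivAt_integral_of_bounded_on_ball {h : ℂ → ℝ → ℂ} {a : ℂ} {r : ℝ} (hr : 0 < r)
    {bound : ℝ → ℝ} (hm : ∀ z ∈ ball a r, AEStronglyMeasurable (h z) volume)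
    (hd : ∀ x, DifferentiableOn ℂ (fun z => h z x) (ball a r))
    (hb : ∀ z ∈ ball a r, ∀ x, ‖h z x‖ ≤ bound x) (hi : Integrable bound) :
    HasDerivAt (fun z => ∫ x, h z x) (∫ x, deriv (fun z => h z x) a) a := by
  have ha : a ∈ ball a r := mem_ball_self hr
  have hder : ∀ x, ∀ z ∈ ball a r, HasDerivAt (fun z => h z x) (deriv (fun z => h z x) z) z :=
    fun x z hz => ((hd x).differentiableAt (isOpen_ball.mem_nhds hz)).hasDerivAt
  refine (hasDerivAt_integral_of_dominated_loc_of_deriv_le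
    (F' := fun z x => deriv (fun z => h z x) z) (bound := fun x => bound x / (r / 4))
    (s := ball a (r / 2)) (ball_mem_nhds _ (by positivity)) ?_ ?_ ?_ ?_ ?_ ?_).2
  · filter_upwards [ball_mem_nhds a hr] with z hz using hm z hz
  · exact hi.mono' (hm a ha) (Eventually.of_forall (hb a ha))
  · have hlim : Tendsto (fun n : ℕ => a + ((1 / ((n : ℝ) + 1) : ℝ) : ℂ)) atTop (𝓝[≠] a) := by
      rw [tendsto_nhdsWithin_iff]
      constructor
      · have := (Complex.continuous_ofReal.tendsto 0).comp
          (tendsto_one_div_add_atTop_nhds_zero_nat (𝕜 := ℝ))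
        simpa using this.const_add a
      · refine Eventually.of_forall fun n => ?_
        have : (1 / ((n : ℝ) + 1) : ℝ) ≠ 0 := by positivity
        simp only [Set.mem_compl_iff, Set.mem_singleton_iff, add_eq_left]
        exact_mod_cast this
    have hlimr : Tendsto (fun n : ℕ => a + ((1 / ((n : ℝ) + 1) : ℝ) : ℂ)) atTop (𝓝 a) :=
      hlim.mono_right nhdsWithin_le_nhds
    obtain ⟨K, hK⟩ := eventually_atTop.1 (hlimr.eventually (ball_mem_nhds a hr))
    refine aestronglyMeasurable_of_tendsto_ae atTop
      (f := fun n x => slope (fun z => h z x) a (a + ((1 / (((n + K : ℕ) : ℝ) + 1) : ℝ) : ℂ)))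
      (fun n => ?_) (Eventually.of_forall fun x => ?_)
    · simp only [slope, vsub_eq_sub]
      exact AEStronglyMeasurable.const_smul (𝕜 := ℂ)
        ((hm _ (hK (n + K) (by omega))).sub (hm a ha)) _
    · exact ((hder x a ha).tendsto_slope.comp hlim).comp (tendsto_add_atTop_nat K)
  · refine Eventually.of_forall fun x z hz => ?_
    have hsub : closedBall z (r / 4) ⊆ ball a r := fun y hy => by
      rw [mem_ball] at *
      rw [mem_closedBall] at hy
      linarith [dist_triangle y z a]
    refine Complex.norm_deriv_le_of_forall_mem_sphere_norm_le (by positivity) ?_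
      fun y hy => hb y (hsub (sphere_subset_closedBall hy)) x
    refine DifferentiableOn.diffContOnCl ((hd x).mono ?_)
    exact closure_ball_subset_closedBall.trans hsub
  · exact hi.div_const _
  · exact Eventually.of_forall fun x z hz => hder x z (ball_subset_ball (by linarith) hz)

theorem integrable_exp_neg_mul_abs {δ : ℝ} (hδ : 0 < δ) :
    Integrable (fun x : ℝ => Real.exp (-δ * |x|)) := by
  have h1 : IntegrableOn (fun x : ℝ => Real.exp (-δ * |x|)) (Set.Ioi 0) :=
    (integrableOn_exp_mul_Ioi (neg_lt_zero.2 hδ) 0).congr_fun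
      (fun x hx => by simp only; rw [abs_of_pos hx]) measurableSet_Ioi
  have h2 : IntegrableOn (fun x : ℝ => Real.exp (-δ * |x|)) (Set.Iic 0) :=
    (integrableOn_exp_mul_Iic hδ 0).congr_fun
      (fun x hx => by simp only; rw [abs_of_nonpos hx]; ring_nf) measurableSet_Iic
  rw [← integrableOn_univ, ← Set.Iic_union_Ioi (a := (0 : ℝ))]
  exact h2.union h1

/-- Exponential decay of `φ` in horizontal directions, uniform on closed substrips of the open
strip `α < Im z < β`. -/
def HasStripDecay (φ : ℂ → ℂ) (α β : ℝ) : Prop :=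
  ∀ p q, α < p → q < β → ∃ C δ : ℝ, 0 < δ ∧
    ∀ z : ℂ, p ≤ z.im → z.im ≤ q → ‖φ z‖ ≤ C * Real.exp (-δ * |z.re|)

/-- The open horizontal strip `α < Im z < β`. -/
def openStrip (α β : ℝ) : Set ℂ := {z | α < z.im ∧ z.im < β}

theorem isOpen_openStrip (α β : ℝ) : IsOpen (openStrip α β) :=
  (isOpen_lt continuous_const Complex.continuous_im).inter
    (isOpen_lt Complex.continuous_im continuous_const)

theorem convex_openStrip (α β : ℝ) : Convex ℝ (openStrip α β) :=
  (convex_halfSpace_im_gt α).inter (convex_halfSpace_im_lt β)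

theorem add_ofReal_mem_openStrip {α β : ℝ} {a : ℂ} (ha : a ∈ openStrip α β) (x : ℝ) :
    (x : ℂ) + a ∈ openStrip α β := by
  simpa [openStrip] using ha

theorem continuous_comp_horizontal {φ : ℂ → ℂ} {α β : ℝ}
    (hφ : DifferentiableOn ℂ φ (openStrip α β)) {a : ℂ} (ha : a ∈ openStrip α β) :
    Continuous (fun x : ℝ => φ (x + a)) :=
  hφ.continuousOn.comp_continuous (by fun_prop) (add_ofReal_mem_openStrip ha)

theorem exists_closedBall_bound {φ : ℂ → ℂ} {α β : ℝ} (hdec : HasStripDecay φ α β) {a : ℂ}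
    (ha : a ∈ openStrip α β) : ∃ r C δ : ℝ, 0 < r ∧ 0 < δ ∧ ball a r ⊆ openStrip α β ∧
      ∀ z ∈ ball a r, ∀ x : ℝ, ‖φ (x + z)‖ ≤ C * Real.exp (-δ * |x|) := by
  obtain ⟨h1, h2⟩ := ha
  obtain ⟨p, hp1, hp2⟩ := exists_between h1
  obtain ⟨q, hq1, hq2⟩ := exists_between h2
  obtain ⟨C, δ, hδ, hC⟩ := hdec p q hp1 hq2
  have hC0 : 0 ≤ C := by
    have := (norm_nonneg _).trans (hC a hp2.le hq1.le)
    exact nonneg_of_mul_nonneg_left this (Real.exp_pos _)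
  obtain ⟨r, hr, hrs⟩ := Metric.isOpen_iff.1 (isOpen_openStrip p q) a ⟨hp2, hq1⟩
  refine ⟨r, C * Real.exp (δ * (|a.re| + r)), δ, hr, hδ, fun z hz => ?_, fun z hz x => ?_⟩
  · have := hrs hz
    exact ⟨hp1.trans this.1, this.2.trans hq2⟩
  · have hz' := hrs hz
    refine (hC (x + z) (by simpa using hz'.1.le) (by simpa using hz'.2.le)).trans ?_
    rw [mul_assoc, ← Real.exp_add]
    have hzr : |z.re| ≤ |a.re| + r := by
      have h3 : |(z - a).re| ≤ r := (Complex.abs_re_le_norm _).trans (mem_ball_iff_norm.1 hz).le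
      have h4 : z.re = a.re + (z - a).re := by simp
      rw [h4]
      exact (abs_add_le _ _).trans (by linarith)
    have h5 : |x| ≤ |x + z.re| + |z.re| := by
      simpa using abs_sub (x + z.re) z.re
    gcongr
    simp only [Complex.add_re, Complex.ofReal_re]
    nlinarith

theorem integrable_horizontal {φ : ℂ → ℂ} {α β : ℝ}
    (hφ : DifferentiableOn ℂ φ (openStrip α β)) (hdec : HasStripDecay φ α β) {a : ℂ}
    (ha : a ∈ openStrip α β) : Integrable (fun x : ℝ => φ (x + a)) := by
  obtain ⟨r, C, δ, hr, hδ, -, hb⟩ := exists_closedBall_bound hdec ha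
  exact ((integrable_exp_neg_mul_abs hδ).const_mul C).mono'
    (continuous_comp_horizontal hφ ha).aestronglyMeasurable
    (Eventually.of_forall (hb a (mem_ball_self hr)))

/-- Contour shift: integrals along horizontal lines in a strip of holomorphy and exponential decay
do not depend on the line. -/
theorem integral_horizontal_eq {φ : ℂ → ℂ} {α β : ℝ}
    (hφ : DifferentiableOn ℂ φ (openStrip α β)) (hdec : HasStripDecay φ α β) {a a' : ℂ}
    (ha : a ∈ openStrip α β) (ha' : a' ∈ openStrip α β) :
    ∫ x : ℝ, φ (x + a) = ∫ x : ℝ, φ (x + a') := by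
  set D : ℂ → ℂ := fun a => ∫ x : ℝ, φ (x + a) with hD
  have hdiff : ∀ a ∈ openStrip α β, DifferentiableAt ℂ D a := by
    intro a ha
    obtain ⟨r, C, δ, hr, hδ, hsub, hb⟩ := exists_closedBall_bound hdec ha
    refine (hasDerivAt_integral_of_bounded_on_ball hr
      (fun z hz => (continuous_comp_horizontal hφ (hsub hz)).aestronglyMeasurable)
      (fun x => ?_) hb ((integrable_exp_neg_mul_abs hδ).const_mul C)).differentiableAt
    exact hφ.comp (by fun_prop) fun z hz => add_ofReal_mem_openStrip (hsub hz) x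
  have htrans : ∀ (a : ℂ) (t : ℝ), D (a + t) = D a := by
    intro a t
    have := integral_add_right_eq_self (μ := volume) (fun x : ℝ => φ (x + a)) t
    rw [hD]
    simp only
    rw [← this]
    congr 1
    ext x
    push_cast
    ring_nf
  refine (isOpen_openStrip α β).is_const_of_deriv_eq_zero
    (convex_openStrip α β).isPreconnected
    (fun z hz => (hdiff z hz).differentiableWithinAt) (fun z hz => ?_) ha ha'
  have h1 : HasDerivAt (fun t : ℝ => D (z + t)) (deriv D z) 0 := by
    have h2 : HasDerivAt D (deriv D z) (z + ((0 : ℝ) : ℂ)) := by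
      simpa using (hdiff z hz).hasDerivAt
    have h3 : HasDerivAt (fun t : ℂ => D (z + t)) (deriv D z) ((0 : ℝ) : ℂ) :=
      HasDerivAt.comp_const_add z _ h2
    exact h3.comp_ofReal
  have h4 : (fun t : ℝ => D (z + t)) = fun _ => D z := funext (htrans z)
  rw [h4] at h1
  simpa using h1.unique (hasDerivAt_const _ _)

/-- A holomorphic function on the punctured plane that grows at most like `‖q‖ ^ κ` at infinity and
`‖q‖ ^ (-κ)` at the origin, with `κ < 1`, is constant. -/
theorem eq_of_growth_on_punctured_plane {H : ℂ → ℂ} {κ C : ℝ} (hκ0 : 0 ≤ κ) (hκ : κ < 1)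
    (hH : ∀ q ≠ 0, DifferentiableAt ℂ H q)
    (hbd : ∀ q ≠ 0, ‖H q‖ ≤ C * Real.exp (κ * |Real.log ‖q‖|)) {q q' : ℂ} (hq : q ≠ 0)
    (hq' : q' ≠ 0) : H q = H q' := by
  have hC : 0 ≤ C := by
    have := (norm_nonneg _).trans (hbd 1 one_ne_zero)
    exact nonneg_of_mul_nonneg_left this (Real.exp_pos _)
  set k : ℂ → ℂ := fun q => q * H q with hk
  have hkd : ∀ q ≠ 0, DifferentiableAt ℂ k q := fun q hq => differentiableAt_id.mul (hH q hq)
  have hkc : ContinuousAt k 0 := by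
    have h0 : k 0 = 0 := by simp [hk]
    rw [ContinuousAt, h0]
    have hlim : Tendsto (fun q : ℂ => C * ‖q‖ ^ (1 - κ)) (𝓝 0) (𝓝 0) := by
      have h1 : ContinuousAt (fun q : ℂ => C * ‖q‖ ^ (1 - κ)) 0 :=
        ((Real.continuousAt_rpow_const _ _ (Or.inr (by linarith))).comp
          continuous_norm.continuousAt).const_mul C
      have h2 := h1.tendsto
      simpa [Real.zero_rpow (by linarith : (1 - κ) ≠ 0)] using h2
    refine squeeze_zero_norm' ?_ hlim
    filter_upwards [ball_mem_nhds (0 : ℂ) one_pos] with q hq1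
    by_cases hq0 : q = 0
    · simp only [hq0, h0, norm_zero]
      positivity
    · have hpos : 0 < ‖q‖ := norm_pos_iff.2 hq0
      have hlog : Real.log ‖q‖ ≤ 0 := 
        Real.log_nonpos hpos.le (by simpa using (mem_ball_zero_iff.1 hq1).le)
      calc ‖k q‖ = ‖q‖ * ‖H q‖ := norm_mul _ _
        _ ≤ ‖q‖ * (C * Real.exp (κ * |Real.log ‖q‖|)) := by gcongr; exact hbd q hq0
        _ = C * (Real.exp (Real.log ‖q‖) * Real.exp (κ * |Real.log ‖q‖|)) := by
          rw [Real.exp_log hpos]; ring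
        _ = C * ‖q‖ ^ (1 - κ) := by
          rw [← Real.exp_add, Real.rpow_def_of_pos hpos, abs_of_nonpos hlog]; ring_nf
  have hkdiff : Differentiable ℂ k := by
    intro q
    by_cases hq : q = 0
    · subst hq
      exact (Complex.analyticAt_of_differentiable_on_punctured_nhds_of_continuousAt
        (eventually_mem_nhdsWithin.mono fun q hq => hkd q hq) hkc).differentiableAt
    · exact hkd q hq
  have hDd : Differentiable ℂ (dslope k 0) := by
    rw [← differentiableOn_univ, Complex.differentiableOn_dslope univ_mem]
    exact hkdiff.differentiableOn
  have hDH : ∀ q ≠ 0, dslope k 0 q = H q := by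
    intro q hq
    rw [dslope_of_ne _ hq, slope_def_field]
    simp [hk, hq]
  rw [← hDH q hq, ← hDH q' hq']
  refine is_const_of_deriv_eq_zero hDd (fun z => ?_) q q'
  have hlim : Tendsto (fun R : ℝ => C * (2 ^ κ * R ^ (-(1 - κ)))) atTop (𝓝 0) := by
    simpa using ((tendsto_rpow_neg_atTop (by linarith : 0 < 1 - κ)).const_mul (2 ^ κ)).const_mul C
  refine norm_le_zero_iff.1 (ge_of_tendsto hlim ?_)
  filter_upwards [eventually_ge_atTop (1 + ‖z‖)] with R hR
  have hR0 : 0 < R := by linarith [norm_nonneg z]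
  have hb : ∀ y ∈ sphere z R, ‖dslope k 0 y‖ ≤ C * (2 * R) ^ κ := by
    intro y hy
    have hy' : ‖y - z‖ = R := mem_sphere_iff_norm.1 hy
    have h1 : 1 ≤ ‖y‖ := by
      have := norm_sub_le y z
      linarith
    have h2 : ‖y‖ ≤ 2 * R := by
      have : y = (y - z) + z := by ring
      have h3 := norm_add_le (y - z) z
      rw [← this] at h3
      linarith
    have hy0 : y ≠ 0 := norm_pos_iff.1 (by linarith)
    rw [hDH y hy0]
    refine (hbd y hy0).trans ?_
    rw [abs_of_nonneg (Real.log_nonneg h1), mul_comm κ, ← Real.rpow_def_of_pos (by linarith)]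
    gcongr
  have := Complex.norm_deriv_le_of_forall_mem_sphere_norm_le hR0 hDd.diffContOnCl hb
  refine this.trans (le_of_eq ?_)
  rw [Real.mul_rpow (by norm_num) hR0.le, neg_sub, Real.rpow_sub hR0, Real.rpow_one]
  ring

theorem eq_of_periodic_of_growth {g : ℂ → ℂ} {h θ C : ℝ} (hh : 0 < h) (hθ0 : 0 ≤ θ)
    (hθ : θ * h < 1) (hg : Differentiable ℂ g) (hper : Function.Periodic g h)
    (hbd : ∀ z, ‖g z‖ ≤ C * Real.exp (2 * π * θ * |z.im|)) (z z' : ℂ) : g z = g z' := by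
  rw [← Function.Periodic.eq_cuspFunction hh.ne' hper z,
    ← Function.Periodic.eq_cuspFunction hh.ne' hper z']
  refine eq_of_growth_on_punctured_plane (κ := θ * h) (C := C) (by positivity) hθ (fun q hq => ?_)
    (fun q hq => ?_) (Complex.exp_ne_zero _) (Complex.exp_ne_zero _)
  · have := Function.Periodic.differentiableAt_cuspFunction hh.ne' hper
      (hg (Function.Periodic.invQParam h q))
    rwa [Function.Periodic.qParam_right_inv hh.ne' hq] at this
  · rw [Function.Periodic.cuspFunction_eq_of_nonzero _ _ hq]
    refine (hbd _).trans (le_of_eq ?_)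
    rw [Function.Periodic.im_invQParam, abs_mul, abs_div, abs_neg, abs_of_pos hh,
      abs_of_pos (by positivity : 0 < 2 * π)]
    congr 2
    field_simp

/-- Liouville theorem on a strip: a function holomorphic on a strip of height larger than `b`,
`I * b`-periodic and growing slower than `exp (2π|Re z| / b)`, is constant. -/
theorem eq_of_periodic_on_openStrip {f : ℂ → ℂ} {α β b θ C p : ℝ} (hb : 0 < b) (hθ0 : 0 ≤ θ)
    (hθ : θ * b < 1) (hf : DifferentiableOn ℂ f (openStrip α β))
    (hper : ∀ z ∈ openStrip α β, z + Complex.I * b ∈ openStrip α β → f (z + Complex.I * b) = f z)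
    (hp : α < p) (hq : p + b < β)
    (hbd : ∀ z : ℂ, p ≤ z.im → z.im ≤ p + b → ‖f z‖ ≤ C * Real.exp (2 * π * θ * |z.re|))
    {z z' : ℂ} (hz : z ∈ openStrip α β) (hz' : z' ∈ openStrip α β) : f z = f z' := by
  set n : ℂ → ℤ := fun w => ⌊(w.im - p) / b⌋ with hn
  set G : ℂ → ℂ := fun w => f (w - Complex.I * b * n w) with hG
  have him : ∀ w : ℂ, ∀ m : ℤ, (w - Complex.I * b * m).im = w.im - b * m := by
    intro w m
    simp
  have hn1 : ∀ w, p ≤ w.im - b * n w := by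
    intro w
    have := Int.floor_le ((w.im - p) / b)
    rw [le_div_iff₀ hb] at this
    simp only [hn]
    linarith
  have hn2 : ∀ w, w.im - b * n w < p + b := by
    intro w
    have := Int.lt_floor_add_one ((w.im - p) / b)
    rw [div_lt_iff₀ hb] at this
    simp only [hn]
    linarith
  have hmem : ∀ w, w - Complex.I * b * n w ∈ openStrip α β := by
    intro w
    constructor <;> rw [him]
    · linarith [hn1 w]
    · linarith [hn2 w]
  have hGloc : ∀ w, G =ᶠ[𝓝 w] fun w' => f (w' - Complex.I * b * n w) := by
    intro w
    have hop : ∀ᶠ w' in 𝓝 w, w' - Complex.I * b * n w ∈ openStrip α β := by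
      refine ((continuous_id.sub continuous_const).continuousAt).eventually
        ((isOpen_openStrip α β).mem_nhds (hmem w))
    have hfl : ∀ᶠ w' in 𝓝 w, n w' = n w ∨ n w' = n w - 1 := by
      have h1 : ∀ᶠ w' : ℂ in 𝓝 w, w'.im < w.im + (p + b - (w.im - b * n w)) :=
        Complex.continuous_im.continuousAt.eventually_lt continuousAt_const
          (by linarith [hn2 w])
      have h2 : ∀ᶠ w' : ℂ in 𝓝 w, w.im - b < w'.im :=
        continuousAt_const.eventually_lt Complex.continuous_im.continuousAt (by linarith)
      filter_upwards [h1, h2] with w' h1 h2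
      have h3 := hn1 w'
      have h4 := hn2 w'
      have h5 := hn1 w
      have h6 : b * n w' < b * (n w + 1 : ℤ) := by push_cast; linarith
      have h7 : b * (n w - 2 : ℤ) < b * n w' := by push_cast; linarith
      have h8 := lt_of_mul_lt_mul_left h6 hb.le
      have h9 := lt_of_mul_lt_mul_left h7 hb.le
      norm_cast at h8 h9
      omega
    filter_upwards [hop, hfl] with w' h1 h2
    simp only [hG]
    rcases h2 with h2 | h2
    · rw [h2]
    · have h3 : w' - Complex.I * b * n w' = (w' - Complex.I * b * n w) + Complex.I * b := by
        rw [h2]; push_cast; ring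
      rw [h3]
      refine hper _ h1 ?_
      rw [← h3]
      constructor <;> rw [him]
      · linarith [hn1 w']
      · linarith [hn2 w']
  have hGd : Differentiable ℂ G := by
    intro w
    refine DifferentiableAt.congr_of_eventuallyEq ?_ (hGloc w)
    exact (hf.differentiableAt ((isOpen_openStrip α β).mem_nhds (hmem w))).comp w
      (differentiableAt_id.sub_const _)
  have hGper : ∀ w, G (w + Complex.I * b) = G w := by
    intro w
    have : n (w + Complex.I * b) = n w + 1 := by
      simp only [hn]
      rw [← Int.floor_add_one]
      congr 1
      simp
      field_simp
      ring
    simp only [hG, this]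
    congr 1
    push_cast
    ring
  have hGconst : ∀ w w', G w = G w' := by
    intro w w'
    have := eq_of_periodic_of_growth (g := fun ζ => G (Complex.I * ζ)) (C := C) hb hθ0 hθ
      (hGd.comp (differentiable_id.const_mul _))
      (fun ζ => by simp only; rw [mul_add]; exact hGper _)
      (fun ζ => by
        refine (hbd _ ?_ ?_).trans (le_of_eq ?_)
        · rw [him]; exact hn1 _
        · rw [him]; exact (hn2 _).le
        · simp) (-Complex.I * w) (-Complex.I * w')
    simpa [← mul_assoc] using this
  set w₀ : ℂ := Complex.I * (p + b / 2 : ℝ) with hw₀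
  have hw₀im : w₀.im = p + b / 2 := by simp [hw₀]
  have hw₀mem : w₀ ∈ openStrip α β := ⟨by linarith, by linarith⟩
  have hloc : f =ᶠ[𝓝 w₀] fun _ => G w₀ := by
    have h1 : openStrip p (p + b) ∈ 𝓝 w₀ :=
      (isOpen_openStrip p (p + b)).mem_nhds ⟨by linarith, by linarith⟩
    filter_upwards [h1] with w hw
    rw [← hGconst w w₀]
    have : n w = 0 := by
      simp only [hn]
      rw [Int.floor_eq_zero_iff]
      constructor
      · exact div_nonneg (by linarith [hw.1]) hb.le
      · rw [div_lt_one hb]; linarith [hw.2]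
    simp [hG, this]
  have hEq := (hf.analyticOnNhd (isOpen_openStrip α β)).eqOn_of_preconnected_of_eventuallyEq
    analyticOnNhd_const (convex_openStrip α β).isPreconnected hw₀mem hloc
  rw [hEq hz, hEq hz']

theorem Complex.norm_sinh_sq (z : ℂ) :
    ‖Complex.sinh z‖ ^ 2 = Real.sinh z.re ^ 2 + Real.sin z.im ^ 2 := by
  have h : Complex.sinh z = (Real.sinh z.re * Real.cos z.im : ℝ) +
      (Real.cosh z.re * Real.sin z.im : ℝ) * Complex.I := by
    conv_lhs => rw [← Complex.re_add_im z]
    rw [Complex.sinh_add, Complex.sinh_mul_I, Complex.cosh_mul_I]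
    push_cast
    ring
  rw [h, Complex.sq_norm, Complex.normSq_add_mul_I]
  nlinarith [Real.sin_sq_add_cos_sq z.im, Real.cosh_sq z.re]

theorem Complex.abs_sinh_re_le_norm_sinh (z : ℂ) : |Real.sinh z.re| ≤ ‖Complex.sinh z‖ := by
  refine abs_le_of_sq_le_sq ?_ (norm_nonneg _)
  rw [Complex.norm_sinh_sq]
  nlinarith [sq_nonneg (Real.sin z.im)]

theorem Complex.abs_sin_im_mul_exp_le_norm_sinh (z : ℂ) :
    |Real.sin z.im| * (Real.exp |z.re| / 2) ≤ ‖Complex.sinh z‖ := by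
  have h1 : Real.exp |z.re| / 2 ≤ Real.cosh z.re := by
    rw [← Real.cosh_abs, Real.cosh_eq]
    linarith [Real.exp_pos (-|z.re|)]
  refine (mul_le_mul_of_nonneg_left h1 (abs_nonneg _)).trans ?_
  refine le_of_sq_le_sq ?_ (norm_nonneg _)
  rw [Complex.norm_sinh_sq, mul_pow, sq_abs, Real.cosh_sq]
  nlinarith [Real.sin_sq_le_one z.im, sq_nonneg (Real.sinh z.re)]

theorem Complex.sinh_ne_zero_of_mem_openStrip {z : ℂ} (hz : z ∈ openStrip 0 π) :
    Complex.sinh z ≠ 0 := by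
  have h := Complex.abs_sin_im_mul_exp_le_norm_sinh z
  have h1 : 0 < Real.sin z.im := Real.sin_pos_of_pos_of_lt_pi hz.1 hz.2
  have h2 : 0 < |Real.sin z.im| * (Real.exp |z.re| / 2) := by positivity
  exact norm_pos_iff.1 (h2.trans_le h)

theorem Complex.sinh_ne_zero_of_mem_openStrip_neg {z : ℂ} (hz : z ∈ openStrip (-π) 0) :
    Complex.sinh z ≠ 0 := by
  have := Complex.sinh_ne_zero_of_mem_openStrip (z := -z)
    ⟨by simpa using hz.2, by simpa using neg_lt_neg hz.1⟩
  rwa [Complex.sinh_neg, neg_ne_zero] at this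

theorem Complex.sinh_ne_zero_of_abs_im_lt {z : ℂ} (hz : |z.im| < π) (h0 : z ≠ 0) :
    Complex.sinh z ≠ 0 := by
  rw [abs_lt] at hz
  rcases lt_trichotomy z.im 0 with h | h | h
  · exact Complex.sinh_ne_zero_of_mem_openStrip_neg ⟨hz.1, h⟩
  · have hre : z.re ≠ 0 := fun hre => h0 (Complex.ext hre h)
    have h1 := Complex.abs_sinh_re_le_norm_sinh z
    have h2 : 0 < |Real.sinh z.re| := abs_pos.2 (by simpa using hre)
    exact norm_pos_iff.1 (h2.trans_le h1)
  · exact Complex.sinh_ne_zero_of_mem_openStrip ⟨h, hz.2⟩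

/-- `φ` is `O(exp (κ|Re z|))` as `|Re z| → ∞`, uniformly on `|Im z| ≤ Y`. -/
def ExpTail (φ : ℂ → ℂ) (Y κ : ℝ) : Prop :=
  ∃ C : ℝ, ∀ z : ℂ, |z.im| ≤ Y → 1 ≤ |z.re| → ‖φ z‖ ≤ C * Real.exp (κ * |z.re|)

namespace ExpTail

variable {φ ψ : ℂ → ℂ} {Y κ κ' : ℝ}

theorem exists_nonneg (h : ExpTail φ Y κ) : ∃ C : ℝ, 0 ≤ C ∧
    ∀ z : ℂ, |z.im| ≤ Y → 1 ≤ |z.re| → ‖φ z‖ ≤ C * Real.exp (κ * |z.re|) := by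
  obtain ⟨C, hC⟩ := h
  refine ⟨max C 0, le_max_right _ _, fun z h1 h2 => (hC z h1 h2).trans ?_⟩
  gcongr
  exact le_max_left _ _

theorem mul (h : ExpTail φ Y κ) (h' : ExpTail ψ Y κ') :
    ExpTail (fun z => φ z * ψ z) Y (κ + κ') := by
  obtain ⟨C, hC0, hC⟩ := h.exists_nonneg
  obtain ⟨C', hC0', hC'⟩ := h'.exists_nonneg
  refine ⟨C * C', fun z h1 h2 => ?_⟩
  rw [norm_mul, add_mul, Real.exp_add, mul_mul_mul_comm]
  have := hC z h1 h2
  have := hC' z h1 h2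
  gcongr

theorem mono (h : ExpTail φ Y κ) (hk : κ ≤ κ') : ExpTail φ Y κ' := by
  obtain ⟨C, hC0, hC⟩ := h.exists_nonneg
  refine ⟨C, fun z h1 h2 => (hC z h1 h2).trans ?_⟩
  gcongr

theorem sub (h : ExpTail φ Y κ) (h' : ExpTail ψ Y κ) : ExpTail (fun z => φ z - ψ z) Y κ := by
  obtain ⟨C, hC⟩ := h
  obtain ⟨C', hC'⟩ := h'
  refine ⟨C + C', fun z h1 h2 => (norm_sub_le _ _).trans ?_⟩
  linarith [hC z h1 h2, hC' z h1 h2]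

theorem const_mul (h : ExpTail φ Y κ) (a : ℂ) : ExpTail (fun z => a * φ z) Y κ := by
  obtain ⟨C, hC⟩ := h
  refine ⟨‖a‖ * C, fun z h1 h2 => ?_⟩
  rw [norm_mul, mul_assoc]
  have := hC z h1 h2
  gcongr

theorem congr (h : ExpTail φ Y κ) (he : ∀ z : ℂ, 1 ≤ |z.re| → ψ z = φ z) : ExpTail ψ Y κ := by
  obtain ⟨C, hC⟩ := h
  exact ⟨C, fun z h1 h2 => by rw [he z h2]; exact hC z h1 h2⟩

theorem inv : ExpTail (fun w => w⁻¹) Y 0 := by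
  refine ⟨1, fun z _ h2 => ?_⟩
  rw [norm_inv, zero_mul, Real.exp_zero, mul_one]
  exact inv_le_one_of_one_le₀ (h2.trans (Complex.abs_re_le_norm z))

theorem exp (z : ℂ) : ExpTail (fun w => Complex.exp (-2 * Complex.I * z * w)) Y (2 * |z.im|) := by
  refine ⟨Real.exp (2 * |z.re| * Y), fun w h1 _ => ?_⟩
  rw [Complex.norm_exp, ← Real.exp_add]
  gcongr
  have h3 : (-2 * Complex.I * z * w).re = 2 * (z.re * w.im) + 2 * (z.im * w.re) := by
    simp
    ring
  rw [h3]
  have h4 : z.re * w.im ≤ |z.re| * |w.im| := by rw [← abs_mul]; exact le_abs_self _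
  have h5 : z.im * w.re ≤ |z.im| * |w.re| := by rw [← abs_mul]; exact le_abs_self _
  have h6 : |z.re| * |w.im| ≤ |z.re| * Y := by gcongr
  linarith

theorem inv_sinh {a : ℝ} (ha : 0 < a) : ExpTail (fun w => (Complex.sinh (w * a))⁻¹) Y (-a) := by
  have hk : 0 < (1 - Real.exp (-2 * a)) / 2 := by
    have : Real.exp (-2 * a) < 1 := (Real.exp_lt_exp.2 (by linarith)).trans_eq Real.exp_zero
    linarith
  refine ⟨((1 - Real.exp (-2 * a)) / 2)⁻¹, fun w _ h2 => ?_⟩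
  have h3 : (1 - Real.exp (-2 * a)) / 2 * Real.exp (a * |w.re|) ≤ ‖Complex.sinh (w * a)‖ := by
    refine le_trans ?_ (Complex.abs_sinh_re_le_norm_sinh _)
    have h4 : (w * a).re = w.re * a := by simp
    rw [h4, Real.abs_sinh, abs_mul, abs_of_pos ha, Real.sinh_eq]
    have h5 : Real.exp (-(|w.re| * a)) ≤ Real.exp (-2 * a) * Real.exp (a * |w.re|) := by
      rw [← Real.exp_add]
      gcongr
      nlinarith
    rw [mul_comm |w.re| a] at *
    linarith
  rw [norm_inv, neg_mul a, Real.exp_neg (a * _), ← mul_inv]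
  exact inv_anti₀ (by positivity) h3

theorem cosh : ExpTail Complex.cosh Y 1 := by
  refine ⟨1, fun z _ _ => ?_⟩
  have h1 : ‖Complex.cosh z‖ ≤ (‖Complex.exp z‖ + ‖Complex.exp (-z)‖) / 2 := by
    rw [Complex.cosh, norm_div]
    simp only [RCLike.norm_ofNat]
    gcongr
    exact norm_add_le _ _
  rw [Complex.norm_exp, Complex.norm_exp] at h1
  have h2 : Real.exp z.re ≤ Real.exp |z.re| := by gcongr; exact le_abs_self _
  have h3 : Real.exp (-z).re ≤ Real.exp |z.re| := by
    gcongr; simpa using neg_le_abs z.re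
  simp only [one_mul]
  linarith

theorem hasStripDecay {α β : ℝ} (hκ : κ < 0) (h : ∀ Y, ExpTail φ Y κ)
    (hφ : ContinuousOn φ (openStrip α β)) : HasStripDecay φ α β := by
  intro p q hp hq
  obtain ⟨C, hC0, hC⟩ := (h (max |p| |q|)).exists_nonneg
  have hK : IsCompact (Set.Icc (-1 : ℝ) 1 ×ℂ Set.Icc p q) := isCompact_Icc.reProdIm isCompact_Icc
  obtain ⟨B, hB⟩ := hK.exists_bound_of_continuousOn (hφ.mono fun z hz =>
    ⟨hp.trans_le (Complex.mem_reProdIm.1 hz).2.1, (Complex.mem_reProdIm.1 hz).2.2.trans_lt hq⟩)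
  refine ⟨max C (B * Real.exp (-κ)), -κ, by linarith, fun z h1 h2 => ?_⟩
  rw [neg_neg]
  rcases le_or_gt 1 |z.re| with h3 | h3
  · refine (hC z (abs_le_max_abs_abs h1 h2) h3).trans ?_
    gcongr
    exact le_max_left _ _
  · have h4 := hB z (Complex.mem_reProdIm.2 ⟨abs_le.1 h3.le, h1, h2⟩)
    have hB0 : 0 ≤ B := (norm_nonneg _).trans h4
    refine h4.trans ?_
    calc B = B * Real.exp (-κ) * Real.exp κ := by
          rw [mul_assoc, ← Real.exp_add]; simp
      _ ≤ max C (B * Real.exp (-κ)) * Real.exp (κ * |z.re|) := by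
          gcongr
          · exact le_max_right _ _
          · nlinarith

end ExpTail

theorem tendsto_horizontal_atTop {φ : ℂ → ℂ} {α β : ℝ} (hdec : HasStripDecay φ α β) {a : ℂ}
    (ha : a ∈ openStrip α β) :
    Tendsto (fun x : ℝ => φ (x + a)) atTop (𝓝 0) ∧
      Tendsto (fun x : ℝ => φ (x + a)) atBot (𝓝 0) := by
  obtain ⟨r, C, δ, hr, hδ, -, hb⟩ := exists_closedBall_bound hdec ha
  have h1 : Tendsto (fun y : ℝ => C * Real.exp (-δ * y)) atTop (𝓝 0) := by
    have := (Real.tendsto_exp_atBot.comp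
      (tendsto_id.const_mul_atTop_of_neg (neg_lt_zero.2 hδ))).const_mul C
    simpa using this
  exact ⟨squeeze_zero_norm (hb a (mem_ball_self hr)) (h1.comp tendsto_abs_atTop_atTop),
    squeeze_zero_norm (hb a (mem_ball_self hr)) (h1.comp tendsto_abs_atBot_atTop)⟩

/-- The derivative of a decaying holomorphic function has zero integral along horizontal lines. -/
theorem integral_horizontal_deriv_eq_zero {φ φ' : ℂ → ℂ} {α β : ℝ}
    (hd : ∀ z ∈ openStrip α β, HasDerivAt φ (φ' z) z)
    (hφ' : DifferentiableOn ℂ φ' (openStrip α β))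
    (hdec : HasStripDecay φ α β) (hdec' : HasStripDecay φ' α β) {a : ℂ}
    (ha : a ∈ openStrip α β) : ∫ x : ℝ, φ' (x + a) = 0 := by
  obtain ⟨h1, h2⟩ := tendsto_horizontal_atTop hdec ha
  have := integral_of_hasDerivAt_of_tendsto (f := fun x : ℝ => φ (x + a))
    (f' := fun x : ℝ => φ' (x + a)) (fun x => ?_) (integrable_horizontal hφ' hdec' ha) h2 h1
  · simpa using this
  · have h3 := hd _ (add_ofReal_mem_openStrip ha x)
    exact (HasDerivAt.comp_add_const (x : ℂ) a h3).comp_ofReal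

section SinhIntegrals

variable {α β : ℝ}

theorem expTail_inv_sinh_one (Y : ℝ) : ExpTail (fun w => (Complex.sinh w)⁻¹) Y (-1) := by
  simpa using ExpTail.inv_sinh (Y := Y) one_pos

theorem expTail_inv_sinh_cube (Y : ℝ) : ExpTail (fun w => (Complex.sinh w)⁻¹ ^ 3) Y (-1) := by
  refine (((expTail_inv_sinh_one Y).mul (expTail_inv_sinh_one Y)).mul
    (expTail_inv_sinh_one Y)).mono (by norm_num) |>.congr fun z _ => by ring

theorem expTail_cosh_mul_inv_sinh_sq (Y : ℝ) :
    ExpTail (fun w => Complex.cosh w * (Complex.sinh w)⁻¹ ^ 2) Y (-1) := by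
  refine (ExpTail.cosh.mul ((expTail_inv_sinh_one Y).mul (expTail_inv_sinh_one Y))).mono
    (by norm_num) |>.congr fun z _ => by ring

theorem differentiableOn_inv_sinh
    (hs : ∀ z ∈ openStrip α β, Complex.sinh z ≠ 0) :
    DifferentiableOn ℂ (fun w => (Complex.sinh w)⁻¹) (openStrip α β) :=
  Complex.differentiable_sinh.differentiableOn.inv hs

theorem integrable_inv_sinh
    (hs : ∀ z ∈ openStrip α β, Complex.sinh z ≠ 0) {a : ℂ}
    (ha : a ∈ openStrip α β) :
    Integrable (fun x : ℝ => (Complex.sinh (x + a))⁻¹) :=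
  integrable_horizontal (differentiableOn_inv_sinh hs)
    (ExpTail.hasStripDecay (by norm_num) expTail_inv_sinh_one
      (differentiableOn_inv_sinh hs).continuousOn) ha

theorem integrable_inv_sinh_cube
    (hs : ∀ z ∈ openStrip α β, Complex.sinh z ≠ 0) {a : ℂ}
    (ha : a ∈ openStrip α β) :
    Integrable (fun x : ℝ => (Complex.sinh (x + a))⁻¹ ^ 3) :=
  integrable_horizontal (φ := fun w => (Complex.sinh w)⁻¹ ^ 3)
    ((differentiableOn_inv_sinh hs).pow 3)
    (ExpTail.hasStripDecay (by norm_num) expTail_inv_sinh_cube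
      ((differentiableOn_inv_sinh hs).pow 3).continuousOn) ha

theorem differentiableOn_cosh_mul_inv_sinh_sq
    (hs : ∀ z ∈ openStrip α β, Complex.sinh z ≠ 0) :
    DifferentiableOn ℂ (fun w => Complex.cosh w * (Complex.sinh w)⁻¹ ^ 2) (openStrip α β) :=
  Complex.differentiable_cosh.differentiableOn.mul ((differentiableOn_inv_sinh hs).pow 2)

theorem hasStripDecay_cosh_mul_inv_sinh_sq
    (hs : ∀ z ∈ openStrip α β, Complex.sinh z ≠ 0) :
    HasStripDecay (fun w => Complex.cosh w * (Complex.sinh w)⁻¹ ^ 2) α β :=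
  ExpTail.hasStripDecay (by norm_num) expTail_cosh_mul_inv_sinh_sq
    (differentiableOn_cosh_mul_inv_sinh_sq hs).continuousOn

theorem integrable_cosh_mul_inv_sinh_sq
    (hs : ∀ z ∈ openStrip α β, Complex.sinh z ≠ 0) {a : ℂ}
    (ha : a ∈ openStrip α β) :
    Integrable (fun x : ℝ => Complex.cosh (x + a) * (Complex.sinh (x + a))⁻¹ ^ 2) :=
  integrable_horizontal (φ := fun w => Complex.cosh w * (Complex.sinh w)⁻¹ ^ 2)
    (differentiableOn_cosh_mul_inv_sinh_sq hs) (hasStripDecay_cosh_mul_inv_sinh_sq hs) ha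

theorem integral_cosh_mul_inv_sinh_sq
    (hs : ∀ z ∈ openStrip α β, Complex.sinh z ≠ 0) {a : ℂ}
    (ha : a ∈ openStrip α β) :
    ∫ x : ℝ, Complex.cosh (x + a) * (Complex.sinh (x + a))⁻¹ ^ 2 = 0 := by
  refine integral_horizontal_deriv_eq_zero (φ := fun w => -(Complex.sinh w)⁻¹)
    (φ' := fun w => Complex.cosh w * (Complex.sinh w)⁻¹ ^ 2) (fun z hz => ?_)
    (differentiableOn_cosh_mul_inv_sinh_sq hs) ?_ (hasStripDecay_cosh_mul_inv_sinh_sq hs) ha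
  · have := ((Complex.hasDerivAt_sinh z).inv (hs z hz)).neg
    exact this.congr_deriv (by ring)
  · refine ExpTail.hasStripDecay (κ := -1) (by norm_num) (fun Y => ?_)
      (differentiableOn_inv_sinh hs).neg.continuousOn
    exact ((expTail_inv_sinh_one Y).const_mul (-1)).congr fun z _ => by simp

theorem integral_inv_sinh_cube
    (hs : ∀ z ∈ openStrip α β, Complex.sinh z ≠ 0) {a : ℂ}
    (ha : a ∈ openStrip α β) :
    ∫ x : ℝ, (Complex.sinh (x + a))⁻¹ ^ 3 = -(1 / 2) * ∫ x : ℝ, (Complex.sinh (x + a))⁻¹ := by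
  have hd : DifferentiableOn ℂ
      (fun w => -(Complex.sinh w)⁻¹ - 2 * (Complex.sinh w)⁻¹ ^ 3) (openStrip α β) :=
    (differentiableOn_inv_sinh hs).neg.sub (((differentiableOn_inv_sinh hs).pow 3).const_mul 2)
  have h0 : ∫ x : ℝ, (-(Complex.sinh (x + a))⁻¹ - 2 * (Complex.sinh (x + a))⁻¹ ^ 3) = 0 := by
    refine integral_horizontal_deriv_eq_zero
      (φ' := fun w => -(Complex.sinh w)⁻¹ - 2 * (Complex.sinh w)⁻¹ ^ 3) (fun z hz => ?_) hd
      (hasStripDecay_cosh_mul_inv_sinh_sq hs) ?_ ha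
    · have := (Complex.hasDerivAt_cosh z).mul (((Complex.hasDerivAt_sinh z).inv (hs z hz)).pow 2)
      refine this.congr_deriv ?_
      have h1 := hs z hz
      have h2 := Complex.cosh_sq z
      simp only [Pi.pow_apply, Pi.inv_apply, Nat.cast_ofNat, Nat.add_one_sub_one, pow_one]
      field_simp
      linear_combination -2 * h2
    · refine ExpTail.hasStripDecay (κ := -1) (by norm_num) (fun Y => ?_) hd.continuousOn
      exact (((expTail_inv_sinh_one Y).const_mul (-1)).sub
        ((expTail_inv_sinh_cube Y).const_mul 2)).congr fun z _ => by simp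
  rw [integral_sub (integrable_inv_sinh hs ha).fun_neg ((integrable_inv_sinh_cube hs ha).const_mul 2),
    integral_neg, integral_const_mul] at h0
  linear_combination (-1 / 2) * h0

end SinhIntegrals

theorem integrable_inv_cosh : Integrable (fun t : ℝ => (Real.cosh t)⁻¹) := by
  refine ((integrable_exp_neg_mul_abs one_pos).const_mul 2).mono'
    (Real.continuous_cosh.inv₀ fun x => (Real.cosh_pos x).ne').aestronglyMeasurable
    (Eventually.of_forall fun t => ?_)
  rw [norm_inv, Real.norm_of_nonneg (Real.cosh_pos t).le, neg_mul, one_mul, Real.exp_neg,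
    ← div_eq_mul_inv, inv_le_comm₀ (Real.cosh_pos t) (by positivity), inv_div, ← Real.cosh_abs,
    Real.cosh_eq]
  linarith [Real.exp_pos (-|t|)]

theorem integral_inv_cosh : ∫ t : ℝ, (Real.cosh t)⁻¹ = π := by
  have := integral_of_hasDerivAt_of_tendsto (f := fun t : ℝ => Real.arctan (Real.sinh t))
    (f' := fun t => (Real.cosh t)⁻¹) (m := -(π / 2)) (n := π / 2) (fun t => ?_)
    integrable_inv_cosh ?_ ?_
  · rw [this]; ring
  · refine (Real.hasDerivAt_sinh t).arctan.congr_deriv ?_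
    have h1 := Real.cosh_sq t
    have h2 := (Real.cosh_pos t).ne'
    rw [add_comm 1, ← h1]
    field_simp
  · exact (Real.tendsto_arctan_atBot.mono_right nhdsWithin_le_nhds).comp Real.sinhOrderIso.tendsto_atBot
  · exact (Real.tendsto_arctan_atTop.mono_right nhdsWithin_le_nhds).comp Real.sinhOrderIso.tendsto_atTop

theorem integral_inv_sinh_upper {a : ℂ} (ha : a ∈ openStrip 0 π) :
    ∫ x : ℝ, (Complex.sinh (x + a))⁻¹ = -(π * Complex.I) := by
  have hs : ∀ z ∈ openStrip 0 π, Complex.sinh z ≠ 0 :=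
    fun z => Complex.sinh_ne_zero_of_mem_openStrip
  have hm : (π / 2 : ℝ) * Complex.I ∈ openStrip 0 π := by
    constructor <;> simp <;> linarith [pi_pos]
  have hd := differentiableOn_inv_sinh hs
  rw [integral_horizontal_eq (φ := fun w => (Complex.sinh w)⁻¹) hd
    (ExpTail.hasStripDecay (by norm_num) expTail_inv_sinh_one hd.continuousOn) ha hm]
  have : ∀ x : ℝ, (Complex.sinh (x + (π / 2 : ℝ) * Complex.I))⁻¹ =
      -Complex.I * ((Real.cosh x)⁻¹ : ℝ) := by
    intro x
    rw [Complex.sinh_add, Complex.sinh_mul_I, Complex.cosh_mul_I]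
    push_cast
    rw [Complex.cos_pi_div_two, Complex.sin_pi_div_two]
    simp [mul_comm]
  simp_rw [this]
  rw [integral_const_mul, integral_complex_ofReal, integral_inv_cosh]
  ring

theorem integral_inv_sinh_lower {a : ℂ} (ha : a ∈ openStrip (-π) 0) :
    ∫ x : ℝ, (Complex.sinh (x + a))⁻¹ = π * Complex.I := by
  have ha' : -a ∈ openStrip 0 π := ⟨by simpa using ha.2, by simpa using neg_lt_neg ha.1⟩
  rw [← integral_neg_eq_self (μ := volume)]
  have : ∀ x : ℝ, (Complex.sinh ((-x : ℝ) + a))⁻¹ = -(Complex.sinh (x + -a))⁻¹ := by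
    intro x
    rw [← inv_neg, ← Complex.sinh_neg]
    push_cast
    ring_nf
  simp_rw [this]
  rw [integral_neg, integral_inv_sinh_upper ha', neg_neg]

theorem norm_exp_line (ε : ℝ) (z : ℂ) (t : ℝ) :
    ‖Complex.exp (-2 * Complex.I * z * (t + Complex.I * ε))‖ =
      Real.exp (2 * ε * z.re + 2 * z.im * t) := by
  rw [Complex.norm_exp]
  congr 1
  simp
  ring

/-- The Fourier-type transform of a function `K` on the line `ℝ + iε`. -/
def lineTransform (ε : ℝ) (K : ℝ → ℂ) (z : ℂ) : ℂ :=
  ∫ t : ℝ, Complex.exp (-2 * Complex.I * z * (t + Complex.I * ε)) * K t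

section LineTransform

variable {ε A κ : ℝ} {K : ℝ → ℂ}

theorem norm_line_integrand_le (hb : ∀ t, ‖K t‖ ≤ A * Real.exp (-κ * |t|)) {Y : ℝ} {z : ℂ}
    (hz : |z.im| ≤ Y) (t : ℝ) :
    ‖Complex.exp (-2 * Complex.I * z * (t + Complex.I * ε)) * K t‖ ≤
      Real.exp (2 * ε * z.re) * (A * Real.exp (-(κ - 2 * Y) * |t|)) := by
  have hA : 0 ≤ A := nonneg_of_mul_nonneg_left ((norm_nonneg _).trans (hb 0)) (Real.exp_pos _)
  rw [norm_mul, norm_exp_line]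
  calc _ ≤ Real.exp (2 * ε * z.re + 2 * Y * |t|) * (A * Real.exp (-κ * |t|)) := by
        gcongr ?_ * ?_
        · rw [Real.exp_le_exp]
          have : z.im * t ≤ |z.im| * |t| := by rw [← abs_mul]; exact le_abs_self _
          nlinarith [abs_nonneg t]
        · exact hb t
    _ = _ := by
        rw [show -(κ - 2 * Y) * |t| = 2 * Y * |t| + -κ * |t| by ring, Real.exp_add, Real.exp_add]
        ring

theorem integrable_line (hK : Continuous K) (hb : ∀ t, ‖K t‖ ≤ A * Real.exp (-κ * |t|)) {z : ℂ}
    (hz : 2 * |z.im| < κ) :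
    Integrable fun t : ℝ => Complex.exp (-2 * Complex.I * z * (t + Complex.I * ε)) * K t :=
  (((integrable_exp_neg_mul_abs (sub_pos.2 hz)).const_mul A).const_mul _).mono'
    (by fun_prop) (Eventually.of_forall (norm_line_integrand_le hb le_rfl))

theorem exists_norm_lineTransform_le (hb : ∀ t, ‖K t‖ ≤ A * Real.exp (-κ * |t|)) {Y : ℝ} (hY : 2 * Y < κ) :
    ∃ C : ℝ, ∀ z : ℂ, |z.im| ≤ Y → ‖lineTransform ε K z‖ ≤ C * Real.exp (2 * ε * z.re) := by
  refine ⟨∫ t : ℝ, A * Real.exp (-(κ - 2 * Y) * |t|), fun z hz => ?_⟩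
  rw [mul_comm, ← integral_const_mul]
  exact norm_integral_le_of_norm_le
    (((integrable_exp_neg_mul_abs (sub_pos.2 hY)).const_mul A).const_mul _)
    (Eventually.of_forall (norm_line_integrand_le hb hz))

theorem hasDerivAt_lineTransform (hK : Continuous K)
    (hb : ∀ t, ‖K t‖ ≤ A * Real.exp (-κ * |t|)) {z : ℂ} (hz : 2 * |z.im| < κ) :
    HasDerivAt (lineTransform ε K)
      (∫ t : ℝ, -2 * Complex.I * (t + Complex.I * ε) *
        (Complex.exp (-2 * Complex.I * z * (t + Complex.I * ε)) * K t)) z := by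
  have hA : 0 ≤ A := nonneg_of_mul_nonneg_left ((norm_nonneg _).trans (hb 0)) (Real.exp_pos _)
  obtain ⟨Y, hY1, hY2⟩ := exists_between (show |z.im| < κ / 2 by linarith)
  have hball : ∀ y ∈ ball z (Y - |z.im|), |y.im| ≤ Y ∧ |y.re| ≤ |z.re| + (Y - |z.im|) := by
    intro y hy
    have h1 := (Complex.abs_im_le_norm _).trans (mem_ball_iff_norm.1 hy).le
    have h2 := (Complex.abs_re_le_norm _).trans (mem_ball_iff_norm.1 hy).le
    have h3 := abs_add_le z.im (y - z).im
    have h4 := abs_add_le z.re (y - z).re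
    simp only [Complex.sub_im, Complex.sub_re, add_sub_cancel] at *
    constructor <;> linarith
  have := hasDerivAt_integral_of_bounded_on_ball (a := z) (r := Y - |z.im|)
    (h := fun z t => Complex.exp (-2 * Complex.I * z * (t + Complex.I * ε)) * K t)
    (bound := fun t => Real.exp (2 * (|ε| * (|z.re| + (Y - |z.im|)))) *
      (A * Real.exp (-(κ - 2 * Y) * |t|)))
    (by linarith) (fun y _ => by fun_prop) (fun t => by fun_prop) (fun y hy t => ?_)
    (((integrable_exp_neg_mul_abs (by linarith)).const_mul A).const_mul _)
  · refine this.congr_deriv (integral_congr_ae (Eventually.of_forall fun t => ?_))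
    have h5 : HasDerivAt (fun z : ℂ => Complex.exp (-2 * Complex.I * z * (t + Complex.I * ε)) * K t)
        (Complex.exp (-2 * Complex.I * z * (t + Complex.I * ε)) *
          (-2 * Complex.I * 1 * (t + Complex.I * ε)) * K t) z :=
      ((((hasDerivAt_id z).const_mul (-2 * Complex.I)).mul_const _).cexp).mul_const _
    simp only [h5.deriv]
    ring
  · obtain ⟨h1, h2⟩ := hball y hy
    refine (norm_line_integrand_le hb h1 t).trans ?_
    refine mul_le_mul_of_nonneg_right (Real.exp_le_exp.2 ?_) (by positivity)
    have h3 : ε * y.re ≤ |ε| * |y.re| := by rw [← abs_mul]; exact le_abs_self _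
    have h4 : |ε| * |y.re| ≤ |ε| * (|z.re| + (Y - |z.im|)) := by gcongr
    linarith

theorem differentiableOn_lineTransform (hK : Continuous K)
    (hb : ∀ t, ‖K t‖ ≤ A * Real.exp (-κ * |t|)) :
    DifferentiableOn ℂ (lineTransform ε K) (openStrip (-(κ / 2)) (κ / 2)) := fun z hz =>
  (hasDerivAt_lineTransform hK hb (by
    linarith [abs_lt.2 hz])).differentiableAt.differentiableWithinAt

end LineTransform

theorem inv_norm_sinh_line_le {a ε : ℝ} (ha : 0 < a) (h1 : 0 < ε * a) (h2 : ε * a < π) (t : ℝ) :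
    ‖(Complex.sinh ((t + Complex.I * ε) * a))⁻¹‖ ≤
      2 / Real.sin (ε * a) * Real.exp (-a * |t|) := by
  have h := Complex.abs_sin_im_mul_exp_le_norm_sinh ((t + Complex.I * ε) * a)
  have hs := Real.sin_pos_of_pos_of_lt_pi h1 h2
  have him : ((t + Complex.I * ε) * a).im = ε * a := by simp
  have hre : ((t + Complex.I * ε) * a).re = t * a := by simp
  rw [him, hre, abs_of_pos hs, abs_mul, abs_of_pos ha] at h
  rw [norm_inv]
  refine (inv_anti₀ (by positivity) h).trans_eq ?_
  rw [neg_mul, mul_comm a, Real.exp_neg]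
  field_simp

theorem sinh_line_ne_zero {a ε : ℝ} (h1 : 0 < ε * a) (h2 : ε * a < π) (t : ℝ) :
    Complex.sinh ((t + Complex.I * ε) * a) ≠ 0 :=
  Complex.sinh_ne_zero_of_mem_openStrip ⟨by simpa using h1, by simpa using h2⟩

theorem inv_norm_line_le {ε : ℝ} (hε : 0 < ε) (t : ℝ) : ‖((t : ℂ) + Complex.I * ε)⁻¹‖ ≤ ε⁻¹ := by
  rw [norm_inv]
  refine inv_anti₀ hε ?_
  have := Complex.abs_im_le_norm ((t : ℂ) + Complex.I * ε)
  simpa [abs_of_pos hε] using this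

theorem line_ne_zero {ε : ℝ} (hε : 0 < ε) (t : ℝ) : ((t : ℂ) + Complex.I * ε) ≠ 0 := fun h => by
  have := congrArg Complex.im h
  simp at this
  exact hε.ne' this

/-- Contour shift across a removable singularity at `0`. -/
theorem integral_horizontal_eq_of_removable {f : ℂ → ℂ} {h κ : ℝ} (hκ : κ < 0)
    (hf : DifferentiableOn ℂ f (openStrip (-h) h \ {0}))
    (h0 : Tendsto (fun w => w * f w) (𝓝[≠] 0) (𝓝 0)) (htail : ∀ Y, ExpTail f Y κ) {a a' : ℂ}
    (ha : a ∈ openStrip (-h) h) (ha' : a' ∈ openStrip (-h) h) (ha0 : a.im ≠ 0)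
    (ha0' : a'.im ≠ 0) : ∫ x : ℝ, f (x + a) = ∫ x : ℝ, f (x + a') := by
  classical
  have hpos : 0 < h := by linarith [ha.1, ha.2]
  have hc : openStrip (-h) h ∈ 𝓝 (0 : ℂ) :=
    (isOpen_openStrip _ _).mem_nhds ⟨by simpa using hpos, by simpa using hpos⟩
  have ho : (fun z => f z - f 0) =o[𝓝[≠] 0] fun z => (z - (0 : ℂ))⁻¹ := by
    rw [Asymptotics.isLittleO_iff_tendsto' (by
      filter_upwards [self_mem_nhdsWithin] with z hz h2
      simp at h2
      exact absurd h2 hz)]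
    have h1 : Tendsto (fun w : ℂ => w * f 0) (𝓝[≠] 0) (𝓝 0) := by
      have : Tendsto (fun w : ℂ => w * f 0) (𝓝 0) (𝓝 (0 * f 0)) := tendsto_id.mul_const _
      rw [zero_mul] at this
      exact this.mono_left nhdsWithin_le_nhds
    simpa [mul_sub, mul_comm] using h0.sub h1
  set g := Function.update f 0 (limUnder (𝓝[≠] 0) f) with hg
  have hgd : DifferentiableOn ℂ g (openStrip (-h) h) :=
    Complex.differentiableOn_update_limUnder_of_isLittleO hc hf ho
  have heq : ∀ z : ℂ, z ≠ 0 → g z = f z := fun z hz => Function.update_of_ne hz _ _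
  have hline : ∀ a : ℂ, a.im ≠ 0 → ∀ x : ℝ, g (x + a) = f (x + a) := fun a ha x =>
    heq _ fun h => ha (by simpa using congrArg Complex.im h)
  have hdec : HasStripDecay g (-h) h := ExpTail.hasStripDecay hκ
    (fun Y => (htail Y).congr fun z hz => heq z (by rintro rfl; simp at hz; linarith))
    hgd.continuousOn
  simpa only [hline a ha0, hline a' ha0'] using integral_horizontal_eq hgd hdec ha ha'

theorem tendsto_sinh_mul_div {a : ℝ} :
    Tendsto (fun w : ℂ => Complex.sinh (w * a) / w) (𝓝[≠] 0) (𝓝 a) := by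
  have h : HasDerivAt (fun w : ℂ => Complex.sinh (w * a)) a 0 := by
    have := ((hasDerivAt_id (0 : ℂ)).mul_const (a : ℂ)).csinh
    simpa using this
  refine h.tendsto_slope.congr fun w => ?_
  simp [slope_def_field]

theorem tendsto_mul_inv_sinh {a : ℝ} (ha : 0 < a) :
    Tendsto (fun w : ℂ => w * (Complex.sinh (w * a))⁻¹) (𝓝[≠] 0) (𝓝 (a : ℂ)⁻¹) := by
  refine (tendsto_sinh_mul_div.inv₀ (by exact_mod_cast ha.ne')).congr fun w => ?_
  rw [inv_div, div_eq_mul_inv]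

section ExpDivSinh

variable {a ε : ℝ} (z : ℂ)

theorem sinh_mul_ne_zero_upper (ha : 0 < a) {w : ℂ} (hw : w ∈ openStrip 0 (π / a)) :
    Complex.sinh (w * a) ≠ 0 := by
  refine Complex.sinh_ne_zero_of_mem_openStrip ⟨?_, ?_⟩
  · simpa using mul_pos hw.1 ha
  · simpa using (lt_div_iff₀ ha).1 hw.2

theorem sinh_mul_ne_zero_of_ne_zero (ha : 0 < a) {w : ℂ}
    (hw : w ∈ openStrip (-(π / a)) (π / a)) (h0 : w ≠ 0) : Complex.sinh (w * a) ≠ 0 := by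
  refine Complex.sinh_ne_zero_of_abs_im_lt ?_ (mul_ne_zero h0 (by exact_mod_cast ha.ne'))
  have := abs_lt.2 hw
  rw [lt_div_iff₀ ha] at this
  simpa [abs_mul, abs_of_pos ha] using this

theorem integral_inv_sinh_mul_upper (ha : 0 < a) (h1 : 0 < ε) (h2 : ε * a < π) :
    ∫ t : ℝ, (Complex.sinh ((t + Complex.I * ε) * a))⁻¹ = -(π * Complex.I) / a := by
  have := integral_inv_sinh_upper (a := Complex.I * (ε * a : ℝ))
    ⟨by simpa using mul_pos h1 ha, by simpa using h2⟩
  have h3 := Measure.integral_comp_mul_right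
    (fun t : ℝ => (Complex.sinh (t + Complex.I * (ε * a : ℝ)))⁻¹) a
  rw [this, abs_of_pos (inv_pos.2 ha)] at h3
  convert h3 using 1
  · congr 1
    ext t
    push_cast
    ring_nf
  · simp
    ring

theorem integral_inv_sinh_mul_lower (ha : 0 < a) (h1 : 0 < ε) (h2 : ε * a < π) :
    ∫ t : ℝ, (Complex.sinh ((t - Complex.I * ε) * a))⁻¹ = π * Complex.I / a := by
  have := integral_inv_sinh_lower (a := -(Complex.I * (ε * a : ℝ)))
    ⟨by simpa using h2, by simpa using mul_pos h1 ha⟩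
  have h3 := Measure.integral_comp_mul_right
    (fun t : ℝ => (Complex.sinh (t + -(Complex.I * (ε * a : ℝ))))⁻¹) a
  rw [this, abs_of_pos (inv_pos.2 ha)] at h3
  convert h3 using 1
  · congr 1
    ext t
    push_cast
    ring_nf
  · simp
    ring

variable {z}

theorem expTail_exp_mul_inv_sinh (ha : 0 < a) (Y : ℝ) :
    ExpTail (fun w => Complex.exp (-2 * Complex.I * z * w) * (Complex.sinh (w * a))⁻¹) Y
      (2 * |z.im| - a) :=
  ((ExpTail.exp z).mul (ExpTail.inv_sinh ha)).mono (by linarith)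

theorem differentiable_exp_neg_two_I_mul :
    Differentiable ℂ fun w : ℂ => Complex.exp (-2 * Complex.I * z * w) := by fun_prop

theorem integral_exp_div_sinh_shift (ha : 0 < a) (h1 : 0 < ε) (h2 : ε * a < π)
    (hz : 2 * |z.im| < a) :
    ∫ t : ℝ, Complex.exp (-2 * Complex.I * z * (t + Complex.I * ε)) *
        (Complex.sinh ((t + Complex.I * ε) * a))⁻¹ =
      -Complex.exp (2 * π * z / a) *
        ∫ t : ℝ, Complex.exp (-2 * Complex.I * z * (t - Complex.I * ε)) *
          (Complex.sinh ((t - Complex.I * ε) * a))⁻¹ := by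
  have hac : (a : ℂ) ≠ 0 := by exact_mod_cast ha.ne'
  have hd : DifferentiableOn ℂ
      (fun w => Complex.exp (-2 * Complex.I * z * w) * (Complex.sinh (w * a))⁻¹)
      (openStrip 0 (π / a)) :=
    differentiable_exp_neg_two_I_mul.differentiableOn.mul
      (DifferentiableOn.inv (by fun_prop) fun w hw => sinh_mul_ne_zero_upper ha hw)
  have h3 : ε < π / a := (lt_div_iff₀ ha).2 h2
  rw [integral_horizontal_eq hd (ExpTail.hasStripDecay (by linarith)
    (expTail_exp_mul_inv_sinh ha) hd.continuousOn) (a := Complex.I * ε)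
    (a' := Complex.I * (π / a - ε : ℝ)) ⟨by simpa using h1, by simpa using h3⟩
    ⟨by simpa using h3, by simpa using h1⟩, ← integral_const_mul]
  congr 1
  ext t
  have e1 : ((t : ℂ) + Complex.I * (π / a - ε : ℝ)) * a =
      (t - Complex.I * ε) * a + π * Complex.I := by
    push_cast
    field_simp
    ring
  have e2 : -2 * Complex.I * z * ((t : ℂ) + Complex.I * (π / a - ε : ℝ)) =
      2 * π * z / a + -2 * Complex.I * z * (t - Complex.I * ε) := by
    push_cast
    linear_combination (-2 * z * (π / a)) * Complex.I_sq
  rw [e1, e2, Complex.exp_add, Complex.sinh_add, Complex.sinh_mul_I, Complex.cosh_mul_I,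
    Complex.sin_pi, Complex.cos_pi]
  simp only [mul_neg, mul_one, zero_mul, mul_zero, add_zero, inv_neg]
  ring

theorem integral_exp_div_sinh_sub (ha : 0 < a) (h1 : 0 < ε) (h2 : ε * a < π)
    (hz : 2 * |z.im| < a) :
    (∫ t : ℝ, Complex.exp (-2 * Complex.I * z * (t + Complex.I * ε)) *
        (Complex.sinh ((t + Complex.I * ε) * a))⁻¹) -
      ∫ t : ℝ, Complex.exp (-2 * Complex.I * z * (t - Complex.I * ε)) *
          (Complex.sinh ((t - Complex.I * ε) * a))⁻¹ = -(2 * π * Complex.I) / a := by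
  have h3 : ε < π / a := (lt_div_iff₀ ha).2 h2
  have hiu : ∀ y : ℂ, 2 * |y.im| < a → ∀ s ∈ openStrip (-(π / a)) (π / a), s.im ≠ 0 →
      Integrable fun t : ℝ => Complex.exp (-2 * Complex.I * y * (t + s)) *
        (Complex.sinh ((t + s) * a))⁻¹ := by
    intro y hy s hs hs0
    have key : ∀ α β : ℝ, s ∈ openStrip α β →
        (∀ w ∈ openStrip α β, w ∈ openStrip (-(π / a)) (π / a) ∧ w ≠ 0) →
        Integrable fun t : ℝ => Complex.exp (-2 * Complex.I * y * (t + s)) *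
          (Complex.sinh ((t + s) * a))⁻¹ := by
      intro α β hsα hw
      have hd : DifferentiableOn ℂ
          (fun w => Complex.exp (-2 * Complex.I * y * w) * (Complex.sinh (w * a))⁻¹)
          (openStrip α β) :=
        differentiable_exp_neg_two_I_mul.differentiableOn.mul
          (DifferentiableOn.inv (by fun_prop) fun w hw' =>
            sinh_mul_ne_zero_of_ne_zero ha (hw w hw').1 (hw w hw').2)
      exact integrable_horizontal hd (ExpTail.hasStripDecay (by linarith)
        (expTail_exp_mul_inv_sinh ha) hd.continuousOn) hsα
    have hpa : 0 < π / a := by positivity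
    rcases lt_or_gt_of_ne hs0 with h | h
    · exact key (-(π / a)) 0 ⟨hs.1, h⟩ fun w hw => ⟨⟨hw.1, hw.2.trans hpa⟩, fun h => by
        have := hw.2
        simp [h] at this⟩
    · exact key 0 (π / a) ⟨h, hs.2⟩ fun w hw => ⟨⟨by linarith [hw.1], hw.2⟩, fun h => by
        have := hw.1
        simp [h] at this⟩
  have hup : Complex.I * ε ∈ openStrip (-(π / a)) (π / a) :=
    ⟨by simp; linarith, by simpa using h3⟩
  have hlow : -(Complex.I * ε) ∈ openStrip (-(π / a)) (π / a) :=
    ⟨by simpa using h3, by simp; linarith⟩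
  have hu0 : (Complex.I * ε).im ≠ 0 := by simpa using h1.ne'
  have hl0 : (-(Complex.I * ε)).im ≠ 0 := by simpa using h1.ne'
  have h := integral_horizontal_eq_of_removable (h := π / a) (κ := 2 * |z.im| - a)
    (f := fun w => Complex.exp (-2 * Complex.I * z * w) * (Complex.sinh (w * a))⁻¹ -
      Complex.exp (-2 * Complex.I * 0 * w) * (Complex.sinh (w * a))⁻¹) (by linarith) ?_ ?_
    (fun Y => (expTail_exp_mul_inv_sinh ha Y).sub ((expTail_exp_mul_inv_sinh ha Y).mono
      (by simp))) hup hlow hu0 hl0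
  · have i0 : 2 * |(0 : ℂ).im| < a := by simpa using ha
    rw [integral_sub (hiu z hz _ hup hu0) (hiu 0 i0 _ hup hu0),
      integral_sub (hiu z hz _ hlow hl0) (hiu 0 i0 _ hlow hl0)] at h
    simp only [mul_zero, zero_mul, Complex.exp_zero, one_mul, ← sub_eq_add_neg,
      integral_inv_sinh_mul_upper ha h1 h2, integral_inv_sinh_mul_lower ha h1 h2] at h
    linear_combination h
  · have hs : DifferentiableOn ℂ (fun w : ℂ => (Complex.sinh (w * a))⁻¹)
        (openStrip (-(π / a)) (π / a) \ {0}) :=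
      DifferentiableOn.inv (by fun_prop) fun w hw => sinh_mul_ne_zero_of_ne_zero ha hw.1 hw.2
    exact (differentiable_exp_neg_two_I_mul.differentiableOn.mul hs).sub
      (differentiable_exp_neg_two_I_mul.differentiableOn.mul hs)
  · have h4 : Tendsto (fun w : ℂ => Complex.exp (-2 * Complex.I * z * w) - 1) (𝓝[≠] 0) (𝓝 0) := by
      have : ContinuousAt (fun w : ℂ => Complex.exp (-2 * Complex.I * z * w) - 1) 0 := by fun_prop
      have := this.tendsto
      simp only [mul_zero, Complex.exp_zero, sub_self] at this
      exact this.mono_left nhdsWithin_le_nhds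
    have h5 := (tendsto_mul_inv_sinh ha).mul h4
    rw [mul_zero] at h5
    refine h5.congr fun w => ?_
    simp only [mul_zero, zero_mul, Complex.exp_zero]
    ring

/-- The kernel whose transform is `log (1 + e^{2πz/a})`. -/
def logKer (a ε : ℝ) (t : ℝ) : ℂ :=
  -(2 * Complex.sinh ((t + Complex.I * ε) * a) * (t + Complex.I * ε))⁻¹

theorem continuous_logKer (ha : 0 < a) (h1 : 0 < ε) (h2 : ε * a < π) :
    Continuous (logKer a ε) := by
  refine (Continuous.inv₀ (by fun_prop) fun t => ?_).neg
  exact mul_ne_zero (mul_ne_zero two_ne_zero (sinh_line_ne_zero (mul_pos h1 ha) h2 t))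
    (line_ne_zero h1 t)

theorem norm_logKer_le (ha : 0 < a) (h1 : 0 < ε) (h2 : ε * a < π) (t : ℝ) :
    ‖logKer a ε t‖ ≤ (Real.sin (ε * a) * ε)⁻¹ * Real.exp (-a * |t|) := by
  have h3 := inv_norm_sinh_line_le ha (mul_pos h1 ha) h2 t
  have h4 := inv_norm_line_le h1 t
  have hs := Real.sin_pos_of_pos_of_lt_pi (mul_pos h1 ha) h2
  rw [logKer, norm_neg, mul_inv, mul_inv, norm_mul, norm_mul]
  calc _ ≤ 2⁻¹ * (2 / Real.sin (ε * a) * Real.exp (-a * |t|)) * ε⁻¹ := by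
        gcongr
        simp
    _ = _ := by field_simp

theorem exp_lineTransform_logKer (ha : 0 < a) (h1 : 0 < ε) (h2 : ε * a < π)
    (hz : 2 * |z.im| < a) :
    Complex.exp (lineTransform ε (logKer a ε) z) = 1 + Complex.exp (2 * π * z / a) := by
  have hac : (a : ℂ) ≠ 0 := by exact_mod_cast ha.ne'
  have hK := continuous_logKer ha h1 h2
  have hb := norm_logKer_le ha h1 h2
  have hmem : ∀ y ∈ openStrip (-(a / 2)) (a / 2), 2 * |y.im| < a := fun y hy => by
    linarith [abs_lt.2 hy]
  have hder : ∀ y ∈ openStrip (-(a / 2)) (a / 2), ∃ D, HasDerivAt (lineTransform ε (logKer a ε)) D y ∧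
      D * (1 + Complex.exp (2 * π * y / a)) = 2 * π / a * Complex.exp (2 * π * y / a) := by
    intro y hy
    refine ⟨_, hasDerivAt_lineTransform hK hb (hmem y hy), ?_⟩
    have e1 := integral_exp_div_sinh_shift ha h1 h2 (hmem y hy)
    have e2 := integral_exp_div_sinh_sub ha h1 h2 (hmem y hy)
    have e3 : ∫ t : ℝ, -2 * Complex.I * (t + Complex.I * ε) *
        (Complex.exp (-2 * Complex.I * y * (t + Complex.I * ε)) * logKer a ε t) =
        Complex.I * ∫ t : ℝ, Complex.exp (-2 * Complex.I * y * (t + Complex.I * ε)) *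
          (Complex.sinh ((t + Complex.I * ε) * a))⁻¹ := by
      rw [← integral_const_mul]
      congr 1
      ext t
      have := sinh_line_ne_zero (mul_pos h1 ha) h2 t
      have := line_ne_zero h1 t
      rw [logKer]
      field_simp
    rw [e3]
    set U := ∫ t : ℝ, Complex.exp (-2 * Complex.I * y * (t + Complex.I * ε)) *
          (Complex.sinh ((t + Complex.I * ε) * a))⁻¹
    set V := ∫ t : ℝ, Complex.exp (-2 * Complex.I * y * (t - Complex.I * ε)) *
          (Complex.sinh ((t - Complex.I * ε) * a))⁻¹
    set E := Complex.exp (2 * π * y / a)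
    linear_combination Complex.I * e1 + Complex.I * E * e2 - 2 * π / a * E * Complex.I_sq
  set G : ℂ → ℂ := fun y =>
    Complex.exp (-lineTransform ε (logKer a ε) y) * (1 + Complex.exp (2 * π * y / a)) with hG
  have hG' : ∀ y ∈ openStrip (-(a / 2)) (a / 2), HasDerivAt G 0 y := by
    intro y hy
    obtain ⟨D, hD, hD'⟩ := hder y hy
    have h3 : HasDerivAt (fun y : ℂ => Complex.exp (2 * π * y / a))
        (Complex.exp (2 * π * y / a) * (2 * π * 1 / a)) y :=
      (((hasDerivAt_id y).const_mul (2 * π : ℂ)).div_const (a : ℂ)).cexp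
    refine (hD.neg.cexp.mul (h3.const_add 1)).congr_deriv ?_
    simp only [Pi.neg_apply]
    linear_combination -Complex.exp (-lineTransform ε (logKer a ε) y) * hD'
  have hconst : ∀ y ∈ openStrip (-(a / 2)) (a / 2), ∀ y' ∈ openStrip (-(a / 2)) (a / 2),
      G y = G y' := fun y hy y' hy' =>
    (isOpen_openStrip _ _).is_const_of_deriv_eq_zero (convex_openStrip _ _).isPreconnected
      (fun x hx => (hG' x hx).differentiableAt.differentiableWithinAt)
      (fun x hx => (hG' x hx).deriv) hy hy'
  have hlim : Tendsto (fun x : ℝ => G x) atBot (𝓝 1) := by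
    obtain ⟨C, hC⟩ := exists_norm_lineTransform_le (ε := ε) hb (Y := 0) (by simpa using ha)
    have l1 : Tendsto (fun x : ℝ => lineTransform ε (logKer a ε) x) atBot (𝓝 0) := by
      refine squeeze_zero_norm (fun x => hC x (by simp)) ?_
      have := (Real.tendsto_exp_atBot.comp
        (tendsto_id.const_mul_atBot (show 0 < 2 * ε by positivity))).const_mul C
      simpa using this
    have l2 : Tendsto (fun x : ℝ => Complex.exp (2 * π * x / a)) atBot (𝓝 0) := by
      have h4 := Real.tendsto_exp_atBot.comp
        (tendsto_id.const_mul_atBot (show 0 < 2 * π / a by positivity))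
      refine squeeze_zero_norm (fun x => ?_) h4
      rw [show (2 * π * x / a : ℂ) = ((2 * π / a * x : ℝ) : ℂ) by push_cast; ring,
        Complex.norm_exp_ofReal]
      rfl
    have := (Complex.continuous_exp.tendsto _).comp l1.neg |>.mul (l2.const_add 1)
    simpa using this
  have hreal : ∀ x : ℝ, (x : ℂ) ∈ openStrip (-(a / 2)) (a / 2) := fun x =>
    ⟨by simpa using ha, by simpa using ha⟩
  have hG0 : ∀ x : ℝ, G x = G 0 := fun x => hconst x (hreal x) 0 (by simpa using hreal 0)
  simp only [hG0] at hlim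
  have h5 : G 0 = 1 := tendsto_nhds_unique tendsto_const_nhds hlim
  have hzs : z ∈ openStrip (-(a / 2)) (a / 2) := abs_lt.1 (by linarith)
  have h6 : G z = 1 := by rw [← h5]; exact hconst z hzs 0 (by simpa using hreal 0)
  rw [hG] at h6
  simp only [Complex.exp_neg] at h6
  have h7 := Complex.exp_ne_zero (lineTransform ε (logKer a ε) z)
  field_simp at h6
  exact h6.symm

end ExpDivSinh

/-- The height of the contour in the definition of `PhiS`. -/
def contourHeight (b : ℝ) : ℝ := π * min b b⁻¹ / 2

/-- The kernel of the integral defining `log Φ_𝖻`, restricted to the contour. -/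
def phiLineKer (b t : ℝ) : ℂ :=
  (4 * Complex.sinh ((t + Complex.I * contourHeight b) * b) *
    Complex.sinh ((t + Complex.I * contourHeight b) * (b⁻¹ : ℝ)) *
      (t + Complex.I * contourHeight b))⁻¹

/-- The logarithm of `Φ_𝖻` on the strip `|Im z| < Im c_𝖻`. -/
def logPhi (b : ℝ) (z : ℂ) : ℂ := lineTransform (contourHeight b) (phiLineKer b) z

theorem PhiS_eq_exp_logPhi (b : ℝ) (z : ℂ) : PhiS b z = Complex.exp (logPhi b z) := by
  unfold PhiS logPhi lineTransform phiKer phiLineKer contourHeight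
  push_cast
  simp only [div_eq_mul_inv]

theorem contourHeight_inv (b : ℝ) : contourHeight b⁻¹ = contourHeight b := by
  unfold contourHeight
  rw [inv_inv, min_comm]

theorem phiLineKer_inv (b : ℝ) : phiLineKer b⁻¹ = phiLineKer b := by
  ext t
  unfold phiLineKer
  rw [contourHeight_inv, inv_inv]
  ring_nf

theorem PhiS_inv (b : ℝ) : PhiS b⁻¹ = PhiS b := by
  ext z
  rw [PhiS_eq_exp_logPhi, PhiS_eq_exp_logPhi, logPhi, logPhi, phiLineKer_inv, contourHeight_inv]

section

variable {b : ℝ}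

theorem contourHeight_pos (hb : 0 < b) : 0 < contourHeight b := by
  unfold contourHeight
  positivity

theorem two_mul_contourHeight_mul_le (hb : 0 < b) : 2 * contourHeight b * b ≤ π := by
  unfold contourHeight
  have h : min b b⁻¹ * b ≤ b⁻¹ * b := by gcongr; exact min_le_right _ _
  rw [inv_mul_cancel₀ hb.ne'] at h
  nlinarith [pi_pos]

theorem two_mul_contourHeight_mul_inv_le (hb : 0 < b) : 2 * contourHeight b * b⁻¹ ≤ π := by
  rw [← contourHeight_inv]
  exact two_mul_contourHeight_mul_le (inv_pos.2 hb)

theorem contourHeight_mul_lt (hb : 0 < b) : contourHeight b * b < π := by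
  linarith [two_mul_contourHeight_mul_le hb, mul_pos (contourHeight_pos hb) hb]

theorem contourHeight_mul_inv_lt (hb : 0 < b) : contourHeight b * b⁻¹ < π := by
  linarith [two_mul_contourHeight_mul_inv_le hb, mul_pos (contourHeight_pos hb) (inv_pos.2 hb)]

theorem two_mul_contourHeight_le (hb : 0 < b) : 2 * contourHeight b ≤ π := by
  rcases le_total 1 b with h | h
  · nlinarith [two_mul_contourHeight_mul_le hb, contourHeight_pos hb]
  · nlinarith [two_mul_contourHeight_mul_inv_le hb, contourHeight_pos hb, (one_le_inv₀ hb).2 h]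

theorem continuous_phiLineKer (hb : 0 < b) : Continuous (phiLineKer b) := by
  refine Continuous.inv₀ (by fun_prop) fun t => ?_
  have h1 := contourHeight_pos hb
  exact mul_ne_zero (mul_ne_zero (mul_ne_zero (by norm_num)
    (sinh_line_ne_zero (mul_pos h1 hb) (contourHeight_mul_lt hb) t))
    (sinh_line_ne_zero (mul_pos h1 (inv_pos.2 hb)) (contourHeight_mul_inv_lt hb) t))
    (line_ne_zero h1 t)

theorem exists_norm_phiLineKer_le (hb : 0 < b) :
    ∃ A, ∀ t, ‖phiLineKer b t‖ ≤ A * Real.exp (-(b + b⁻¹) * |t|) := by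
  have h0 := contourHeight_pos hb
  have hbi := inv_pos.2 hb
  have hs1 := Real.sin_pos_of_pos_of_lt_pi (mul_pos h0 hb) (contourHeight_mul_lt hb)
  have hs2 := Real.sin_pos_of_pos_of_lt_pi (mul_pos h0 hbi) (contourHeight_mul_inv_lt hb)
  refine ⟨4⁻¹ * (2 / Real.sin (contourHeight b * b)) * (2 / Real.sin (contourHeight b * b⁻¹)) *
    (contourHeight b)⁻¹, fun t => ?_⟩
  have h1 := inv_norm_sinh_line_le hb (mul_pos h0 hb) (contourHeight_mul_lt hb) t
  have h2 := inv_norm_sinh_line_le hbi (mul_pos h0 hbi) (contourHeight_mul_inv_lt hb) t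
  have h3 := inv_norm_line_le h0 t
  rw [phiLineKer, mul_inv, mul_inv, mul_inv, norm_mul, norm_mul, norm_mul]
  calc _ ≤ 4⁻¹ * (2 / Real.sin (contourHeight b * b) * Real.exp (-b * |t|)) *
        (2 / Real.sin (contourHeight b * b⁻¹) * Real.exp (-b⁻¹ * |t|)) * (contourHeight b)⁻¹ := by
        gcongr
        simp
    _ = _ := by
      rw [show -(b + b⁻¹) * |t| = -b * |t| + -b⁻¹ * |t| by ring, Real.exp_add]
      ring

theorem differentiableOn_logPhi (hb : 0 < b) :
    DifferentiableOn ℂ (logPhi b) (openStrip (-((b + b⁻¹) / 2)) ((b + b⁻¹) / 2)) := by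
  obtain ⟨A, hA⟩ := exists_norm_phiLineKer_le hb
  exact differentiableOn_lineTransform (continuous_phiLineKer hb) hA

theorem differentiableOn_PhiS (hb : 0 < b) :
    DifferentiableOn ℂ (PhiS b) (openStrip (-((b + b⁻¹) / 2)) ((b + b⁻¹) / 2)) := by
  rw [show PhiS b = fun z => Complex.exp (logPhi b z) from funext (PhiS_eq_exp_logPhi b)]
  exact (differentiableOn_logPhi hb).cexp

theorem PhiS_ne_zero (b : ℝ) (z : ℂ) : PhiS b z ≠ 0 := Complex.exp_ne_zero _

theorem exists_norm_logPhi_le (hb : 0 < b) {Y : ℝ} (hY : Y < (b + b⁻¹) / 2) :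
    ∃ C : ℝ, ∀ z : ℂ, |z.im| ≤ Y → ‖logPhi b z‖ ≤ C * Real.exp (2 * contourHeight b * z.re) := by
  obtain ⟨A, hA⟩ := exists_norm_phiLineKer_le hb
  exact exists_norm_lineTransform_le hA (by linarith)

theorem logPhi_sub_eq (hb : 0 < b) {z : ℂ} (hz : 2 * |z.im| < b⁻¹) :
    logPhi b (z - Complex.I * b / 2) - logPhi b (z + Complex.I * b / 2) =
      lineTransform (contourHeight b) (logKer b⁻¹ (contourHeight b)) z := by
  obtain ⟨A, hA⟩ := exists_norm_phiLineKer_le hb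
  have hK := continuous_phiLineKer hb
  have h0 := contourHeight_pos hb
  have h1 : |(z - Complex.I * b / 2).im| ≤ |z.im| + b / 2 := by
    simpa [abs_of_pos (half_pos hb)] using abs_sub z.im (b / 2)
  have h2 : |(z + Complex.I * b / 2).im| ≤ |z.im| + b / 2 := by
    simpa [abs_of_pos (half_pos hb)] using abs_add_le z.im (b / 2)
  rw [logPhi, logPhi, lineTransform, lineTransform, lineTransform,
    ← integral_sub (integrable_line hK hA (by linarith)) (integrable_line hK hA (by linarith))]
  congr 1
  ext t
  have n1 := sinh_line_ne_zero (mul_pos h0 hb) (contourHeight_mul_lt hb) t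
  have n2 := sinh_line_ne_zero (mul_pos h0 (inv_pos.2 hb)) (contourHeight_mul_inv_lt hb) t
  have n3 := line_ne_zero h0 t
  rw [phiLineKer, logKer]
  set w : ℂ := t + Complex.I * contourHeight b
  have e1 : -2 * Complex.I * (z - Complex.I * b / 2) * w = -2 * Complex.I * z * w + -(w * b) := by
    linear_combination (b * w) * Complex.I_sq
  have e2 : -2 * Complex.I * (z + Complex.I * b / 2) * w = -2 * Complex.I * z * w + w * b := by
    linear_combination (-b * w) * Complex.I_sq
  have e3 : Complex.exp (w * b) - Complex.exp (-(w * b)) = 2 * Complex.sinh (w * b) := by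
    rw [Complex.sinh]; ring
  rw [e1, e2, Complex.exp_add, Complex.exp_add]
  have e4 : Complex.exp (-(w * b)) = Complex.exp (w * b) - 2 * Complex.sinh (w * b) := by
    rw [← e3]; ring
  rw [e4]
  field_simp
  ring

theorem PhiS_sub_eq (hb : 0 < b) {z : ℂ} (hz : 2 * |z.im| < b⁻¹) :
    PhiS b (z - Complex.I * b / 2) =
      (1 + Complex.exp (2 * π * b * z)) * PhiS b (z + Complex.I * b / 2) := by
  have h := exp_lineTransform_logKer (inv_pos.2 hb) (contourHeight_pos hb)
    (contourHeight_mul_inv_lt hb) hz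
  rw [← logPhi_sub_eq hb hz, Complex.exp_sub, div_eq_iff (Complex.exp_ne_zero _),
    ← PhiS_eq_exp_logPhi, ← PhiS_eq_exp_logPhi] at h
  rw [h]
  congr 3
  push_cast
  field_simp

theorem PhiS_eq_Efac_mul (hb : 0 < b) {z : ℂ} (h1 : -((b + b⁻¹) / 2) < z.im)
    (h2 : z.im + b < (b + b⁻¹) / 2) :
    PhiS b z = Efac b z * PhiS b (z + Complex.I * b) := by
  have h := PhiS_sub_eq hb (z := z + Complex.I * b / 2) (by
    have : |(z + Complex.I * b / 2).im| < b⁻¹ / 2 := by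
      rw [abs_lt]
      constructor <;> simp <;> linarith
    linarith)
  rw [Efac]
  convert h using 2
  · ring_nf
  · ring_nf

end

/-- `f(w) = f₀ + f₁ w + f₂ w² + o(w²)` as `w → 0`. -/
def HasQuadraticJet (f : ℂ → ℂ) (f₀ f₁ f₂ : ℂ) : Prop :=
  (fun w => f w - (f₀ + f₁ * w + f₂ * w ^ 2)) =o[𝓝[≠] 0] fun w : ℂ => w ^ 2

namespace HasQuadraticJet

variable {f g : ℂ → ℂ} {f₀ f₁ f₂ g₀ g₁ g₂ : ℂ}

theorem add (hf : HasQuadraticJet f f₀ f₁ f₂) (hg : HasQuadraticJet g g₀ g₁ g₂) :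
    HasQuadraticJet (fun w => f w + g w) (f₀ + g₀) (f₁ + g₁) (f₂ + g₂) := by
  refine (Asymptotics.IsLittleO.add hf hg).congr_left fun w => ?_
  ring

theorem const_mul (hf : HasQuadraticJet f f₀ f₁ f₂) (k : ℂ) :
    HasQuadraticJet (fun w => k * f w) (k * f₀) (k * f₁) (k * f₂) := by
  refine (Asymptotics.IsLittleO.const_mul_left hf k).congr_left fun w => ?_
  ring

theorem const (k : ℂ) : HasQuadraticJet (fun _ => k) k 0 0 := by
  simp [HasQuadraticJet]

theorem isBigO_polynomial (f₀ f₁ f₂ : ℂ) :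
    (fun w : ℂ => f₀ + f₁ * w + f₂ * w ^ 2) =O[𝓝[≠] 0] fun _ => (1 : ℂ) := by
  have : ContinuousAt (fun w : ℂ => f₀ + f₁ * w + f₂ * w ^ 2) 0 := by fun_prop
  exact (this.tendsto.isBigO_one ℂ).mono nhdsWithin_le_nhds

theorem isBigO_one (hf : HasQuadraticJet f f₀ f₁ f₂) : f =O[𝓝[≠] 0] fun _ => (1 : ℂ) := by
  have h1 : (fun w : ℂ => w ^ 2) =O[𝓝[≠] 0] fun _ => (1 : ℂ) := by
    simpa using isBigO_polynomial 0 0 1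
  refine ((Asymptotics.IsLittleO.isBigO hf).trans h1 |>.add
    (isBigO_polynomial f₀ f₁ f₂)).congr_left fun w => ?_
  ring

theorem mul (hf : HasQuadraticJet f f₀ f₁ f₂) (hg : HasQuadraticJet g g₀ g₁ g₂) :
    HasQuadraticJet (fun w => f w * g w) (f₀ * g₀) (f₀ * g₁ + f₁ * g₀)
      (f₀ * g₂ + f₁ * g₁ + f₂ * g₀) := by
  have h1 : (fun w => (f w - (f₀ + f₁ * w + f₂ * w ^ 2)) * g w) =o[𝓝[≠] 0] fun w : ℂ => w ^ 2 := by
    simpa using Asymptotics.IsLittleO.mul_isBigO hf hg.isBigO_one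
  have h2 : (fun w => (g w - (g₀ + g₁ * w + g₂ * w ^ 2)) * (f₀ + f₁ * w + f₂ * w ^ 2))
      =o[𝓝[≠] 0] fun w : ℂ => w ^ 2 := by
    simpa using Asymptotics.IsLittleO.mul_isBigO hg (isBigO_polynomial f₀ f₁ f₂)
  have h3 : (fun w : ℂ => w ^ 3 * (f₁ * g₂ + f₂ * g₁ + f₂ * g₂ * w)) =o[𝓝[≠] 0]
      fun w : ℂ => w ^ 2 := by
    have h4 : (fun w : ℂ => w ^ 3) =o[𝓝[≠] 0] fun w : ℂ => w ^ 2 :=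
      (Asymptotics.isLittleO_pow_pow (by norm_num)).mono nhdsWithin_le_nhds
    simpa using h4.mul_isBigO (isBigO_polynomial (f₁ * g₂ + f₂ * g₁) (f₂ * g₂) 0)
  refine ((h1.add h2).add h3).congr_left fun w => ?_
  ring

theorem exp_mul_sub_sum_isLittleO (a : ℂ) (n : ℕ) :
    (fun w : ℂ => Complex.exp (a * w) - ∑ i ∈ Finset.range (n + 1), (a * w) ^ i / (i.factorial : ℂ))
      =o[𝓝[≠] 0] fun w : ℂ => w ^ n := by
  have ht : Tendsto (fun w : ℂ => a * w) (𝓝[≠] 0) (𝓝 0) := by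
    have : ContinuousAt (fun w : ℂ => a * w) 0 := by fun_prop
    simpa using this.tendsto.mono_left nhdsWithin_le_nhds
  have h3 : ((fun w : ℂ => w ^ n) ∘ fun w => a * w) =O[𝓝[≠] 0] fun w : ℂ => w ^ n := by
    simp only [Function.comp_def, mul_pow]
    exact Asymptotics.isBigO_const_mul_self _ _ _
  exact ((Complex.exp_sub_sum_range_succ_isLittleO_pow n).comp_tendsto ht).trans_isBigO h3

theorem exp (a : ℂ) : HasQuadraticJet (fun w => Complex.exp (a * w)) 1 a (a ^ 2 / 2) := by
  refine (exp_mul_sub_sum_isLittleO a 2).congr_left fun w => ?_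
  simp [Finset.sum_range_succ]
  ring

theorem sinh : HasQuadraticJet Complex.sinh 0 1 0 := by
  have h := ((exp 1).const_mul (1 / 2)).add ((exp (-1)).const_mul (-1 / 2))
  have e : Complex.sinh = fun w => 1 / 2 * Complex.exp (1 * w) + -1 / 2 * Complex.exp (-1 * w) := by
    ext w
    simp only [one_mul, neg_mul, Complex.sinh]
    ring
  rw [e]
  convert h using 1 <;> norm_num

theorem cosh : HasQuadraticJet Complex.cosh 1 0 (1 / 2) := by
  have h := ((exp 1).const_mul (1 / 2)).add ((exp (-1)).const_mul (1 / 2))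
  have e : Complex.cosh = fun w => 1 / 2 * Complex.exp (1 * w) + 1 / 2 * Complex.exp (-1 * w) := by
    ext w
    simp only [one_mul, neg_mul, Complex.cosh]
    ring
  rw [e]
  convert h using 1 <;> norm_num

theorem sinh_div (c : ℂ) :
    HasQuadraticJet (fun w => Complex.sinh (w * c) / w) c 0 (c ^ 3 / 6) := by
  have h := ((exp_mul_sub_sum_isLittleO c 3).const_mul_left (1 / 2)).sub
    ((exp_mul_sub_sum_isLittleO (-c) 3).const_mul_left (1 / 2))
  have h2 := h.mul_isBigO (Asymptotics.isBigO_refl (fun w : ℂ => w⁻¹) (𝓝[≠] 0))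
  refine h2.congr' ?_ ?_
  · filter_upwards [self_mem_nhdsWithin] with w hw
    have hw : w ≠ 0 := hw
    simp only [Finset.sum_range_succ, Complex.sinh, Nat.factorial]
    simp
    rw [mul_comm w c]
    field_simp
    ring
  · filter_upwards [self_mem_nhdsWithin] with w hw
    have hw : w ≠ 0 := hw
    field_simp

end HasQuadraticJet

/-- The principal part at `0` of the integrand of `log Φ_𝖻`, expressed through powers of `sinh`. -/
def sinhPart (a B w : ℂ) : ℂ :=
  1 / 4 * ((Complex.sinh w)⁻¹ ^ 3 + a * (Complex.cosh w * (Complex.sinh w)⁻¹ ^ 2) +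
    B * (Complex.sinh w)⁻¹)

/-- The integrand of `log Φ_𝖻`. -/
def phiIntegrand (b : ℝ) (z w : ℂ) : ℂ :=
  Complex.exp (-2 * Complex.I * z * w) *
    (4 * Complex.sinh (w * b) * Complex.sinh (w * (b⁻¹ : ℝ)) * w)⁻¹

theorem tendsto_mul_phiIntegrand_sub {b : ℝ} (hb : 0 < b) (z : ℂ) :
    Tendsto (fun w => w * (phiIntegrand b z w - sinhPart (-2 * Complex.I * z)
      (-2 * z ^ 2 + 1 / 2 - (b ^ 2 + (b⁻¹) ^ 2) / 6) w)) (𝓝[≠] 0) (𝓝 0) := by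
  set a : ℂ := -2 * Complex.I * z with ha
  set B : ℂ := -2 * z ^ 2 + 1 / 2 - (b ^ 2 + (b⁻¹) ^ 2) / 6 with hB
  have hbc : (b : ℂ) ≠ 0 := by exact_mod_cast hb.ne'
  have haB : a ^ 2 / 2 = -2 * z ^ 2 := by
    rw [ha]
    linear_combination 2 * z ^ 2 * Complex.I_sq
  set N : ℂ → ℂ := fun w => Complex.exp (a * w) *
      (Complex.sinh (w * 1) / w * (Complex.sinh (w * 1) / w) * (Complex.sinh (w * 1) / w)) +
    -1 * (Complex.sinh (w * b) / w * (Complex.sinh (w * (b : ℂ)⁻¹) / w) *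
      (1 + (a * (Complex.cosh w * Complex.sinh w) + B * (Complex.sinh w * Complex.sinh w)))) with hN
  have hjet : HasQuadraticJet N 0 0 0 := by
    have s1 := HasQuadraticJet.sinh_div 1
    have h1 := (HasQuadraticJet.exp a).mul ((s1.mul s1).mul s1)
    have h2 := ((HasQuadraticJet.cosh.mul HasQuadraticJet.sinh).const_mul a).add
      ((HasQuadraticJet.sinh.mul HasQuadraticJet.sinh).const_mul B)
    have h3 := (h1.add ((((HasQuadraticJet.sinh_div (b : ℂ)).mul
      (HasQuadraticJet.sinh_div (b : ℂ)⁻¹)).mul ((HasQuadraticJet.const 1).add h2)).const_mul (-1)))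
    convert h3 using 1
    · field_simp
      ring
    · field_simp
      ring
    · rw [haB, hB]
      push_cast
      field_simp
      ring
  have hlim : Tendsto (fun w => N w / w ^ 2) (𝓝[≠] 0) (𝓝 0) := by
    refine Asymptotics.IsLittleO.tendsto_div_nhds_zero ?_
    simpa [HasQuadraticJet] using hjet
  have l1 : Tendsto (fun w : ℂ => w * (Complex.sinh w)⁻¹) (𝓝[≠] 0) (𝓝 1) := by
    simpa using tendsto_mul_inv_sinh one_pos
  have l2 := (((tendsto_mul_inv_sinh hb).mul (tendsto_mul_inv_sinh (inv_pos.2 hb))).mul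
    (l1.pow 3)).mul hlim |>.const_mul (1 / 4)
  simp only [mul_zero] at l2
  refine l2.congr' ?_
  have hs : ∀ c : ℝ, 0 < c → ∀ᶠ w : ℂ in 𝓝[≠] 0, Complex.sinh (w * c) ≠ 0 := fun c hc => by
    filter_upwards [(tendsto_mul_inv_sinh hc).eventually_ne (inv_ne_zero (by exact_mod_cast hc.ne'))]
      with w hw h
    simp [h] at hw
  filter_upwards [self_mem_nhdsWithin, hs b hb, hs b⁻¹ (inv_pos.2 hb), hs 1 one_pos]
    with w hw n1 n2 n3
  have hw : w ≠ 0 := hw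
  simp only [Complex.ofReal_one, mul_one] at n3
  simp only [hN, phiIntegrand, sinhPart, mul_one, ← ha]
  push_cast at n2 ⊢
  generalize Complex.sinh (w * b) = S1 at *
  generalize Complex.sinh (w * (b : ℂ)⁻¹) = S2 at *
  generalize Complex.sinh w = S at *
  field_simp
  ring

section Inversion

variable {b : ℝ} {z : ℂ}

theorem expTail_phiIntegrand (hb : 0 < b) (Y : ℝ) :
    ExpTail (phiIntegrand b z) Y (2 * |z.im| - (b + b⁻¹)) := by
  refine (((((ExpTail.exp z).mul (ExpTail.inv_sinh hb)).mul
    (ExpTail.inv_sinh (inv_pos.2 hb))).mul ExpTail.inv).const_mul (1 / 4)).mono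
    (κ' := 2 * |z.im| - (b + b⁻¹)) (by linarith) |>.congr fun w _ => ?_
  rw [phiIntegrand, mul_inv, mul_inv, mul_inv]
  ring

theorem expTail_sinhPart (a B : ℂ) (Y : ℝ) : ExpTail (sinhPart a B) Y (-1) := by
  refine ((((expTail_inv_sinh_cube Y).sub
    ((expTail_cosh_mul_inv_sinh_sq Y).const_mul (-a))).sub
    ((expTail_inv_sinh_one Y).const_mul (-B))).const_mul (1 / 4)).congr fun w _ => ?_
  rw [sinhPart]
  ring

theorem mem_openStrip_of_contourHeight (hb : 0 < b) {w : ℂ}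
    (hw : w ∈ openStrip (-(2 * contourHeight b)) (2 * contourHeight b)) :
    w ∈ openStrip (-(π / b)) (π / b) ∧ w ∈ openStrip (-(π / b⁻¹)) (π / b⁻¹) ∧
      w ∈ openStrip (-π) π := by
  have h1 := (le_div_iff₀ hb).2 (two_mul_contourHeight_mul_le hb)
  have h2 := (le_div_iff₀ (inv_pos.2 hb)).2 (two_mul_contourHeight_mul_inv_le hb)
  have h3 := two_mul_contourHeight_le hb
  obtain ⟨h4, h5⟩ := hw
  refine ⟨⟨?_, ?_⟩, ⟨?_, ?_⟩, ⟨?_, ?_⟩⟩ <;> linarith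

theorem differentiableOn_phiIntegrand (hb : 0 < b) : DifferentiableOn ℂ (phiIntegrand b z)
    (openStrip (-(2 * contourHeight b)) (2 * contourHeight b) \ {0}) := by
  refine differentiable_exp_neg_two_I_mul.differentiableOn.mul
    (DifferentiableOn.inv (by fun_prop) fun w hw => ?_)
  obtain ⟨h1, h2, -⟩ := mem_openStrip_of_contourHeight hb hw.1
  exact mul_ne_zero (mul_ne_zero (mul_ne_zero (by norm_num)
    (sinh_mul_ne_zero_of_ne_zero hb h1 hw.2))
    (sinh_mul_ne_zero_of_ne_zero (inv_pos.2 hb) h2 hw.2)) hw.2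

theorem differentiableOn_sinhPart (a B : ℂ) :
    DifferentiableOn ℂ (sinhPart a B) (openStrip (-π) π \ {0}) := by
  have h : DifferentiableOn ℂ (fun w => (Complex.sinh w)⁻¹) (openStrip (-π) π \ {0}) :=
    Complex.differentiable_sinh.differentiableOn.inv fun w hw =>
      Complex.sinh_ne_zero_of_abs_im_lt (abs_lt.2 hw.1) hw.2
  exact (((h.pow 3).add ((Complex.differentiable_cosh.differentiableOn.mul (h.pow 2)).const_mul a)).add
    (h.const_mul B)).const_mul (1 / 4)

theorem integrable_sinhPart {α β : ℝ} (hs : ∀ z ∈ openStrip α β, Complex.sinh z ≠ 0) {s : ℂ}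
    (hmem : s ∈ openStrip α β) (a B : ℂ) : Integrable (fun t : ℝ => sinhPart a B (t + s)) :=
  (((integrable_inv_sinh_cube hs hmem).add
    ((integrable_cosh_mul_inv_sinh_sq hs hmem).const_mul a)).add
    ((integrable_inv_sinh hs hmem).const_mul B)).const_mul (1 / 4)

theorem integral_sinhPart {α β : ℝ} (hs : ∀ z ∈ openStrip α β, Complex.sinh z ≠ 0) {s : ℂ}
    (hmem : s ∈ openStrip α β) (a B : ℂ) :
    ∫ t : ℝ, sinhPart a B (t + s) =
      1 / 4 * (B - 1 / 2) * ∫ t : ℝ, (Complex.sinh (t + s))⁻¹ := by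
  have i1 := integrable_inv_sinh_cube hs hmem
  have i2 := (integrable_cosh_mul_inv_sinh_sq hs hmem).const_mul a
  have i3 := (integrable_inv_sinh hs hmem).const_mul B
  have i12 : Integrable (fun x : ℝ => (Complex.sinh (x + s))⁻¹ ^ 3 +
    a * (Complex.cosh (x + s) * (Complex.sinh (x + s))⁻¹ ^ 2)) := i1.add i2
  simp only [sinhPart]
  rw [integral_const_mul, integral_add i12 i3, integral_add i1 i2, integral_const_mul,
    integral_const_mul, integral_inv_sinh_cube hs hmem, integral_cosh_mul_inv_sinh_sq hs hmem]
  ring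

theorem logPhi_neg (b : ℝ) (z : ℂ) :
    logPhi b (-z) = -∫ t : ℝ, phiIntegrand b z (t + -(Complex.I * contourHeight b)) := by
  rw [logPhi, lineTransform, ← integral_neg_eq_self, ← integral_neg]
  congr 1
  ext t
  rw [phiIntegrand, phiLineKer]
  push_cast
  rw [show -(t : ℂ) + Complex.I * contourHeight b = -(t + -(Complex.I * contourHeight b)) by ring]
  generalize (t : ℂ) + -(Complex.I * contourHeight b) = w
  rw [neg_mul w, neg_mul w, Complex.sinh_neg, Complex.sinh_neg,
    show -2 * Complex.I * -z * -w = -2 * Complex.I * z * w by ring]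
  ring

theorem logPhi_add_logPhi_neg (hb : 0 < b) (hz : |z.im| < (b + b⁻¹) / 2) :
    logPhi b z + logPhi b (-z) =
      Complex.I * π * z ^ 2 + Complex.I * π * (b ^ 2 + (b⁻¹ : ℝ) ^ 2) / 12 := by
  have h0 := contourHeight_pos hb
  have hπ := two_mul_contourHeight_le hb
  have hz' : |(-z).im| < (b + b⁻¹) / 2 := by simpa using hz
  set ε := contourHeight b with hε
  set a : ℂ := -2 * Complex.I * z
  set B : ℂ := -2 * z ^ 2 + 1 / 2 - (b ^ 2 + (b⁻¹ : ℝ) ^ 2) / 6 with hB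
  have hu : Complex.I * ε ∈ openStrip 0 π := ⟨by simpa using h0, by simp; linarith⟩
  have hl : -(Complex.I * ε) ∈ openStrip (-π) 0 := ⟨by simp; linarith, by simpa using h0⟩
  have key := integral_horizontal_eq_of_removable (h := 2 * ε)
    (κ := max (2 * |z.im| - (b + b⁻¹)) (-1)) (f := fun w => phiIntegrand b z w - sinhPart a B w)
    (max_lt (by linarith) (by norm_num))
    ((differentiableOn_phiIntegrand hb).sub ((differentiableOn_sinhPart a B).mono fun w hw =>
      ⟨(mem_openStrip_of_contourHeight hb hw.1).2.2, hw.2⟩))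
    (tendsto_mul_phiIntegrand_sub hb z)
    (fun Y => ((expTail_phiIntegrand hb Y).mono (le_max_left _ _)).sub
      ((expTail_sinhPart a B Y).mono (le_max_right _ _))) (a := Complex.I * ε)
    (a' := -(Complex.I * ε)) ⟨by simp; linarith, by simp; linarith⟩
    ⟨by simp; linarith, by simp; linarith⟩ (by simpa using h0.ne') (by simpa using h0.ne')
  have su : ∀ z ∈ openStrip 0 π, Complex.sinh z ≠ 0 :=
    fun z => Complex.sinh_ne_zero_of_mem_openStrip
  have sl : ∀ z ∈ openStrip (-π) 0, Complex.sinh z ≠ 0 :=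
    fun z => Complex.sinh_ne_zero_of_mem_openStrip_neg
  obtain ⟨A, hA⟩ := exists_norm_phiLineKer_le hb
  have hK := continuous_phiLineKer hb
  have iu : Integrable (fun t : ℝ => phiIntegrand b z (t + Complex.I * ε)) :=
    integrable_line hK hA (by linarith)
  have il : Integrable (fun t : ℝ => phiIntegrand b z (t + -(Complex.I * ε))) := by
    have hd : DifferentiableOn ℂ (phiIntegrand b z) (openStrip (-(2 * ε)) 0) :=
      (differentiableOn_phiIntegrand (z := z) hb).mono fun w hw => ⟨⟨hw.1, hw.2.trans (by positivity)⟩, fun h => by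
        have := hw.2
        rw [h] at this
        simp at this⟩
    exact integrable_horizontal hd (ExpTail.hasStripDecay (by linarith)
      (expTail_phiIntegrand hb) hd.continuousOn) ⟨by simp; linarith, by simpa using h0⟩
  rw [integral_sub iu (integrable_sinhPart su hu a B),
    integral_sub il (integrable_sinhPart sl hl a B), integral_sinhPart su hu,
    integral_sinhPart sl hl, integral_inv_sinh_upper hu, integral_inv_sinh_lower hl] at key
  have e1 : logPhi b z = ∫ t : ℝ, phiIntegrand b z (t + Complex.I * ε) := rfl
  rw [logPhi_neg, e1, ← hε]
  rw [hB] at key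
  linear_combination key

end Inversion

section Bounds

variable {b : ℝ}

theorem PhiS_mul_PhiS_neg (hb : 0 < b) {z : ℂ} (hz : |z.im| < (b + b⁻¹) / 2) :
    PhiS b z * PhiS b (-z) =
      Complex.exp (Complex.I * π * z ^ 2 + Complex.I * π * (b ^ 2 + (b⁻¹ : ℝ) ^ 2) / 12) := by
  rw [PhiS_eq_exp_logPhi, PhiS_eq_exp_logPhi, ← Complex.exp_add, logPhi_add_logPhi_neg hb hz]

theorem exists_abs_re_logPhi_add_le (hb : 0 < b) {Y : ℝ} (hY : Y < (b + b⁻¹) / 2) :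
    ∃ C : ℝ, ∀ z : ℂ, |z.im| ≤ Y → |(logPhi b z).re + 2 * π * max z.re 0 * z.im| ≤ C := by
  obtain ⟨C, hC⟩ := exists_norm_logPhi_le hb hY
  have hneg : ∀ z : ℂ, |z.im| ≤ Y → z.re ≤ 0 → |(logPhi b z).re| ≤ max C 0 := by
    intro z hz hz0
    have h1 : Real.exp (2 * contourHeight b * z.re) ≤ 1 :=
      Real.exp_le_one_iff.2 (by nlinarith [contourHeight_pos hb])
    refine (Complex.abs_re_le_norm _).trans ((hC z hz).trans ?_)
    calc _ ≤ max C 0 * Real.exp (2 * contourHeight b * z.re) := by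
          gcongr
          exact le_max_left _ _
      _ ≤ max C 0 * 1 := by gcongr
      _ = _ := mul_one _
  refine ⟨max C 0, fun z hz => ?_⟩
  rcases le_total z.re 0 with h | h
  · simpa [max_eq_right h] using hneg z hz h
  · have h1 := congrArg Complex.re (logPhi_add_logPhi_neg hb (hz.trans_lt hY))
    have h2 : (Complex.I * π * z ^ 2 + Complex.I * π * (b ^ 2 + (b⁻¹ : ℝ) ^ 2) / 12).re =
        -(2 * π * z.re * z.im) := by
      have e1 : (Complex.I * π * (b ^ 2 + (b⁻¹ : ℝ) ^ 2) / 12 : ℂ) =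
        ((π * (b ^ 2 + (b⁻¹ : ℝ) ^ 2) / 12 : ℝ) : ℂ) * Complex.I := by
        push_cast; ring
      rw [e1, Complex.add_re, Complex.re_ofReal_mul, Complex.I_re]
      simp [pow_two]
      ring
    rw [h2, Complex.add_re] at h1
    have h3 := hneg (-z) (by simpa using hz) (by simpa using h)
    rw [max_eq_left h, show (logPhi b z).re + 2 * π * z.re * z.im = -(logPhi b (-z)).re by linarith,
      abs_neg]
    exact h3

theorem exists_abs_re_logPhi_translate_le (hb : 0 < b) {Y : ℝ} (hY : Y < (b + b⁻¹) / 2)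
    (M : ℝ) : ∃ C : ℝ, ∀ (x : ℝ) (y : ℂ), |y.im| ≤ Y → |y.re| ≤ M →
      |(logPhi b (x + y)).re + 2 * π * max x 0 * y.im| ≤ C := by
  obtain ⟨C, hC⟩ := exists_abs_re_logPhi_add_le hb hY
  refine ⟨C + 2 * π * (M * Y), fun x y hy hyr => ?_⟩
  have h1 := hC (x + y) (by simpa using hy)
  have h2 : |max (x + y.re) 0 - max x 0| ≤ M := by
    refine le_trans ?_ hyr
    simpa using abs_max_sub_max_le_abs (x + y.re) x 0
  have h3 : |(max x 0 - max (x + y.re) 0) * y.im| ≤ M * Y := by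
    rw [abs_mul, abs_sub_comm]
    gcongr
    exact (abs_nonneg _).trans h2
  simp only [Complex.add_re, Complex.add_im, Complex.ofReal_re, Complex.ofReal_im, zero_add] at h1
  have e : (logPhi b (x + y)).re + 2 * π * max x 0 * y.im =
      ((logPhi b (x + y)).re + 2 * π * max (x + y.re) 0 * y.im) +
        2 * π * ((max x 0 - max (x + y.re) 0) * y.im) := by ring
  rw [e]
  refine (abs_add_le _ _).trans (add_le_add h1 ?_)
  rw [abs_mul, abs_of_pos (by positivity : (0 : ℝ) < 2 * π)]
  gcongr

theorem norm_PhiS (b : ℝ) (z : ℂ) : ‖PhiS b z‖ = Real.exp (logPhi b z).re := by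
  rw [PhiS_eq_exp_logPhi, Complex.norm_exp]

theorem exists_norm_PhiS_div_le (hb : 0 < b) {Y : ℝ} (hY : Y < (b + b⁻¹) / 2) (M : ℝ) :
    ∃ C : ℝ, ∀ (u v : ℂ) (x : ℝ), |u.im| ≤ Y → |v.im| ≤ Y → |u.re| ≤ M → |v.re| ≤ M →
      ‖PhiS b (x + u) / PhiS b (x + v)‖ ≤
        C * Real.exp (-(2 * π * (max x 0 * (u.im - v.im)))) := by
  obtain ⟨C, hC⟩ := exists_abs_re_logPhi_translate_le hb hY M
  refine ⟨Real.exp (2 * C), fun u v x hu hv hur hvr => ?_⟩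
  have h1 := (abs_le.1 (hC x u hu hur)).2
  have h2 := (abs_le.1 (hC x v hv hvr)).1
  rw [norm_div, norm_PhiS, norm_PhiS, ← Real.exp_sub, ← Real.exp_add, Real.exp_le_exp]
  linarith

/-- The integrand of the integral Ramanujan formula. -/
def ramIntegrand (b : ℝ) (u v w x : ℂ) : ℂ :=
  PhiS b (x + u) / PhiS b (x + v) * Complex.exp (2 * π * Complex.I * w * x)

/-- The left-hand side of the integral Ramanujan formula. -/
def ramIntegral (b : ℝ) (u v w : ℂ) : ℂ := ∫ x : ℝ, ramIntegrand b u v w x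

/-- The conditions on the parameters under which the integral converges absolutely. -/
def RamDomain (b : ℝ) (u v w : ℂ) : Prop :=
  -((b + b⁻¹) / 2) < v.im ∧ u.im < (b + b⁻¹) / 2 ∧ w.im < 0 ∧ 0 < u.im - v.im + w.im

theorem exists_norm_ramIntegrand_le (hb : 0 < b) {Y : ℝ} (hY : Y < (b + b⁻¹) / 2) (M δ : ℝ) :
    ∃ C : ℝ, ∀ (u v w : ℂ) (x : ℝ), |u.im| ≤ Y → |v.im| ≤ Y → |u.re| ≤ M → |v.re| ≤ M →
      w.im ≤ -δ → δ ≤ u.im - v.im + w.im →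
      ‖ramIntegrand b u v w x‖ ≤ C * Real.exp (-(2 * π * δ) * |x|) := by
  obtain ⟨C, hC⟩ := exists_norm_PhiS_div_le hb hY M
  refine ⟨C, fun u v w x hu hv hur hvr hw hs => ?_⟩
  have hC0 := hC u v x hu hv hur hvr
  have hC1 : 0 ≤ C := by
    by_contra! hneg
    exact absurd (hC0.trans_lt (mul_neg_of_neg_of_pos hneg (Real.exp_pos _)))
      (norm_nonneg _).not_gt
  rw [ramIntegrand, norm_mul, Complex.norm_exp]
  refine (mul_le_mul_of_nonneg_right hC0 (Real.exp_pos _).le).trans ?_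
  have h3 : (2 * π * Complex.I * w * x).re = -(2 * π * w.im * x) := by simp
  rw [mul_assoc, ← Real.exp_add, h3]
  refine mul_le_mul_of_nonneg_left (Real.exp_le_exp.2 ?_) hC1
  have : δ * |x| ≤ max x 0 * (u.im - v.im) + w.im * x := by
    rcases le_total x 0 with h | h
    · rw [max_eq_right h, abs_of_nonpos h]
      nlinarith
    · rw [max_eq_left h, abs_of_nonneg h]
      nlinarith
  nlinarith [pi_pos]

namespace RamDomain

variable {u v w : ℂ}

theorem abs_im_left (h : RamDomain b u v w) : |u.im| < (b + b⁻¹) / 2 := by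
  obtain ⟨h1, h2, h3, h4⟩ := h
  exact abs_lt.2 ⟨by linarith, h2⟩

theorem abs_im_right (h : RamDomain b u v w) : |v.im| < (b + b⁻¹) / 2 := by
  obtain ⟨h1, h2, h3, h4⟩ := h
  exact abs_lt.2 ⟨h1, by linarith⟩

theorem exists_bound (hb : 0 < b) (h : RamDomain b u v w) : ∃ r C δ : ℝ, 0 < r ∧ 0 < δ ∧
    ∀ u' ∈ ball u r, ∀ v' ∈ ball v r, ∀ w' ∈ ball w r, RamDomain b u' v' w' ∧
      ∀ x : ℝ, ‖ramIntegrand b u' v' w' x‖ ≤ C * Real.exp (-δ * |x|) := by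
  obtain ⟨Y, hY1, hY2⟩ := exists_between (max_lt h.abs_im_left h.abs_im_right)
  obtain ⟨h1, h2, h3, h4⟩ := h
  obtain ⟨hYu, hYv⟩ := max_lt_iff.1 hY1
  set δ := min (-w.im) (u.im - v.im + w.im) / 2 with hδ
  have hm : 0 < min (-w.im) (u.im - v.im + w.im) := lt_min (by linarith) h4
  have hm1 := min_le_left (-w.im) (u.im - v.im + w.im)
  have hm2 := min_le_right (-w.im) (u.im - v.im + w.im)
  have hδ0 : 0 < δ := by positivity
  set r := min (min (Y - |u.im|) (Y - |v.im|)) (δ / 3) with hr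
  have hr0 : 0 < r := lt_min (lt_min (by linarith) (by linarith)) (by linarith)
  have hr1 : r ≤ Y - |u.im| := (min_le_left _ _).trans (min_le_left _ _)
  have hr2 : r ≤ Y - |v.im| := (min_le_left _ _).trans (min_le_right _ _)
  have hr3 : r ≤ δ / 3 := min_le_right _ _
  obtain ⟨C, hC⟩ := exists_norm_ramIntegrand_le hb hY2 (max |u.re| |v.re| + r) δ
  refine ⟨r, C, 2 * π * δ, hr0, by positivity, fun u' hu v' hv w' hw => ?_⟩
  have near : ∀ p q : ℂ, q ∈ ball p r → |q.im - p.im| ≤ r ∧ |q.re - p.re| ≤ r := fun p q hq =>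
    ⟨by simpa using (Complex.abs_im_le_norm _).trans (mem_ball_iff_norm.1 hq).le,
      by simpa using (Complex.abs_re_le_norm _).trans (mem_ball_iff_norm.1 hq).le⟩
  have tri : ∀ p q : ℝ, |q - p| ≤ r → |q| ≤ |p| + r := fun p q hq => by
    have := abs_add_le p (q - p)
    rw [add_sub_cancel] at this
    linarith
  obtain ⟨u1, u2⟩ := near u u' hu
  obtain ⟨v1, v2⟩ := near v v' hv
  obtain ⟨w1, -⟩ := near w w' hw
  have b1 : |u'.im| ≤ Y := (tri _ _ u1).trans (by linarith)
  have b2 : |v'.im| ≤ Y := (tri _ _ v1).trans (by linarith)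
  have b3 : |u'.re| ≤ max |u.re| |v.re| + r :=
    (tri _ _ u2).trans (by linarith [le_max_left |u.re| |v.re|])
  have b4 : |v'.re| ≤ max |u.re| |v.re| + r :=
    (tri _ _ v2).trans (by linarith [le_max_right |u.re| |v.re|])
  have u1 := abs_le.1 u1
  have v1 := abs_le.1 v1
  have w1 := abs_le.1 w1
  have b5 : w'.im ≤ -δ := by linarith
  have b6 : δ ≤ u'.im - v'.im + w'.im := by linarith
  exact ⟨⟨by linarith [(abs_le.1 b2).1], by linarith [(abs_le.1 b1).2], by linarith,
    by linarith⟩, fun x => hC u' v' w' x b1 b2 b3 b4 b5 b6⟩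

theorem continuous_ramIntegrand (hb : 0 < b) (h : RamDomain b u v w) :
    Continuous fun x : ℝ => ramIntegrand b u v w x := by
  have hd := differentiableOn_PhiS hb
  have h1 := continuous_comp_horizontal hd (abs_lt.1 h.abs_im_left)
  have h2 := continuous_comp_horizontal hd (abs_lt.1 h.abs_im_right)
  exact (h1.div h2 fun x => PhiS_ne_zero b _).mul (by fun_prop)

theorem integrable (hb : 0 < b) (h : RamDomain b u v w) :
    Integrable fun x : ℝ => ramIntegrand b u v w x := by
  obtain ⟨r, C, δ, hr, hδ, hB⟩ := h.exists_bound hb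
  exact ((integrable_exp_neg_mul_abs hδ).const_mul C).mono'
    (h.continuous_ramIntegrand hb).aestronglyMeasurable
    (Eventually.of_forall (hB u (mem_ball_self hr) v (mem_ball_self hr) w (mem_ball_self hr)).2)

theorem differentiableAt_ramIntegral_right (hb : 0 < b) (h : RamDomain b u v w) :
    DifferentiableAt ℂ (fun w => ramIntegral b u v w) w := by
  obtain ⟨r, C, δ, hr, hδ, hB⟩ := h.exists_bound hb
  have hB := fun w' hw' => hB u (mem_ball_self hr) v (mem_ball_self hr) w' hw'
  refine (hasDerivAt_integral_of_bounded_on_ball (h := fun w x => ramIntegrand b u v w x) hr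
    (fun w' hw' => ((hB w' hw').1.continuous_ramIntegrand hb).aestronglyMeasurable)
    (fun x => ?_) (fun w' hw' => (hB w' hw').2)
    ((integrable_exp_neg_mul_abs hδ).const_mul C)).differentiableAt
  unfold ramIntegrand
  fun_prop

theorem differentiableAt_ramIntegral_left (hb : 0 < b) (h : RamDomain b u v w) :
    DifferentiableAt ℂ (fun u => ramIntegral b u v w) u := by
  obtain ⟨r, C, δ, hr, hδ, hB⟩ := h.exists_bound hb
  have hB := fun u' hu' => hB u' hu' v (mem_ball_self hr) w (mem_ball_self hr)
  refine (hasDerivAt_integral_of_bounded_on_ball (h := fun u x => ramIntegrand b u v w x) hr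
    (fun u' hu' => ((hB u' hu').1.continuous_ramIntegrand hb).aestronglyMeasurable)
    (fun x => ?_) (fun u' hu' => (hB u' hu').2)
    ((integrable_exp_neg_mul_abs hδ).const_mul C)).differentiableAt
  have h1 : DifferentiableOn ℂ (fun u : ℂ => PhiS b (x + u)) (ball u r) :=
    (differentiableOn_PhiS hb).comp (by fun_prop) fun u' hu' =>
      add_ofReal_mem_openStrip (abs_lt.1 (hB u' hu').1.abs_im_left) x
  exact (h1.div_const _).mul_const _

theorem ramIntegral_translate (hb : 0 < b) (h : RamDomain b u v w) (η : ℝ)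
    (hη : RamDomain b (u + Complex.I * η) (v + Complex.I * η) w) :
    ramIntegral b (u + Complex.I * η) (v + Complex.I * η) w =
      Complex.exp (2 * π * w * η) * ramIntegral b u v w := by
  have hsh : ∀ x η : ℝ, ramIntegrand b u v w (x + Complex.I * η) =
      Complex.exp (-(2 * π * w * η)) *
        ramIntegrand b (u + Complex.I * η) (v + Complex.I * η) w x := by
    intro x η
    rw [ramIntegrand, ramIntegrand, add_assoc, add_assoc, add_comm _ u, add_comm _ v,
      show (2 * π * Complex.I * w * (x + Complex.I * η) : ℂ) =
        -(2 * π * w * η) + 2 * π * Complex.I * w * x by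
        linear_combination (2 * π * w * η) * Complex.I_sq, Complex.exp_add]
    ring
  obtain ⟨h1, h2, h3, h4⟩ := h
  obtain ⟨k1, k2, -, -⟩ := hη
  simp only [Complex.add_im, Complex.mul_im, Complex.I_re, Complex.I_im, Complex.ofReal_re,
    Complex.ofReal_im, one_mul, zero_add, mul_zero] at k1 k2
  set α := -((b + b⁻¹) / 2) - v.im with hα
  set β := (b + b⁻¹) / 2 - u.im with hβ
  have hd : DifferentiableOn ℂ (ramIntegrand b u v w) (openStrip α β) := by
    have hd := differentiableOn_PhiS hb
    have d1 : DifferentiableOn ℂ (fun x : ℂ => PhiS b (x + u)) (openStrip α β) :=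
      hd.comp (by fun_prop) fun z hz => by
        obtain ⟨z1, z2⟩ := hz
        constructor <;> simp only [Complex.add_im] <;> linarith
    have d2 : DifferentiableOn ℂ (fun x : ℂ => PhiS b (x + v)) (openStrip α β) :=
      hd.comp (by fun_prop) fun z hz => by
        obtain ⟨z1, z2⟩ := hz
        constructor <;> simp only [Complex.add_im] <;> linarith
    exact (d1.div d2 fun z _ => PhiS_ne_zero b _).mul (by fun_prop)
  have hdec : HasStripDecay (ramIntegrand b u v w) α β := by
    intro p q hp hq
    set δ := min (-w.im) (u.im - v.im + w.im) with hδ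
    have hm : 0 < δ := lt_min (by linarith) h4
    have hm1 : δ ≤ -w.im := min_le_left _ _
    have hm2 : δ ≤ u.im - v.im + w.im := min_le_right _ _
    by_cases hpq : p ≤ q
    swap
    · exact ⟨0, 1, one_pos, fun z z1 z2 => absurd (z1.trans z2) hpq⟩
    have hY : max |p + v.im| |q + u.im| < (b + b⁻¹) / 2 :=
      max_lt (abs_lt.2 ⟨by linarith, by linarith⟩) (abs_lt.2 ⟨by linarith, by linarith⟩)
    obtain ⟨C, hC⟩ := exists_norm_ramIntegrand_le hb hY (max |u.re| |v.re|) δ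
    refine ⟨Real.exp (2 * π * (|w.re| * max |p| |q|)) * C, 2 * π * δ, by positivity,
      fun z z1 z2 => ?_⟩
    have hz : z = z.re + Complex.I * z.im := by rw [mul_comm]; exact (Complex.re_add_im z).symm
    have hz' : ramIntegrand b u v w z = Complex.exp (-(2 * π * w * z.im)) *
        ramIntegrand b (u + Complex.I * z.im) (v + Complex.I * z.im) w z.re := by
      conv_lhs => rw [hz]
      exact hsh _ _
    rw [hz', norm_mul, mul_assoc (Real.exp _) C]
    have hCz := hC (u + Complex.I * z.im) (v + Complex.I * z.im) w z.re
      (by simpa using abs_le_max_abs_abs (by linarith) (by linarith))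
      (by simpa using abs_le_max_abs_abs (by linarith) (by linarith))
      (by simp) (by simp) (by linarith) (by simpa using hm2)
    gcongr
    · rw [Complex.norm_exp, Real.exp_le_exp]
      have e : (-(2 * π * w * z.im) : ℂ).re = 2 * π * -(w.re * z.im) := by simp; ring
      rw [e]
      gcongr
      have a1 : |z.im| ≤ max |p| |q| := abs_le_max_abs_abs z1 z2
      calc -(w.re * z.im) ≤ |w.re * z.im| := neg_le_abs _
        _ ≤ |w.re| * max |p| |q| := by rw [abs_mul]; gcongr
  have key := integral_horizontal_eq hd hdec (a := Complex.I * η) (a' := 0)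
    ⟨by simp; linarith, by simp; linarith⟩ ⟨by simp; linarith, by simp; linarith⟩
  simp only [hsh, add_zero] at key
  rw [integral_const_mul] at key
  rw [ramIntegral, ramIntegral, ← key, ← mul_assoc, ← Complex.exp_add, add_neg_cancel,
    Complex.exp_zero, one_mul]

end RamDomain

end Bounds

section DifferenceEquation

variable {b : ℝ}

theorem cB_eq (b : ℝ) : cB b = Complex.I * ((b + b⁻¹) / 2 : ℝ) := by
  rw [cB]
  push_cast
  ring

theorem cB_re (b : ℝ) : (cB b).re = 0 := by
  simp [cB_eq]

theorem cB_im (b : ℝ) : (cB b).im = (b + b⁻¹) / 2 := by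
  rw [cB_eq, Complex.I_mul_im, Complex.ofReal_re]

theorem I_mul_ofReal_im (r : ℝ) : (Complex.I * r).im = r := by simp

theorem exp_two_pi_mul_cB (hb : b ≠ 0) :
    Complex.exp (2 * π * b * cB b) = -Complex.exp (π * Complex.I * b ^ 2) := by
  have hb' : (b : ℂ) ≠ 0 := by exact_mod_cast hb
  rw [show 2 * π * b * cB b = π * Complex.I * b ^ 2 + π * Complex.I by
    rw [cB, Complex.ofReal_inv]; field_simp, Complex.exp_add, Complex.exp_pi_mul_I]
  ring

/-- The `w`-dependent part of the right-hand side of the integral Ramanujan formula. -/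
def ramFactor (b : ℝ) (u v w : ℂ) : ℂ :=
  PhiS b (w + cB b) / PhiS b (u - v + w - cB b) * Complex.exp (-2 * π * Complex.I * w * (v + cB b))

theorem ramFactor_ne_zero (b : ℝ) (u v w : ℂ) : ramFactor b u v w ≠ 0 :=
  mul_ne_zero (div_ne_zero (PhiS_ne_zero b _) (PhiS_ne_zero b _)) (Complex.exp_ne_zero _)

namespace RamDomain

variable {u v w : ℂ}

theorem ramFactor_sub (hb : 0 < b) (h : RamDomain b u v w)
    (hw : 0 < u.im - v.im + w.im - b) :
    ramFactor b u v (w - Complex.I * b) *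
        (Complex.exp (2 * π * b * w) * Complex.exp (2 * π * b * (u - Complex.I * b / 2)) -
          Complex.exp (2 * π * b * (v + Complex.I * b / 2))) =
      ramFactor b u v w * (1 - Complex.exp (2 * π * b * w)) := by
  obtain ⟨h1, h2, h3, h4⟩ := h
  have e1 := PhiS_eq_Efac_mul hb (z := w - Complex.I * b + cB b)
    (by simp only [Complex.add_im, Complex.sub_im, I_mul_ofReal_im, cB_im]; linarith)
    (by simp only [Complex.add_im, Complex.sub_im, I_mul_ofReal_im, cB_im]; linarith)
  have e2 := PhiS_eq_Efac_mul hb (z := u - v + (w - Complex.I * b) - cB b)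
    (by simp only [Complex.add_im, Complex.sub_im, I_mul_ofReal_im, cB_im]; linarith)
    (by simp only [Complex.add_im, Complex.sub_im, I_mul_ofReal_im, cB_im]; linarith)
  have hb' : (b : ℂ) ≠ 0 := by exact_mod_cast hb.ne'
  set q := Complex.exp (π * Complex.I * b ^ 2) with hq
  have hc := exp_two_pi_mul_cB hb.ne'
  have hq0 : q ≠ 0 := Complex.exp_ne_zero _
  set W := Complex.exp (2 * π * b * w) with hW
  set U := Complex.exp (2 * π * b * u) with hU
  set V := Complex.exp (2 * π * b * v) with hV
  have hV0 : V ≠ 0 := Complex.exp_ne_zero _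
  have f1 : Efac b (w - Complex.I * b + cB b) = 1 - W := by
    rw [Efac, show 2 * π * b * (w - Complex.I * b + cB b + Complex.I * b / 2) =
      2 * π * b * w + 2 * π * b * cB b - π * Complex.I * b ^ 2 by ring, Complex.exp_sub,
      Complex.exp_add, hc]
    field_simp
    ring
  have f2 : Efac b (u - v + (w - Complex.I * b) - cB b) = 1 - U * W / (V * q ^ 2) := by
    rw [Efac, show 2 * π * b * (u - v + (w - Complex.I * b) - cB b + Complex.I * b / 2) =
      2 * π * b * u + 2 * π * b * w - 2 * π * b * v - 2 * π * b * cB b - π * Complex.I * b ^ 2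
        by ring, Complex.exp_sub, Complex.exp_sub, Complex.exp_sub,
      Complex.exp_add, hc, ← hU, ← hV, ← hW, ← hq]
    field_simp
    ring
  have f3 : Complex.exp (2 * π * b * (u - Complex.I * b / 2)) = U / q := by
    rw [hU, hq, ← Complex.exp_sub]; congr 1; ring
  have f4 : Complex.exp (2 * π * b * (v + Complex.I * b / 2)) = V * q := by
    rw [hV, hq, ← Complex.exp_add]; congr 1; ring
  have f5 : Complex.exp (-2 * π * Complex.I * (w - Complex.I * b) * (v + cB b)) =
      -Complex.exp (-2 * π * Complex.I * w * (v + cB b)) / (V * q) := by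
    rw [show -2 * π * Complex.I * (w - Complex.I * b) * (v + cB b) =
      -2 * π * Complex.I * w * (v + cB b) - 2 * π * b * v - 2 * π * b * cB b by
        linear_combination (2 * π * b * (v + cB b)) * Complex.I_sq, Complex.exp_sub,
        Complex.exp_sub, hc, ← hV, ← hq]
    field_simp
  rw [f1, show w - Complex.I * b + cB b + Complex.I * b = w + cB b by ring] at e1
  rw [f2, show u - v + (w - Complex.I * b) - cB b + Complex.I * b = u - v + w - cB b by ring] at e2
  have hne : 1 - U * W / (V * q ^ 2) ≠ 0 := by
    intro h0
    rw [h0, zero_mul] at e2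
    exact PhiS_ne_zero b _ e2
  rw [ramFactor, ramFactor, e1, e2, f3, f4, f5]
  have hP := PhiS_ne_zero b (u - v + w - cB b)
  generalize PhiS b (u - v + w - cB b) = P at *
  generalize PhiS b (w + cB b) = Q at *
  generalize Complex.exp (-2 * π * Complex.I * w * (v + cB b)) = E at *
  have hfac : W * (U / q) - V * q = -(1 - U * W / (V * q ^ 2)) * (V * q) := by
    field_simp
    ring
  rw [hfac]
  generalize 1 - U * W / (V * q ^ 2) = D at *
  field_simp

theorem ramIntegral_sub (hb : 0 < b) (h : RamDomain b u v w)
    (hw : 0 < u.im - v.im + w.im - b) :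
    ramIntegral b u v (w - Complex.I * b) *
        (Complex.exp (2 * π * b * w) * Complex.exp (2 * π * b * (u - Complex.I * b / 2)) -
          Complex.exp (2 * π * b * (v + Complex.I * b / 2))) =
      ramIntegral b u v w * (1 - Complex.exp (2 * π * b * w)) := by
  have hF := h.integrable hb
  have ⟨h1, h2, h3, h4⟩ := h
  have hd : RamDomain b u v (w - Complex.I * b) := ⟨h1, h2, by
    simp only [Complex.sub_im, I_mul_ofReal_im]; linarith, by
    simp only [Complex.sub_im, I_mul_ofReal_im]; linarith⟩
  have hu : RamDomain b (u - Complex.I * b) v w := ⟨h1, by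
    simp only [Complex.sub_im, I_mul_ofReal_im]; linarith, h3, by
    simp only [Complex.sub_im, I_mul_ofReal_im]; linarith⟩
  have hv : RamDomain b u (v + Complex.I * b) w := ⟨by
    simp only [Complex.add_im, I_mul_ofReal_im]; linarith, h2, h3, by
    simp only [Complex.add_im, I_mul_ofReal_im]; linarith⟩
  have hexp : ∀ (x : ℝ) (y : ℂ), Complex.exp (2 * π * b * (x + y)) *
      Complex.exp (2 * π * Complex.I * w * x) = Complex.exp (2 * π * b * y) *
        Complex.exp (2 * π * Complex.I * (w - Complex.I * b) * x) := by
    intro x y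
    rw [← Complex.exp_add, ← Complex.exp_add]
    congr 1
    linear_combination (2 * π * b * x) * Complex.I_sq
  have hFd := hd.integrable hb
  have eu : ramIntegral b (u - Complex.I * b) v w = ramIntegral b u v w +
      Complex.exp (2 * π * b * (u - Complex.I * b / 2)) * ramIntegral b u v (w - Complex.I * b) := by
    rw [ramIntegral, ramIntegral, ramIntegral, ← integral_const_mul,
      ← integral_add hF (hFd.const_mul _)]
    refine integral_congr_ae (Eventually.of_forall fun x => ?_)
    have e := PhiS_eq_Efac_mul hb (z := x + (u - Complex.I * b))
      (by simp only [Complex.add_im, Complex.sub_im, I_mul_ofReal_im, Complex.ofReal_im]; linarith)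
      (by simp only [Complex.add_im, Complex.sub_im, I_mul_ofReal_im, Complex.ofReal_im]; linarith)
    rw [Efac, show (x + (u - Complex.I * b) + Complex.I * b : ℂ) = x + u by ring,
      show (x + (u - Complex.I * b) + Complex.I * b / 2 : ℂ) = x + (u - Complex.I * b / 2) by
        ring] at e
    simp only [ramIntegrand]
    rw [e]
    linear_combination (PhiS b (x + u) / PhiS b (x + v)) * hexp x (u - Complex.I * b / 2)
  have ev : ramIntegral b u (v + Complex.I * b) w = ramIntegral b u v w +
      Complex.exp (2 * π * b * (v + Complex.I * b / 2)) * ramIntegral b u v (w - Complex.I * b) := by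
    rw [ramIntegral, ramIntegral, ramIntegral, ← integral_const_mul,
      ← integral_add hF (hFd.const_mul _)]
    refine integral_congr_ae (Eventually.of_forall fun x => ?_)
    have e := PhiS_eq_Efac_mul hb (z := x + v)
      (by simp only [Complex.add_im, Complex.ofReal_im]; linarith)
      (by simp only [Complex.add_im, Complex.ofReal_im]; linarith)
    rw [Efac, add_assoc, add_assoc] at e
    simp only [ramIntegrand]
    have e' : (PhiS b (x + (v + Complex.I * b)))⁻¹ =
        (1 + Complex.exp (2 * π * b * (x + (v + Complex.I * b / 2)))) * (PhiS b (x + v))⁻¹ := by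
      have h1 := PhiS_ne_zero b (x + (v + Complex.I * b))
      have h2 := PhiS_ne_zero b (x + v)
      rw [eq_mul_inv_iff_mul_eq₀ h2, inv_mul_eq_iff_eq_mul₀ h1, e]
      ring
    rw [div_eq_mul_inv, e']
    linear_combination (PhiS b (x + u) / PhiS b (x + v)) * hexp x (v + Complex.I * b / 2)
  have ht := hu.ramIntegral_translate hb b (by rwa [sub_add_cancel])
  rw [sub_add_cancel, eu, ev, show 2 * π * w * b = 2 * π * b * w by ring] at ht
  linear_combination -ht

end RamDomain

end DifferenceEquation

section Constancy

variable {b : ℝ} {u v w : ℂ}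

theorem one_sub_exp_ne_zero (hb : 0 < b) (h1 : -b⁻¹ < w.im) (h2 : w.im < 0) :
    1 - Complex.exp (2 * π * b * w) ≠ 0 := by
  intro h
  obtain ⟨n, hn⟩ := Complex.exp_eq_one_iff.1 (sub_eq_zero.1 h).symm
  have h3 := congrArg Complex.im hn
  have e1 : (2 * π * b * w : ℂ) = ((2 * π * b : ℝ) : ℂ) * w := by push_cast; ring
  have e2 : (n * (2 * π * Complex.I) : ℂ) = ((2 * π * n : ℝ) : ℂ) * Complex.I := by push_cast; ring
  rw [e1, e2, Complex.im_ofReal_mul, Complex.im_ofReal_mul, Complex.I_im] at h3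
  have h4 : b * w.im = n := by
    have := pi_pos
    have h5 : (2 * π) * (b * w.im) = (2 * π) * n := by linarith
    exact mul_left_cancel₀ (by positivity) h5
  have h5 : -1 < b * w.im := by
    have := mul_lt_mul_of_pos_left h1 hb
    rwa [mul_neg, mul_inv_cancel₀ hb.ne'] at this
  have h6 : b * w.im < 0 := mul_neg_of_pos_of_neg hb h2
  rw [h4] at h5 h6
  have h7 : (-1 : ℤ) < n := by exact_mod_cast h5
  have h8 : n < (0 : ℤ) := by exact_mod_cast h6
  omega

theorem exists_norm_ramFactor_inv_le (hb : 0 < b) (hv : -((b + b⁻¹) / 2) < v.im)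
    (hu : u.im < (b + b⁻¹) / 2) {p q : ℝ} (hp : -(u.im - v.im) < p) (hq : q < 0) :
    ∃ C : ℝ, ∀ w : ℂ, p ≤ w.im → w.im ≤ q → ‖(ramFactor b u v w)⁻¹‖ ≤
      C * Real.exp (2 * π * max ((b + b⁻¹) / 2 - u.im) (v.im + (b + b⁻¹) / 2) * |w.re|) := by
  set c := (b + b⁻¹) / 2 with hc
  set Y := max (c + q) (c - (u.im - v.im) - p) with hY
  have hYc : Y < c := max_lt (by linarith) (by linarith)
  have hY1 : c + q ≤ Y := le_max_left _ _
  have hY2 : c - (u.im - v.im) - p ≤ Y := le_max_right _ _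
  obtain ⟨C, hC⟩ := exists_abs_re_logPhi_translate_le hb hYc |u.re - v.re|
  refine ⟨Real.exp (2 * C + 2 * π * (max |p| |q| * |v.re|)), fun w w1 w2 => ?_⟩
  have hw : w = w.re + Complex.I * w.im := by rw [mul_comm]; exact (Complex.re_add_im w).symm
  have k1 := hC w.re (u - v + Complex.I * w.im - cB b)
    (by
      simp only [Complex.add_im, Complex.sub_im, I_mul_ofReal_im, cB_im, ← hc]
      exact abs_le.2 ⟨by linarith, by linarith⟩)
    (by simp [cB_re])
  have k2 := hC w.re (Complex.I * w.im + cB b)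
    (by
      simp only [Complex.add_im, I_mul_ofReal_im, cB_im, ← hc]
      exact abs_le.2 ⟨by linarith, by linarith⟩)
    (by simp [cB_re])
  rw [show (w.re + (u - v + Complex.I * w.im - cB b) : ℂ) = u - v + w - cB b by
    conv_rhs => rw [hw]
    ring] at k1
  rw [show (w.re + (Complex.I * w.im + cB b) : ℂ) = w + cB b by
    conv_rhs => rw [hw]
    ring] at k2
  simp only [Complex.add_im, Complex.sub_im, I_mul_ofReal_im, cB_im, ← hc] at k1 k2
  have k1 := (abs_le.1 k1).2
  have k2 := (abs_le.1 k2).1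
  have e : (-2 * π * Complex.I * w * (v + cB b)).re =
      2 * π * (w.re * (v.im + c) + w.im * v.re) := by
    rw [show -2 * π * Complex.I * w * (v + cB b) =
      ((-2 * π : ℝ) : ℂ) * (Complex.I * (w * (v + cB b))) by push_cast; ring,
      Complex.re_ofReal_mul, Complex.I_mul_re, Complex.mul_im, Complex.add_im, Complex.add_re,
      cB_im, cB_re]
    ring
  rw [norm_inv, ramFactor, norm_mul, norm_div, norm_PhiS, norm_PhiS, Complex.norm_exp, e,
    ← Real.exp_sub, ← Real.exp_add, ← Real.exp_neg, ← Real.exp_add, Real.exp_le_exp]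
  have a1 : -(w.im * v.re) ≤ max |p| |q| * |v.re| := by
    refine (neg_le_abs _).trans ?_
    rw [abs_mul]
    gcongr
    exact abs_le_max_abs_abs w1 w2
  have a2 : max w.re 0 * (2 * c - (u.im - v.im)) - w.re * (v.im + c) ≤
      max (c - u.im) (v.im + c) * |w.re| := by
    have m1 := le_max_left (c - u.im) (v.im + c)
    have m2 := le_max_right (c - u.im) (v.im + c)
    rcases le_total w.re 0 with h | h
    · rw [max_eq_right h, abs_of_nonpos h]
      nlinarith
    · rw [max_eq_left h, abs_of_nonneg h]
      nlinarith
  have a1' := mul_le_mul_of_nonneg_left a1 (by positivity : 0 ≤ 2 * π)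
  have a2' := mul_le_mul_of_nonneg_left a2 (by positivity : 0 ≤ 2 * π)
  linarith

theorem exists_norm_ramIntegral_le (hb : 0 < b) (hv : -((b + b⁻¹) / 2) < v.im)
    (hu : u.im < (b + b⁻¹) / 2) {p q : ℝ} (hp : -(u.im - v.im) < p) (hq : q < 0) :
    ∃ C : ℝ, ∀ w : ℂ, p ≤ w.im → w.im ≤ q → ‖ramIntegral b u v w‖ ≤ C := by
  by_cases hpq : p ≤ q
  swap
  · exact ⟨0, fun w h1 h2 => absurd (h1.trans h2) hpq⟩
  have hY : max |u.im| |v.im| < (b + b⁻¹) / 2 :=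
    max_lt (abs_lt.2 ⟨by linarith, hu⟩) (abs_lt.2 ⟨hv, by linarith⟩)
  set δ := min (-q) (u.im - v.im + p) with hδ
  have hδ0 : 0 < δ := lt_min (by linarith) (by linarith)
  have m1 : δ ≤ -q := min_le_left _ _
  have m2 : δ ≤ u.im - v.im + p := min_le_right _ _
  obtain ⟨C, hC⟩ := exists_norm_ramIntegrand_le hb hY (max |u.re| |v.re|) δ
  refine ⟨∫ x : ℝ, C * Real.exp (-(2 * π * δ) * |x|), fun w w1 w2 => ?_⟩
  exact norm_integral_le_of_norm_le ((integrable_exp_neg_mul_abs (by positivity)).const_mul C)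
    (Eventually.of_forall fun x => hC u v w x (le_max_left _ _) (le_max_right _ _)
      (le_max_left _ _) (le_max_right _ _) (by linarith) (by linarith))

theorem differentiableAt_ramFactor_right (hb : 0 < b) (h : RamDomain b u v w) :
    DifferentiableAt ℂ (fun w => ramFactor b u v w) w := by
  obtain ⟨h1, h2, h3, h4⟩ := h
  have hd : ∀ z ∈ openStrip (-((b + b⁻¹) / 2)) ((b + b⁻¹) / 2), DifferentiableAt ℂ (PhiS b) z :=
    fun z hz => (differentiableOn_PhiS hb).differentiableAt ((isOpen_openStrip _ _).mem_nhds hz)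
  have d1 : DifferentiableAt ℂ (fun w => PhiS b (w + cB b)) w :=
    DifferentiableAt.comp (g := PhiS b) w
      (hd _ ⟨by simp only [Complex.add_im, cB_im]; linarith,
        by simp only [Complex.add_im, cB_im]; linarith⟩) (by fun_prop)
  have d2 : DifferentiableAt ℂ (fun w => PhiS b (u - v + w - cB b)) w :=
    DifferentiableAt.comp (g := PhiS b) w
      (hd _ ⟨by simp only [Complex.add_im, Complex.sub_im, cB_im]; linarith,
        by simp only [Complex.add_im, Complex.sub_im, cB_im]; linarith⟩) (by fun_prop)
  exact (d1.div d2 (PhiS_ne_zero b _)).mul (by fun_prop)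

theorem ramIntegral_div_ramFactor_eq (hb : 0 < b) (hv : -((b + b⁻¹) / 2) < v.im)
    (hu : u.im < (b + b⁻¹) / 2) (hs : b < u.im - v.im) {w w' : ℂ}
    (hw : w ∈ openStrip (-(u.im - v.im)) 0) (hw' : w' ∈ openStrip (-(u.im - v.im)) 0) :
    ramIntegral b u v w / ramFactor b u v w = ramIntegral b u v w' / ramFactor b u v w' := by
  have hdom : ∀ z ∈ openStrip (-(u.im - v.im)) 0, RamDomain b u v z := fun z hz =>
    ⟨hv, hu, hz.2, by linarith [hz.1]⟩
  set p := -(u.im - v.im + b) / 2 with hp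
  have hp1 : -(u.im - v.im) < p := by linarith
  have hp2 : p + b < 0 := by linarith
  obtain ⟨C, hC⟩ := exists_norm_ramIntegral_le hb hv hu hp1 hp2
  obtain ⟨D, hD⟩ := exists_norm_ramFactor_inv_le hb hv hu hp1 hp2
  have hbi : b⁻¹ * b = 1 := inv_mul_cancel₀ hb.ne'
  refine eq_of_periodic_on_openStrip (f := fun w => ramIntegral b u v w / ramFactor b u v w)
    (θ := max ((b + b⁻¹) / 2 - u.im) (v.im + (b + b⁻¹) / 2)) (C := C * D) hb
    (le_max_of_le_left (by linarith)) ?_ ?_ ?_ hp1 hp2 ?_ hw hw'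
  · have : max ((b + b⁻¹) / 2 - u.im) (v.im + (b + b⁻¹) / 2) < b⁻¹ :=
      max_lt (by linarith) (by linarith)
    simpa [hbi] using mul_lt_mul_of_pos_right this hb
  · intro z hz
    exact (((hdom z hz).differentiableAt_ramIntegral_right hb).div
      (differentiableAt_ramFactor_right hb (hdom z hz))
      (ramFactor_ne_zero b u v z)).differentiableWithinAt
  · intro z hz hz'
    have hwz : 0 < u.im - v.im + (z + Complex.I * b).im - b := by
      simp only [Complex.add_im, I_mul_ofReal_im]; linarith [hz.1]
    have e1 := (hdom _ hz').ramIntegral_sub hb hwz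
    have e2 := (hdom _ hz').ramFactor_sub hb hwz
    rw [add_sub_cancel_right] at e1 e2
    have hne := one_sub_exp_ne_zero hb (w := z + Complex.I * b) (by linarith) hz'.2
    rw [div_eq_div_iff (ramFactor_ne_zero _ _ _ _) (ramFactor_ne_zero _ _ _ _)]
    refine mul_right_cancel₀ hne ?_
    linear_combination (ramIntegral b u v z) * e2 - (ramFactor b u v z) * e1
  · intro z z1 z2
    rw [div_eq_mul_inv, norm_mul, mul_assoc]
    exact mul_le_mul (hC z z1 z2) (hD z z1 z2) (norm_nonneg _)
      ((norm_nonneg _).trans (hC z z1 z2))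

end Constancy

section SpecialValue

open ComplexConjugate

variable {b : ℝ}

theorem conj_logPhi (b : ℝ) (z : ℂ) : conj (logPhi b z) = -logPhi b (conj z) := by
  rw [logPhi, logPhi, lineTransform, lineTransform, ← integral_conj, ← integral_neg,
    ← integral_neg_eq_self]
  congr 1 with t
  simp only [phiLineKer, map_mul, map_inv₀, ← Complex.exp_conj, ← Complex.sinh_conj, map_neg,
    map_add, Complex.conj_I, Complex.conj_ofReal, map_ofNat, Complex.ofReal_neg]
  set ε : ℂ := (contourHeight b : ℂ)
  rw [show -t + -Complex.I * ε = -(t + Complex.I * ε) by ring, neg_mul (t + Complex.I * ε),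
    neg_mul (t + Complex.I * ε), Complex.sinh_neg, Complex.sinh_neg, ← mul_neg, ← inv_neg]
  congr 2 <;> ring

theorem PhiS_I_mul (hb : 0 < b) {y : ℝ} (hy : |y| < (b + b⁻¹) / 2) :
    PhiS b (Complex.I * y) = ‖PhiS b (Complex.I * y)‖ *
      Complex.exp (π * Complex.I * ((b ^ 2 + (b⁻¹ : ℝ) ^ 2) / 24 - y ^ 2 / 2)) := by
  have h1 := logPhi_add_logPhi_neg hb (z := Complex.I * y) (by simpa using hy)
  have h2 := conj_logPhi b (Complex.I * y)
  rw [show conj (Complex.I * (y : ℂ)) = -(Complex.I * y) by simp] at h2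
  have h3 := Complex.sub_conj (logPhi b (Complex.I * y))
  rw [h2, sub_neg_eq_add, h1] at h3
  rw [norm_PhiS, PhiS_eq_exp_logPhi, Complex.ofReal_exp, ← Complex.exp_add]
  congr 1
  conv_lhs => rw [← Complex.re_add_im (logPhi b (Complex.I * y))]
  rw [Complex.ofReal_mul, Complex.ofReal_ofNat] at h3
  linear_combination (-1 / 2) * h3 + (π * Complex.I * y ^ 2 / 2) * Complex.I_sq

theorem PhiS_cB_sub (hb : 0 < b) {τ : ℝ} (h0 : 0 < τ) (h1 : τ < b⁻¹) :
    PhiS b (cB b - Complex.I * τ - Complex.I * b) =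
      (1 - Complex.exp (-2 * π * Complex.I * b * τ)) * PhiS b (cB b - Complex.I * τ) := by
  rw [PhiS_eq_Efac_mul hb (by simp only [Complex.sub_im, I_mul_ofReal_im, cB_im]; linarith)
    (by simp only [Complex.sub_im, I_mul_ofReal_im, cB_im]; linarith), sub_add_cancel, Efac,
    show 2 * π * b * (cB b - Complex.I * τ - Complex.I * b + Complex.I * b / 2) =
      2 * π * b * cB b + (-2 * π * Complex.I * b * τ - π * Complex.I * b ^ 2) by ring,
    Complex.exp_add, exp_two_pi_mul_cB hb.ne', Complex.exp_sub]
  have := Complex.exp_ne_zero (π * Complex.I * b ^ 2)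
  field_simp
  ring

theorem continuousAt_PhiS (hb : 0 < b) {z : ℂ} (hz : |z.im| < (b + b⁻¹) / 2) :
    ContinuousAt (PhiS b) z :=
  ((differentiableOn_PhiS hb).differentiableAt
    ((isOpen_openStrip _ _).mem_nhds (abs_lt.1 hz))).continuousAt

theorem tendsto_mul_PhiS_cB (hb : 0 < b) :
    Tendsto (fun τ : ℝ => τ * PhiS b (cB b - Complex.I * τ)) (𝓝[>] 0)
      (𝓝 (PhiS b (cB b - Complex.I * b) / (2 * π * Complex.I * b))) := by
  have hb' : (b : ℂ) ≠ 0 := by exact_mod_cast hb.ne'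
  have hπ : (π : ℂ) ≠ 0 := by exact_mod_cast pi_ne_zero
  have hbi : 0 < b⁻¹ := inv_pos.2 hb
  have hder : HasDerivAt (fun τ : ℝ => 1 - Complex.exp (-2 * π * Complex.I * b * τ))
      (2 * π * Complex.I * b) 0 := by
    have h1 : HasDerivAt (fun τ : ℝ => -2 * π * Complex.I * b * (τ : ℂ))
        (-2 * π * Complex.I * b) 0 := by
      simpa using (Complex.ofRealCLM.hasDerivAt (x := (0 : ℝ))).const_mul (-2 * π * Complex.I * b)
    simpa using h1.cexp.const_sub 1
  have h1 := (hder.tendsto_slope_zero_right).inv₀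
    (by simp [hb', hπ])
  have h2 : Tendsto (fun τ : ℝ => PhiS b (cB b - Complex.I * τ - Complex.I * b)) (𝓝[>] 0)
      (𝓝 (PhiS b (cB b - Complex.I * b))) := by
    refine Tendsto.mono_left ?_ nhdsWithin_le_nhds
    refine (continuousAt_PhiS hb ?_).tendsto.comp ?_
    · simp only [Complex.sub_im, I_mul_ofReal_im, cB_im]
      exact abs_lt.2 ⟨by linarith, by linarith⟩
    · refine Continuous.tendsto' (by fun_prop) _ _ (by simp)
  refine ((h2.mul h1).congr' ?_)
  filter_upwards [Ioo_mem_nhdsGT hbi] with τ hτ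
  rw [PhiS_cB_sub hb hτ.1 hτ.2]
  have hτ' : (τ : ℂ) ≠ 0 := by exact_mod_cast hτ.1.ne'
  have hne := one_sub_exp_ne_zero hb (w := -(Complex.I * τ)) (by simpa using hτ.2)
    (by simpa using hτ.1)
  rw [show 2 * π * b * -(Complex.I * (τ : ℂ)) = -2 * π * Complex.I * b * τ by ring] at hne
  simp only [zero_add, Complex.ofReal_zero, mul_zero, Complex.exp_zero, sub_self, sub_zero,
    Complex.real_smul, Complex.ofReal_inv, mul_inv, inv_inv]
  generalize 1 - Complex.exp (-2 * π * Complex.I * b * τ) = D at hne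
  field_simp

theorem PhiS_cB_sub_I_mul (hb : 0 < b) :
    PhiS b (cB b - Complex.I * b) =
      Complex.I * b / Complex.exp (π * Complex.I * (1 - 4 * cB b ^ 2) / 12) := by
  have hbi : 0 < b⁻¹ := inv_pos.2 hb
  have hb' : (b : ℂ) ≠ 0 := by exact_mod_cast hb.ne'
  have hπ : (π : ℂ) ≠ 0 := by exact_mod_cast pi_ne_zero
  have hsymm : cB b⁻¹ = cB b := by rw [cB_eq, cB_eq, inv_inv, add_comm]
  have h1 := tendsto_mul_PhiS_cB hb
  have h2 := tendsto_mul_PhiS_cB hbi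
  rw [PhiS_inv, hsymm] at h2
  have h3 := tendsto_nhds_unique h1 h2
  set y := (b⁻¹ - b) / 2 with hy
  have hyc : |y| < (b + b⁻¹) / 2 := abs_lt.2 ⟨by linarith, by linarith⟩
  have e1 : cB b - Complex.I * b = Complex.I * y := by
    rw [cB_eq, hy]; push_cast; ring
  have e2 : cB b - Complex.I * (b⁻¹ : ℝ) = -(Complex.I * y) := by
    rw [cB_eq, hy]; push_cast; ring
  rw [e1, e2] at h3
  have h4 := PhiS_mul_PhiS_neg hb (z := Complex.I * y) (by simpa using hyc)
  have h5 : PhiS b (Complex.I * y) = b ^ 2 * PhiS b (-(Complex.I * y)) := by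
    rw [Complex.ofReal_inv] at h3
    field_simp at h3
    linear_combination h3
  have h6 : ‖PhiS b (Complex.I * y)‖ = b := by
    have h7 : ‖PhiS b (Complex.I * y) * PhiS b (-(Complex.I * y))‖ = 1 := by
      rw [h4, show Complex.I * π * (Complex.I * y) ^ 2 +
        Complex.I * π * (b ^ 2 + (b⁻¹ : ℝ) ^ 2) / 12 =
        ((-π * y ^ 2 + π * (b ^ 2 + (b⁻¹ : ℝ) ^ 2) / 12 : ℝ) : ℂ) * Complex.I by
          push_cast; linear_combination (Complex.I * π * y ^ 2) * Complex.I_sq,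
        Complex.norm_exp_ofReal_mul_I]
    have h8 := congrArg norm h5
    rw [norm_mul, norm_pow, Complex.norm_real, norm_of_nonneg hb.le] at h8
    rw [norm_mul] at h7
    have h9 : ‖PhiS b (Complex.I * y)‖ ^ 2 = b ^ 2 := by
      linear_combination ‖PhiS b (Complex.I * y)‖ * h8 + b ^ 2 * h7
    exact (pow_left_inj₀ (norm_nonneg _) hb.le two_ne_zero).1 h9
  rw [e1, PhiS_I_mul hb hyc, h6, mul_comm Complex.I, mul_div_assoc]
  congr 1
  rw [eq_div_iff (Complex.exp_ne_zero _), ← Complex.exp_add]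
  refine Eq.trans ?_ Complex.exp_pi_div_two_mul_I
  congr 1
  rw [cB, hy]
  push_cast
  field_simp
  linear_combination (-192 * (b ^ 2 + 1) ^ 2) * Complex.I_sq

end SpecialValue

section Evaluation

variable {b : ℝ} {u v w : ℂ}

theorem tendsto_PhiS_atBot (hb : 0 < b) (hu : |u.im| < (b + b⁻¹) / 2) :
    Tendsto (fun x : ℝ => PhiS b (x + u)) atBot (𝓝 1) := by
  obtain ⟨C, hC⟩ := exists_norm_logPhi_le hb hu
  have h0 : Tendsto (fun x : ℝ => logPhi b (x + u)) atBot (𝓝 0) := by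
    refine squeeze_zero_norm (fun x => hC (x + u) (by simp)) ?_
    rw [show (0 : ℝ) = C * 0 by simp]
    refine Tendsto.const_mul C (Real.tendsto_exp_atBot.comp ?_)
    refine Tendsto.const_mul_atBot (by have := contourHeight_pos hb; positivity) ?_
    simpa using tendsto_atBot_add_const_right atBot u.re tendsto_id
  simp only [PhiS_eq_exp_logPhi]
  rw [← Complex.exp_zero]
  exact (Complex.continuous_exp.tendsto 0).comp h0

theorem tendsto_mul_ramIntegral (hb : 0 < b) (hv : -((b + b⁻¹) / 2) < v.im)
    (hu : u.im < (b + b⁻¹) / 2) (hs : 0 < u.im - v.im) :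
    Tendsto (fun τ : ℝ => τ * ramIntegral b u v (-(Complex.I * τ))) (𝓝[>] 0)
      (𝓝 (1 / (2 * π))) := by
  have hu' : |u.im| < (b + b⁻¹) / 2 := abs_lt.2 ⟨by linarith, hu⟩
  have hv' : |v.im| < (b + b⁻¹) / 2 := abs_lt.2 ⟨hv, by linarith⟩
  obtain ⟨C, hC⟩ := exists_norm_PhiS_div_le hb (max_lt hu' hv') (max |u.re| |v.re|)
  have hC := fun x => hC u v x (le_max_left _ _) (le_max_right _ _) (le_max_left _ _)
    (le_max_right _ _)
  set h : ℝ → ℂ := fun x => PhiS b (x + u) / PhiS b (x + v) with hh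
  have hcont : Continuous h :=
    (continuous_comp_horizontal (differentiableOn_PhiS hb) (abs_lt.1 hu')).div
      (continuous_comp_horizontal (differentiableOn_PhiS hb) (abs_lt.1 hv'))
      fun x => PhiS_ne_zero b _
  have hlim : Tendsto h atBot (𝓝 1) := by
    rw [← div_one (1 : ℂ)]
    exact (tendsto_PhiS_atBot hb hu').div (tendsto_PhiS_atBot hb hv') one_ne_zero
  have hC0 : 0 ≤ C := by simpa using (norm_nonneg _).trans (hC 0)
  have hlim' : Tendsto h atTop (𝓝 0) := by
    refine squeeze_zero_norm' (a := fun x => C * Real.exp (-(2 * π * (x * (u.im - v.im))))) ?_ ?_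
    · filter_upwards [eventually_ge_atTop 0] with x hx
      have hCx := hC x
      rwa [max_eq_left hx] at hCx
    · rw [show (0 : ℝ) = C * 0 by simp]
      refine Tendsto.const_mul C (Real.tendsto_exp_neg_atTop_nhds_zero.comp ?_)
      exact Tendsto.const_mul_atTop (by positivity) (tendsto_id.atTop_mul_const hs)
  have hsub : ∀ τ : ℝ, 0 < τ → ∫ y : ℝ, h (y / τ) * Complex.exp (2 * π * y) =
      τ * ramIntegral b u v (-(Complex.I * τ)) := by
    intro τ hτ
    have hτ' : (τ : ℂ) ≠ 0 := by exact_mod_cast hτ.ne'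
    have := Measure.integral_comp_div (fun x : ℝ => ramIntegrand b u v (-(Complex.I * τ)) x) τ
    rw [abs_of_pos hτ, Complex.real_smul] at this
    rw [ramIntegral, ← this]
    refine integral_congr_ae (Eventually.of_forall fun y => ?_)
    simp only [ramIntegrand, hh]
    congr 2
    push_cast
    field_simp
    linear_combination y * Complex.I_sq
  have hval : ∫ y : ℝ, (Set.Iic (0 : ℝ)).indicator (fun y : ℝ => Complex.exp (2 * π * y)) y =
      1 / (2 * π) := by
    rw [integral_indicator measurableSet_Iic]
    simpa using integral_exp_mul_complex_Iic (a := 2 * π) (by simp [pi_pos]) 0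
  rw [← hval]
  refine Tendsto.congr' (f₁ := fun τ : ℝ => ∫ y : ℝ, h (y / τ) * Complex.exp (2 * π * y))
    (eventually_mem_nhdsWithin.mono hsub) ?_
  refine tendsto_integral_filter_of_dominated_convergence
    (fun y => C * Real.exp (-(2 * π) * |y|)) ?_ ?_
    ((integrable_exp_neg_mul_abs (by positivity)).const_mul C) ?_
  · exact Eventually.of_forall fun τ =>
      ((hcont.comp (continuous_id.div_const τ)).mul (by fun_prop)).aestronglyMeasurable
  · filter_upwards [Ioo_mem_nhdsGT (half_pos hs)] with τ hτ
    refine Eventually.of_forall fun y => ?_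
    rw [norm_mul, Complex.norm_exp]
    refine (mul_le_mul_of_nonneg_right (hC (y / τ)) (Real.exp_pos _).le).trans ?_
    rw [mul_assoc, ← Real.exp_add]
    refine mul_le_mul_of_nonneg_left (Real.exp_le_exp.2 ?_) hC0
    have e : (2 * π * y : ℂ).re = 2 * π * y := by simp
    rw [e]
    have key : |y| + y ≤ max (y / τ) 0 * (u.im - v.im) := by
      rcases le_total y 0 with hy | hy
      · rw [abs_of_nonpos hy, neg_add_cancel]
        positivity
      · rw [abs_of_nonneg hy, max_eq_left (div_nonneg hy hτ.1.le), div_mul_eq_mul_div,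
          le_div_iff₀ hτ.1]
        nlinarith [hτ.2]
    nlinarith [pi_pos]
  · have hne : ∀ᵐ y : ℝ, y ≠ 0 := by simp [ae_iff]
    filter_upwards [hne] with y hy
    have hinv : Tendsto (fun τ : ℝ => τ⁻¹) (𝓝[>] 0) atTop := tendsto_inv_nhdsGT_zero
    rcases lt_or_gt_of_ne hy with hy | hy
    · rw [Set.indicator_of_mem (Set.mem_Iic.2 hy.le)]
      have h1 : Tendsto (fun τ : ℝ => y / τ) (𝓝[>] 0) atBot :=
        (hinv.const_mul_atTop_of_neg hy)
      simpa using (hlim.comp h1).mul_const (Complex.exp (2 * π * y))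
    · rw [Set.indicator_of_notMem (by simpa using hy)]
      have h1 : Tendsto (fun τ : ℝ => y / τ) (𝓝[>] 0) atTop := hinv.const_mul_atTop hy
      simpa using (hlim'.comp h1).mul_const (Complex.exp (2 * π * y))

/-- The right-hand side of the integral Ramanujan formula. -/
def ramValue (b : ℝ) (u v w : ℂ) : ℂ :=
  Complex.exp (π * Complex.I * (1 - 4 * cB b ^ 2) / 12) *
    (PhiS b (u - v - cB b) * PhiS b (w + cB b) / PhiS b (u - v + w - cB b)) *
    Complex.exp (-2 * π * Complex.I * w * (v + cB b))

theorem tendsto_mul_ramFactor (hb : 0 < b) (hv : -((b + b⁻¹) / 2) < v.im)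
    (hu : u.im < (b + b⁻¹) / 2) (hs : 0 < u.im - v.im) :
    Tendsto (fun τ : ℝ => τ * ramFactor b u v (-(Complex.I * τ))) (𝓝[>] 0)
      (𝓝 (PhiS b (cB b - Complex.I * b) / (2 * π * Complex.I * b) / PhiS b (u - v - cB b))) := by
  have h1 := tendsto_mul_PhiS_cB hb
  have h2 : Tendsto (fun τ : ℝ => PhiS b (u - v + -(Complex.I * τ) - cB b)) (𝓝[>] 0)
      (𝓝 (PhiS b (u - v - cB b))) := by
    refine Tendsto.mono_left ?_ nhdsWithin_le_nhds
    refine (continuousAt_PhiS hb ?_).tendsto.comp ?_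
    · simp only [Complex.sub_im, cB_im]
      exact abs_lt.2 ⟨by linarith, by linarith⟩
    · refine Continuous.tendsto' (by fun_prop) _ _ (by simp)
  have h3 : Tendsto (fun τ : ℝ =>
      Complex.exp (-2 * π * Complex.I * -(Complex.I * τ) * (v + cB b))) (𝓝[>] 0) (𝓝 1) := by
    refine Tendsto.mono_left ?_ nhdsWithin_le_nhds
    exact Continuous.tendsto' (by fun_prop) _ _ (by simp)
  have h4 := (h1.div h2 (PhiS_ne_zero b _)).mul h3
  rw [mul_one] at h4
  refine h4.congr fun τ => ?_
  rw [ramFactor, neg_add_eq_sub]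
  simp only [Pi.div_apply]
  ring

theorem ramIntegral_eq_ramValue_of_lt (hb : 0 < b) (h : RamDomain b u v w)
    (hs : b < u.im - v.im) : ramIntegral b u v w = ramValue b u v w := by
  obtain ⟨h1, h2, h3, h4⟩ := h
  have hb' : (b : ℂ) ≠ 0 := by exact_mod_cast hb.ne'
  have hπ : (π : ℂ) ≠ 0 := by exact_mod_cast pi_ne_zero
  set K := ramIntegral b u v w / ramFactor b u v w with hK
  have hs0 : 0 < u.im - v.im := by linarith
  have t1 := tendsto_mul_ramIntegral hb h1 h2 hs0
  have t2 := (tendsto_mul_ramFactor hb h1 h2 hs0).const_mul K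
  have t3 : Tendsto (fun τ : ℝ => K * (τ * ramFactor b u v (-(Complex.I * τ)))) (𝓝[>] 0)
      (𝓝 (1 / (2 * π))) := by
    refine t1.congr' ?_
    filter_upwards [Ioo_mem_nhdsGT hs0] with τ hτ
    rw [hK, ramIntegral_div_ramFactor_eq hb h1 h2 hs (w := w) (w' := -(Complex.I * τ))
      ⟨by linarith, h3⟩ ⟨by simp only [Complex.neg_im, I_mul_ofReal_im]; linarith [hτ.2],
        by simpa using hτ.1⟩]
    rw [mul_left_comm, div_mul_cancel₀ _ (ramFactor_ne_zero b u v _)]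
  have key := tendsto_nhds_unique t2 t3
  rw [PhiS_cB_sub_I_mul hb] at key
  have hP := PhiS_ne_zero b (u - v - cB b)
  have hE := Complex.exp_ne_zero (π * Complex.I * (1 - 4 * cB b ^ 2) / 12)
  have hKval : K = Complex.exp (π * Complex.I * (1 - 4 * cB b ^ 2) / 12) *
      PhiS b (u - v - cB b) := by
    generalize Complex.exp (π * Complex.I * (1 - 4 * cB b ^ 2) / 12) = E at *
    field_simp at key
    linear_combination key
  have : ramIntegral b u v w = K * ramFactor b u v w := by
    rw [hK, div_mul_cancel₀ _ (ramFactor_ne_zero b u v w)]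
  rw [this, hKval, ramFactor, ramValue]
  ring

theorem ramValue_translate (b : ℝ) (u v w : ℂ) (η : ℝ) :
    ramValue b (u + Complex.I * η) (v + Complex.I * η) w =
      Complex.exp (2 * π * w * η) * ramValue b u v w := by
  rw [ramValue, ramValue, add_sub_add_right_eq_sub,
    show -2 * π * Complex.I * w * (v + Complex.I * η + cB b) =
      2 * π * w * η + -2 * π * Complex.I * w * (v + cB b) by
      linear_combination (-2 * π * w * η) * Complex.I_sq, Complex.exp_add]
  ring

theorem differentiableAt_ramValue_left (hb : 0 < b) (h : RamDomain b u v w) :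
    DifferentiableAt ℂ (fun u => ramValue b u v w) u := by
  obtain ⟨h1, h2, h3, h4⟩ := h
  have hd : ∀ z ∈ openStrip (-((b + b⁻¹) / 2)) ((b + b⁻¹) / 2), DifferentiableAt ℂ (PhiS b) z :=
    fun z hz => (differentiableOn_PhiS hb).differentiableAt ((isOpen_openStrip _ _).mem_nhds hz)
  have d1 : DifferentiableAt ℂ (fun u => PhiS b (u - v - cB b)) u :=
    DifferentiableAt.comp (g := PhiS b) u
      (hd _ ⟨by simp only [Complex.sub_im, cB_im]; linarith,
        by simp only [Complex.sub_im, cB_im]; linarith⟩) (by fun_prop)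
  have d2 : DifferentiableAt ℂ (fun u => PhiS b (u - v + w - cB b)) u :=
    DifferentiableAt.comp (g := PhiS b) u
      (hd _ ⟨by simp only [Complex.add_im, Complex.sub_im, cB_im]; linarith,
        by simp only [Complex.add_im, Complex.sub_im, cB_im]; linarith⟩) (by fun_prop)
  exact (((d1.mul_const _).div d2 (PhiS_ne_zero b _)).const_mul _).mul_const _

theorem ramIntegral_eq_ramValue_of_lt_inv (hb : 0 < b) (h : RamDomain b u v w)
    (hvb : v.im + b < (b + b⁻¹) / 2) : ramIntegral b u v w = ramValue b u v w := by
  obtain ⟨h1, h2, h3, h4⟩ := h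
  set S := openStrip (v.im - w.im) ((b + b⁻¹) / 2) with hS
  have hdom : ∀ z ∈ S, RamDomain b z v w := fun z hz => ⟨h1, hz.2, h3, by linarith [hz.1]⟩
  have a1 : AnalyticOnNhd ℂ (fun u => ramIntegral b u v w) S :=
    DifferentiableOn.analyticOnNhd (fun z hz =>
      ((hdom z hz).differentiableAt_ramIntegral_left hb).differentiableWithinAt)
      (isOpen_openStrip _ _)
  have a2 : AnalyticOnNhd ℂ (fun u => ramValue b u v w) S :=
    DifferentiableOn.analyticOnNhd (fun z hz =>
      (differentiableAt_ramValue_left hb (hdom z hz)).differentiableWithinAt)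
      (isOpen_openStrip _ _)
  obtain ⟨y, hy1, hy2⟩ := exists_between (max_lt hvb (by linarith : v.im - w.im < (b + b⁻¹) / 2))
  obtain ⟨hy3, hy4⟩ := max_lt_iff.1 hy1
  have hmem : Complex.I * y ∈ S := ⟨by simpa using hy4, by simpa using hy2⟩
  refine a1.eqOn_of_preconnected_of_eventuallyEq a2 (convex_openStrip _ _).isPreconnected hmem ?_
    (⟨by linarith, h2⟩ : u ∈ S)
  have hnhds : S ∩ {z : ℂ | v.im + b < z.im} ∈ 𝓝 (Complex.I * y) :=
    inter_mem ((isOpen_openStrip _ _).mem_nhds hmem)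
      ((isOpen_lt continuous_const Complex.continuous_im).mem_nhds (by simpa using hy3))
  filter_upwards [hnhds] with z hz
  exact ramIntegral_eq_ramValue_of_lt hb (hdom z hz.1) (by linarith [Set.mem_ofPred.1 hz.2])

theorem ramIntegral_eq_ramValue (hb : 0 < b) (h : RamDomain b u v w) :
    ramIntegral b u v w = ramValue b u v w := by
  have ⟨h1, h2, h3, h4⟩ := h
  have hbi : 0 < b⁻¹ := inv_pos.2 hb
  set ε := min (v.im + (b + b⁻¹) / 2) (b⁻¹ / 2) with hε
  have hε0 : 0 < ε := lt_min (by linarith) (by linarith)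
  have m1 : ε ≤ v.im + (b + b⁻¹) / 2 := min_le_left _ _
  have m2 : ε ≤ b⁻¹ / 2 := min_le_right _ _
  set η := ε - (v.im + (b + b⁻¹) / 2) with hη
  have hdom : RamDomain b (u + Complex.I * η) (v + Complex.I * η) w := by
    refine ⟨?_, ?_, h3, ?_⟩ <;> simp only [Complex.add_im, I_mul_ofReal_im] <;> linarith
  have e1 := h.ramIntegral_translate hb η hdom
  rw [ramIntegral_eq_ramValue_of_lt_inv hb hdom
    (by simp only [Complex.add_im, I_mul_ofReal_im]; linarith), ramValue_translate] at e1
  exact (mul_left_cancel₀ (Complex.exp_ne_zero _) e1).symm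

theorem ramValue_eq_inv (hb : 0 < b) (h : RamDomain b u v w) :
    ramValue b u v w = (Complex.exp (π * Complex.I * (1 - 4 * cB b ^ 2) / 12))⁻¹ *
        (PhiS b (v - u - w + cB b) / (PhiS b (v - u + cB b) * PhiS b (-w - cB b))) *
        Complex.exp (-2 * π * Complex.I * w * (u - cB b)) := by
  obtain ⟨h1, h2, h3, h4⟩ := h
  have p1 := PhiS_mul_PhiS_neg hb (z := u - v - cB b)
    (by simp only [Complex.sub_im, cB_im]; exact abs_lt.2 ⟨by linarith, by linarith⟩)
  have p2 := PhiS_mul_PhiS_neg hb (z := w + cB b)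
    (by simp only [Complex.add_im, cB_im]; exact abs_lt.2 ⟨by linarith, by linarith⟩)
  have p3 := PhiS_mul_PhiS_neg hb (z := u - v + w - cB b)
    (by simp only [Complex.add_im, Complex.sub_im, cB_im]
        exact abs_lt.2 ⟨by linarith, by linarith⟩)
  rw [show -(u - v - cB b) = v - u + cB b by ring] at p1
  rw [show -(w + cB b) = -w - cB b by ring] at p2
  rw [show -(u - v + w - cB b) = v - u - w + cB b by ring] at p3
  have n1 := PhiS_ne_zero b (v - u + cB b)
  have n2 := PhiS_ne_zero b (-w - cB b)
  have n3 := PhiS_ne_zero b (u - v + w - cB b)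
  have hb' : (b : ℂ) ≠ 0 := by exact_mod_cast hb.ne'
  have hexp : Complex.exp (π * Complex.I * (1 - 4 * cB b ^ 2) / 12) *
      Complex.exp (π * Complex.I * (1 - 4 * cB b ^ 2) / 12) *
      Complex.exp (-2 * π * Complex.I * w * (v + cB b)) *
      (PhiS b (u - v - cB b) * PhiS b (v - u + cB b)) * (PhiS b (w + cB b) * PhiS b (-w - cB b)) =
      (PhiS b (u - v + w - cB b) * PhiS b (v - u - w + cB b)) *
        Complex.exp (-2 * π * Complex.I * w * (u - cB b)) := by
    rw [p1, p2, p3]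
    simp only [← Complex.exp_add]
    congr 1
    have hc : 12 * cB b ^ 2 = -3 * (b ^ 2 + (b⁻¹ : ℝ) ^ 2 + 2) := by
      rw [cB, Complex.ofReal_inv]
      field_simp
      linear_combination (12 * (b ^ 2 + 1) ^ 2) * Complex.I_sq
    linear_combination (π * Complex.I / 36) * hc
  have hE := Complex.exp_ne_zero (π * Complex.I * (1 - 4 * cB b ^ 2) / 12)
  rw [ramValue]
  generalize Complex.exp (π * Complex.I * (1 - 4 * cB b ^ 2) / 12) = E at *
  generalize Complex.exp (-2 * π * Complex.I * w * (v + cB b)) = E1 at *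
  generalize Complex.exp (-2 * π * Complex.I * w * (u - cB b)) = E2 at *
  field_simp
  linear_combination hexp

theorem Phi_eq_PhiS {z : ℂ} (hz : |z.im| < (b + b⁻¹) / 2) : Phi b z = PhiS b z := by
  obtain ⟨h1, h2⟩ := abs_lt.1 hz
  rw [Phi, if_neg h1.not_ge, if_neg h2.not_ge]

end Evaluation

/-- The integral analogue of Ramanujan's ₁ψ₁-summation formula (eqs. (56)-(58) of the paper):
absolute convergence of `Ψ(u,v,w)` and its two closed-form evaluations. -/
theorem ramanujan_integral (bb : ℝ) (hbb : 0 < bb) (u v w : ℂ)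
    (h1 : 0 < (v + cB bb).im) (h2 : 0 < (cB bb - u).im)
    (h3 : (v - u).im < w.im) (h4 : w.im < 0) :
    Integrable (fun x : ℝ =>
        Phi bb (x + u) / Phi bb (x + v) * Complex.exp (2 * π * Complex.I * w * x)) ∧
    (∫ x : ℝ, Phi bb (x + u) / Phi bb (x + v) * Complex.exp (2 * π * Complex.I * w * x)) =
      Complex.exp (π * Complex.I * (1 - 4 * cB bb ^ 2) / 12) *
        (Phi bb (u - v - cB bb) * Phi bb (w + cB bb) / Phi bb (u - v + w - cB bb)) *
        Complex.exp (-2 * π * Complex.I * w * (v + cB bb)) ∧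
    Complex.exp (π * Complex.I * (1 - 4 * cB bb ^ 2) / 12) *
        (Phi bb (u - v - cB bb) * Phi bb (w + cB bb) / Phi bb (u - v + w - cB bb)) *
        Complex.exp (-2 * π * Complex.I * w * (v + cB bb)) =
      (Complex.exp (π * Complex.I * (1 - 4 * cB bb ^ 2) / 12))⁻¹ *
        (Phi bb (v - u - w + cB bb) / (Phi bb (v - u + cB bb) * Phi bb (-w - cB bb))) *
        Complex.exp (-2 * π * Complex.I * w * (u - cB bb)) := by
  obtain ⟨h1, h2, h3, h4⟩ : RamDomain bb u v w := by
    simp only [Complex.add_im, Complex.sub_im, cB_im] at h1 h2 h3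
    exact ⟨by linarith, by linarith, h4, by linarith⟩
  have hdom : RamDomain bb u v w := ⟨h1, h2, h3, h4⟩
  have hP : ∀ z : ℂ, -((bb + bb⁻¹) / 2) < z.im → z.im < (bb + bb⁻¹) / 2 → Phi bb z = PhiS bb z :=
    fun z z1 z2 => Phi_eq_PhiS (abs_lt.2 ⟨z1, z2⟩)
  have hfun : (fun x : ℝ => Phi bb (x + u) / Phi bb (x + v) *
      Complex.exp (2 * π * Complex.I * w * x)) = fun x : ℝ => ramIntegrand bb u v w x := by
    funext x
    rw [ramIntegrand, Phi_eq_PhiS (by simpa using hdom.abs_im_left),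
      Phi_eq_PhiS (by simpa using hdom.abs_im_right)]
  rw [hfun, hP (u - v - cB bb), hP (w + cB bb), hP (u - v + w - cB bb), hP (v - u - w + cB bb),
    hP (v - u + cB bb), hP (-w - cB bb)]
  · exact ⟨hdom.integrable hbb, ramIntegral_eq_ramValue hbb hdom, ramValue_eq_inv hbb hdom⟩
  all_goals
    simp only [Complex.add_im, Complex.sub_im, Complex.neg_im, cB_im]
    linarith
end
end

section
/- Inversion relation for Faddeev's quantum dilogarithm: for every complex z with |Im z| < Im c_𝖻, one has Φ_𝖻(z) · Φ_𝖻(−z) = ζ_inv⁻¹ · e^{iπz²}, where ζ_inv = exp(iπ(1 + 2c_𝖻²)/6). -/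
open Real MeasureTheory

noncomputable section

open Filter Topology Set

/-- An entire function vanishing at the origin is divisible by the coordinate. -/
lemma exists_entire_eq_mul {f : ℂ → ℂ} (hf : Differentiable ℂ f) (h0 : f 0 = 0) :
    ∃ g : ℂ → ℂ, Differentiable ℂ g ∧ ∀ w, f w = w * g w := by
  refine ⟨dslope f 0, ?_, fun w => ?_⟩
  · rw [← differentiableOn_univ] at hf ⊢
    exact (Complex.differentiableOn_dslope univ_mem).2 hf
  · simpa [h0] using (sub_smul_dslope f 0 w).symm

lemma deriv_of_eq_mul {f g : ℂ → ℂ} (hg : Differentiable ℂ g) (h : ∀ w, f w = w * g w) (w : ℂ) :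
    deriv f w = g w + w * deriv g w := by
  rw [funext h, deriv_fun_mul differentiableAt_fun_id (hg w)]
  simp

lemma differentiable_deriv_of_entire {f : ℂ → ℂ} (hf : Differentiable ℂ f) :
    Differentiable ℂ (deriv f) := by
  rw [← differentiableOn_univ] at hf ⊢
  exact hf.deriv isOpen_univ

/-- Second order expansion of an entire function at the origin. -/
lemma exists_entire_eq_add_sq_mul {f : ℂ → ℂ} (hf : Differentiable ℂ f) (h1 : deriv f 0 = 0) :
    ∃ g : ℂ → ℂ, Differentiable ℂ g ∧ g 0 = deriv (deriv f) 0 / 2 ∧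
      ∀ w, f w = f 0 + w ^ 2 * g w := by
  obtain ⟨p, hp, hfp⟩ := exists_entire_eq_mul (f := fun w => f w - f 0) (hf.sub_const _) (by simp)
  have hd : deriv f = fun w => p w + w * deriv p w := by
    ext w
    rw [← deriv_of_eq_mul hp hfp w, deriv_sub_const_fun]
  have hp0 : p 0 = 0 := by simpa [hd] using h1
  obtain ⟨g, hg, hpg⟩ := exists_entire_eq_mul hp hp0
  refine ⟨g, hg, ?_, fun w => ?_⟩
  · have hp' := differentiable_deriv_of_entire hp
    rw [hd, deriv_fun_add (hp 0) (differentiableAt_fun_id.fun_mul (hp' 0)),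
      deriv_of_eq_mul hp' (fun _ => rfl), deriv_of_eq_mul hg hpg]
    simp
  · have := hfp w
    rw [hpg] at this
    linear_combination this

lemma exists_sinh_expansion :
    ∃ u : ℂ → ℂ, Differentiable ℂ u ∧ u 0 = 1 / 6 ∧
      ∀ w, Complex.sinh w = w * (1 + w ^ 2 * u w) := by
  obtain ⟨s, hs, hsinh⟩ := exists_entire_eq_mul Complex.differentiable_sinh Complex.sinh_zero
  have hs' := differentiable_deriv_of_entire hs
  have hcosh : ∀ w, Complex.cosh w = s w + w * deriv s w := fun w => by
    rw [← deriv_of_eq_mul hs hsinh w, Complex.deriv_sinh]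
  have hsinh2 : ∀ w, Complex.sinh w = 2 * deriv s w + w * deriv (deriv s) w := fun w => by
    rw [← Complex.deriv_cosh, funext hcosh, deriv_fun_add (hs w)
      (differentiableAt_fun_id.fun_mul (hs' w)), deriv_of_eq_mul hs' (fun _ => rfl)]
    ring
  have hs'' := differentiable_deriv_of_entire hs'
  have hs0 : s 0 = 1 := by simpa using (hcosh 0).symm
  have hs1 : deriv s 0 = 0 := by simpa using hsinh2 0
  have hs2 : deriv (deriv s) 0 = 1 / 3 := by
    have h : deriv Complex.sinh 0 = 3 * deriv (deriv s) 0 := by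
      rw [funext hsinh2, deriv_fun_add ((hs' 0).const_mul 2)
        (differentiableAt_fun_id.fun_mul (hs'' 0)), deriv_of_eq_mul hs'' (fun _ => rfl),
        deriv_const_mul_field]
      ring
    rw [Complex.deriv_sinh, Complex.cosh_zero] at h
    linear_combination -h / 3
  obtain ⟨u, hu, hu0, hsu⟩ := exists_entire_eq_add_sq_mul hs hs1
  refine ⟨u, hu, by rw [hu0, hs2]; norm_num, fun w => ?_⟩
  rw [hsinh, hsu, hs0]

lemma exists_cos_expansion :
    ∃ v : ℂ → ℂ, Differentiable ℂ v ∧ v 0 = -(1 / 2) ∧ ∀ w, Complex.cos w = 1 + w ^ 2 * v w := by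
  obtain ⟨v, hv, hv0, h⟩ := exists_entire_eq_add_sq_mul Complex.differentiable_cos (by simp)
  refine ⟨v, hv, ?_, fun w => by rw [h, Complex.cos_zero]⟩
  rw [hv0, funext fun w => Complex.deriv_cos (x := w), deriv.fun_neg, Complex.deriv_sin,
    Complex.cos_zero]
  ring

lemma sinh_ne_zero_of_abs_im_lt_pi {w : ℂ} (hw : w ≠ 0) (him : |w.im| < π) :
    Complex.sinh w ≠ 0 := by
  intro h
  have h2 : Complex.sin (w * Complex.I) = 0 := by rw [Complex.sin_mul_I, h, zero_mul]
  obtain ⟨n, hn⟩ := Complex.sin_eq_zero_iff.1 h2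
  have hre : -w.im = n * π := by simpa using congrArg Complex.re hn
  have hn0 : n = 0 := by
    have h3 : |(n : ℝ)| * π < 1 * π := by
      rw [← abs_of_pos pi_pos, ← abs_mul, ← hre, abs_neg, abs_of_pos pi_pos, one_mul]
      exact him
    have h4 : |(n : ℝ)| < 1 := lt_of_mul_lt_mul_right h3 pi_pos.le
    exact Int.abs_lt_one_iff.1 (by exact_mod_cast h4)
  simp [hn0, hw] at hn

lemma exp_abs_le_norm_sinh {w : ℂ} (hw : 1 ≤ |w.re|) :
    rexp |w.re| / 4 ≤ ‖Complex.sinh w‖ := by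
  have key : |‖Complex.exp w‖ - ‖Complex.exp (-w)‖| / 2 ≤ ‖Complex.sinh w‖ := by
    rw [Complex.sinh, norm_div, Complex.norm_two]
    gcongr
    exact abs_norm_sub_norm_le _ _
  rw [Complex.norm_exp, Complex.norm_exp, Complex.neg_re] at key
  have hsymm : |rexp w.re - rexp (-w.re)| = |rexp |w.re| - rexp (-|w.re|)| := by
    rcases abs_choice w.re with h | h <;> rw [h]
    rw [neg_neg, abs_sub_comm]
  rw [hsymm] at key
  refine le_trans ?_ key
  have h1 : rexp (-|w.re|) ≤ 1 := by simp
  have h2 : 2 ≤ rexp |w.re| := by linarith [add_one_le_exp |w.re|]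
  linarith [le_abs_self (rexp |w.re| - rexp (-|w.re|))]

lemma integral_inv_add_I_mul {e : ℝ} (he : 0 < e) (T : ℝ) :
    ∫ t in (-T)..T, ((t : ℂ) + e * Complex.I)⁻¹ = -2 * Complex.I * (arctan (T / e) : ℝ) := by
  have hd : ∀ t : ℝ, HasDerivAt (fun t : ℝ => ((Real.log (t ^ 2 + e ^ 2) / 2 : ℝ) : ℂ)
      - Complex.I * (arctan (t / e) : ℝ)) ((t : ℂ) + e * Complex.I)⁻¹ t := by
    intro t
    have hpos : t ^ 2 + e ^ 2 ≠ 0 := by positivity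
    have h1 : HasDerivAt (fun t : ℝ => Real.log (t ^ 2 + e ^ 2) / 2) (t / (t ^ 2 + e ^ 2)) t := by
      refine HasDerivAt.congr_deriv
        ((((hasDerivAt_id' t).pow 2).add_const (e ^ 2)).log hpos |>.div_const 2) ?_
      simp
      field_simp
    have h2 : HasDerivAt (fun t : ℝ => arctan (t / e)) (e / (t ^ 2 + e ^ 2)) t := by
      refine HasDerivAt.congr_deriv ((hasDerivAt_id' t).div_const e).arctan ?_
      have : 1 + (t / e) ^ 2 ≠ 0 := by positivity
      field_simp
      ring
    refine HasDerivAt.congr_deriv (h1.ofReal_comp.sub (h2.ofReal_comp.const_mul Complex.I)) ?_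
    have hc : (t : ℂ) ^ 2 + (e : ℂ) ^ 2 ≠ 0 := by exact_mod_cast hpos
    push_cast
    refine eq_inv_of_mul_eq_one_left ?_
    field_simp
    linear_combination -(e : ℂ) ^ 2 * Complex.I_sq
  rw [intervalIntegral.integral_eq_sub_of_hasDerivAt (fun t _ => hd t)]
  · simp [neg_div]
    ring
  · apply Continuous.intervalIntegrable
    apply Continuous.inv₀ (by fun_prop)
    intro t h
    simpa [he.ne'] using congrArg Complex.im h

lemma integral_inv_cube_add_I_mul {e : ℝ} (he : 0 < e) (T : ℝ) :
    ∫ t in (-T)..T, (((t : ℂ) + e * Complex.I) ^ 3)⁻¹ =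
      (((-T : ℂ) + e * Complex.I) ^ 2)⁻¹ / 2 - (((T : ℂ) + e * Complex.I) ^ 2)⁻¹ / 2 := by
  have hne : ∀ t : ℝ, (t : ℂ) + e * Complex.I ≠ 0 := by
    intro t h
    simpa [he.ne'] using congrArg Complex.im h
  have hd : ∀ t : ℝ, HasDerivAt (fun t : ℝ => -((((t : ℂ) + e * Complex.I) ^ 2)⁻¹ / 2))
      (((t : ℂ) + e * Complex.I) ^ 3)⁻¹ t := by
    intro t
    have h := hne t
    refine HasDerivAt.congr_deriv
      (((((hasDerivAt_id' t).ofReal_comp.add_const (e * Complex.I)).pow 2).inv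
        (pow_ne_zero 2 h)).div_const 2 |>.neg) ?_
    simp
    field_simp
  rw [intervalIntegral.integral_eq_sub_of_hasDerivAt (fun t _ => hd t)]
  · push_cast
    ring
  · apply Continuous.intervalIntegrable
    exact Continuous.inv₀ (by fun_prop) fun t => pow_ne_zero 3 (hne t)

/-- Contour shift for an odd function whose only singularity in a horizontal strip is a pole of
order at most three at the origin: the integral along the upper edge of the strip is `-πi` times
the residue. -/
lemma integral_add_mul_I_of_odd {G k : ℂ → ℂ} {a r : ℂ} {e : ℝ} (he : 0 < e)
    (hodd : ∀ w, G (-w) = -G w) (hk : DifferentiableOn ℂ k {w | |w.im| ≤ e})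
    (hG : ∀ w, w ≠ 0 → |w.im| ≤ e → G w = a * (w ^ 3)⁻¹ + r * w⁻¹ + k w)
    {B : ℝ → ℝ} (hB : Tendsto B atTop (𝓝 0))
    (hdecay : ∀ᶠ T in atTop, ∀ w : ℂ, |w.re| = T → |w.im| ≤ e → ‖G w‖ ≤ B T)
    (hint : Integrable fun t : ℝ => G (t + e * Complex.I)) :
    ∫ t : ℝ, G (t + e * Complex.I) = -(π * Complex.I * r) := by
  have hne : ∀ t : ℝ, (t : ℂ) + e * Complex.I ≠ 0 := by
    intro t h
    simpa [he.ne'] using congrArg Complex.im h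
  have hkodd : ∀ w, w ≠ 0 → |w.im| ≤ e → k (-w) = -k w := by
    intro w hw him
    have h1 := hG w hw him
    have h2 := hG (-w) (neg_ne_zero.2 hw) (by simpa using him)
    rw [hodd, h1, Odd.neg_pow (by decide), inv_neg, inv_neg] at h2
    linear_combination -h2
  have hkcont : Continuous fun t : ℝ => k (t + e * Complex.I) := by
    refine hk.continuousOn.comp_continuous (by fun_prop) fun t => ?_
    simp [abs_of_pos he]
  have htwo : ∀ T : ℝ, 2 * ∫ t in (-T)..T, k (t + e * Complex.I) =
      Complex.I * (∫ y in (-e)..e, k (T + y * Complex.I)) -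
        Complex.I * ∫ y in (-e)..e, k ((-T : ℝ) + y * Complex.I) := by
    intro T
    have hc := Complex.integral_boundary_rect_eq_zero_of_differentiableOn k
      ⟨-T, -e⟩ ⟨T, e⟩ (hk.mono fun w hw => by
        have h := hw.2
        simp only [mem_preimage, uIcc_of_le (show -e ≤ e by linarith)] at h
        exact abs_le.2 h)
    have hlow : ∫ x in (-T)..T, k (x + (-e : ℝ) * Complex.I) =
        -∫ x in (-T)..T, k (x + e * Complex.I) := by
      have h := intervalIntegral.integral_comp_neg (a := -T) (b := T)
        (fun x : ℝ => k (x + (-e : ℝ) * Complex.I))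
      rw [neg_neg] at h
      rw [← h, ← intervalIntegral.integral_neg]
      refine intervalIntegral.integral_congr fun t _ => ?_
      rw [← hkodd _ (hne t) (by simp [abs_of_pos he])]
      push_cast
      ring_nf
    simp only [smul_eq_mul] at hc
    rw [hlow] at hc
    linear_combination -hc
  have hT0 : ∀ᶠ T : ℝ in atTop, 0 < T := eventually_gt_atTop 0
  have hJ : Tendsto (fun T : ℝ => ∫ t in (-T)..T, k (t + e * Complex.I)) atTop (𝓝 0) := by
    have hK : Tendsto (fun T : ℝ => (B T + ‖a‖ * (T ^ 3)⁻¹ + ‖r‖ * T⁻¹) * (2 * e)) atTop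
        (𝓝 0) := by
      have h3 : Tendsto (fun T : ℝ => (T ^ 3)⁻¹) atTop (𝓝 0) :=
        tendsto_inv_atTop_zero.comp (tendsto_pow_atTop (by norm_num))
      simpa using ((hB.add (h3.const_mul ‖a‖)).add
        (tendsto_inv_atTop_zero.const_mul ‖r‖)).mul_const (2 * e)
    refine squeeze_zero_norm' ?_ hK
    filter_upwards [hdecay, hT0] with T hT hTpos
    have hbound : ∀ x : ℝ, |x| = T → ‖∫ y in (-e)..e, k (x + y * Complex.I)‖ ≤
        (B T + ‖a‖ * (T ^ 3)⁻¹ + ‖r‖ * T⁻¹) * (2 * e) := by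
      intro x hx
      have h := intervalIntegral.norm_integral_le_of_norm_le_const (a := -e) (b := e)
        (f := fun y : ℝ => k (x + y * Complex.I))
        (C := B T + ‖a‖ * (T ^ 3)⁻¹ + ‖r‖ * T⁻¹) (fun y hy => ?_)
      · rwa [sub_neg_eq_add, ← two_mul, abs_of_pos (by positivity)] at h
      · rw [uIoc_of_le (by linarith)] at hy
        set w : ℂ := x + y * Complex.I with hw
        have hre : w.re = x := by simp [hw]
        have him : w.im = y := by simp [hw]
        have hwim : |w.im| ≤ e := by rw [him]; exact abs_le.2 ⟨hy.1.le, hy.2⟩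
        have hTw : T ≤ ‖w‖ := by rw [← hx, ← hre]; exact Complex.abs_re_le_norm w
        have hw0 : w ≠ 0 := norm_pos_iff.1 (hTpos.trans_le hTw)
        have hkw : k w = G w - a * (w ^ 3)⁻¹ - r * w⁻¹ := by
          linear_combination -hG w hw0 hwim
        rw [hkw]
        refine (norm_sub_le _ _).trans (add_le_add ((norm_sub_le _ _).trans
          (add_le_add (hT w (by rw [hre, hx]) hwim) ?_)) ?_)
        · rw [norm_mul, norm_inv, norm_pow]
          gcongr
        · rw [norm_mul, norm_inv]
          gcongr
    have h1 := hbound T (abs_of_pos hTpos)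
    have h2 := hbound (-T) (by rw [abs_neg, abs_of_pos hTpos])
    have h3 := congrArg norm (htwo T)
    rw [norm_mul, Complex.norm_two] at h3
    have h4 := norm_sub_le (Complex.I * (∫ y in (-e)..e, k (T + y * Complex.I)))
      (Complex.I * ∫ y in (-e)..e, k ((-T : ℝ) + y * Complex.I))
    rw [← h3, norm_mul, norm_mul, Complex.norm_I, one_mul, one_mul] at h4
    linarith
  have hsplit : ∀ T : ℝ, ∫ t in (-T)..T, G (t + e * Complex.I) =
      a * ((((-T : ℂ) + e * Complex.I) ^ 2)⁻¹ / 2 - (((T : ℂ) + e * Complex.I) ^ 2)⁻¹ / 2) +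
        r * (-2 * Complex.I * (arctan (T / e) : ℝ)) +
        ∫ t in (-T)..T, k (t + e * Complex.I) := by
    intro T
    have hc3 : Continuous fun t : ℝ => a * (((t : ℂ) + e * Complex.I) ^ 3)⁻¹ :=
      continuous_const.mul (Continuous.inv₀ (by fun_prop) fun t => pow_ne_zero 3 (hne t))
    have hc1 : Continuous fun t : ℝ => r * ((t : ℂ) + e * Complex.I)⁻¹ :=
      continuous_const.mul (Continuous.inv₀ (by fun_prop) hne)
    rw [← integral_inv_add_I_mul he, ← integral_inv_cube_add_I_mul he,
      ← intervalIntegral.integral_const_mul, ← intervalIntegral.integral_const_mul,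
      ← intervalIntegral.integral_add (hc3.intervalIntegrable _ _) (hc1.intervalIntegrable _ _),
      ← intervalIntegral.integral_add ((hc3.fun_add hc1).intervalIntegrable _ _)
        (hkcont.intervalIntegrable _ _)]
    refine intervalIntegral.integral_congr fun t _ => hG _ (hne t) ?_
    simp [abs_of_pos he]
  have hsq : ∀ x : ℝ → ℝ, (∀ T, |x T| = |T|) →
      Tendsto (fun T : ℝ => (((x T : ℂ) + e * Complex.I) ^ 2)⁻¹ / 2) atTop (𝓝 0) := by
    intro x hx
    have h2 : Tendsto (fun T : ℝ => (T ^ 2)⁻¹) atTop (𝓝 0) :=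
      tendsto_inv_atTop_zero.comp (tendsto_pow_atTop (by norm_num))
    refine squeeze_zero_norm' ?_ h2
    filter_upwards [hT0] with T hT
    have hle : T ≤ ‖(x T : ℂ) + e * Complex.I‖ := by
      simpa [hx, abs_of_pos hT] using Complex.abs_re_le_norm ((x T : ℂ) + e * Complex.I)
    rw [norm_div, norm_inv, norm_pow, Complex.norm_two]
    refine (div_le_self (by positivity) (by norm_num)).trans ?_
    gcongr
  have hatan : Tendsto (fun T : ℝ => ((arctan (T / e) : ℝ) : ℂ)) atTop (𝓝 ((π / 2 : ℝ) : ℂ)) :=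
    (Complex.continuous_ofReal.tendsto _).comp
      ((tendsto_arctan_atTop.mono_right nhdsWithin_le_nhds).comp (tendsto_id.atTop_div_const he))
  have hlim := intervalIntegral_tendsto_integral hint tendsto_neg_atTop_atBot tendsto_id
  refine tendsto_nhds_unique hlim ?_
  simp only [id_eq, hsplit]
  have hn := hsq (fun T => -T) (fun T => abs_neg T)
  have hp := hsq (fun T => T) (fun T => rfl)
  push_cast at hn
  have := ((((hn.sub hp).const_mul a).add
    ((hatan.const_mul (-2 * Complex.I)).const_mul r)).add hJ)
  convert this using 2
  push_cast
  ring

lemma phiKer_neg (bb : ℝ) (z w : ℂ) : phiKer bb z (-w) = -phiKer bb (-z) w := by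
  simp only [phiKer, neg_mul, neg_div, Complex.sinh_neg, mul_neg, neg_neg, div_neg]

lemma norm_phiKer_le {bb : ℝ} (hbb : 0 < bb) {e : ℝ} (z : ℂ) {w : ℂ} (him : |w.im| ≤ e)
    (hre : max bb bb⁻¹ ≤ |w.re|) :
    ‖phiKer bb z w‖ ≤
      4 * rexp (2 * |z.re| * e) * rexp (-(bb + bb⁻¹ - 2 * |z.im|) * |w.re|) := by
  obtain ⟨hb1, hb2⟩ := max_le_iff.1 hre
  have hmul : (w * bb).re = w.re * bb := by simp
  have hdiv : (w / bb).re = w.re * bb⁻¹ := by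
    rw [Complex.div_ofReal_re, div_eq_mul_inv]
  have h1 : rexp (|w.re| * bb) / 4 ≤ ‖Complex.sinh (w * bb)‖ := by
    have habs : |(w * bb).re| = |w.re| * bb := by rw [hmul, abs_mul, abs_of_pos hbb]
    rw [← habs]
    refine exp_abs_le_norm_sinh ?_
    rw [habs]
    calc (1 : ℝ) = bb⁻¹ * bb := (inv_mul_cancel₀ hbb.ne').symm
      _ ≤ _ := by gcongr
  have h2 : rexp (|w.re| * bb⁻¹) / 4 ≤ ‖Complex.sinh (w / bb)‖ := by
    have habs : |(w / bb).re| = |w.re| * bb⁻¹ := by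
      rw [hdiv, abs_mul, abs_of_pos (inv_pos.2 hbb)]
    rw [← habs]
    refine exp_abs_le_norm_sinh ?_
    rw [habs]
    calc (1 : ℝ) = bb * bb⁻¹ := (mul_inv_cancel₀ hbb.ne').symm
      _ ≤ _ := by gcongr
  have h3 : 1 ≤ ‖w‖ := by
    refine le_trans ?_ (hre.trans (Complex.abs_re_le_norm w))
    rcases le_total 1 bb with h | h
    · exact le_max_of_le_left h
    · exact le_max_of_le_right ((one_le_inv₀ hbb).2 h)
  have h4 : ‖Complex.exp (-2 * Complex.I * z * w)‖ ≤
      rexp (2 * |z.re| * e) * rexp (2 * |z.im| * |w.re|) := by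
    rw [Complex.norm_exp, ← Real.exp_add]
    refine exp_le_exp.2 ?_
    have hr : (-2 * Complex.I * z * w).re = 2 * (z.re * w.im) + 2 * (z.im * w.re) := by
      simp
      ring
    have h5 : z.re * w.im ≤ |z.re| * e := by
      refine (le_abs_self _).trans ?_
      rw [abs_mul]
      gcongr
    have h6 : z.im * w.re ≤ |z.im| * |w.re| := by
      rw [← abs_mul]
      exact le_abs_self _
    rw [hr]
    linarith
  have h7 : 4 * (rexp (|w.re| * bb) / 4) * (rexp (|w.re| * bb⁻¹) / 4) * 1 ≤
      ‖4 * Complex.sinh (w * bb) * Complex.sinh (w / bb) * w‖ := by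
    rw [norm_mul, norm_mul, norm_mul, show ‖(4 : ℂ)‖ = 4 by simp]
    gcongr
  rw [phiKer, norm_div]
  refine (div_le_div₀ (by positivity) h4 (by positivity) h7).trans (le_of_eq ?_)
  rw [show -(bb + bb⁻¹ - 2 * |z.im|) * |w.re| =
    2 * |z.im| * |w.re| - |w.re| * bb - |w.re| * bb⁻¹ by ring, Real.exp_sub, Real.exp_sub]
  field_simp

lemma integrable_phiKer {bb : ℝ} (hbb : 0 < bb) {e : ℝ} (he : 0 < e)
    (he1 : e * bb < π) (he2 : e * bb⁻¹ < π) {z : ℂ} (hz : 2 * |z.im| < bb + bb⁻¹) :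
    Integrable fun t : ℝ => phiKer bb z (t + e * Complex.I) := by
  have hne : ∀ t : ℝ, (t : ℂ) + e * Complex.I ≠ 0 := by
    intro t h
    simpa [he.ne'] using congrArg Complex.im h
  have hbc : (bb : ℂ) ≠ 0 := by exact_mod_cast hbb.ne'
  have hcont : Continuous fun t : ℝ => phiKer bb z (t + e * Complex.I) := by
    unfold phiKer
    refine Continuous.div (by fun_prop) (by fun_prop) fun t => ?_
    refine mul_ne_zero (mul_ne_zero (mul_ne_zero (by norm_num) ?_) ?_) (hne t)
    · refine sinh_ne_zero_of_abs_im_lt_pi (mul_ne_zero (hne t) hbc) ?_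
      simpa [abs_of_pos hbb, abs_of_pos he] using he1
    · refine sinh_ne_zero_of_abs_im_lt_pi (div_ne_zero (hne t) hbc) ?_
      simpa [div_eq_mul_inv, ← Complex.ofReal_inv, abs_of_pos hbb, abs_of_pos he] using he2
  set d := bb + bb⁻¹ - 2 * |z.im| with hd
  have hdpos : 0 < d := by linarith
  have hbd : ∀ t : ℝ, max bb bb⁻¹ ≤ |t| → ‖phiKer bb z (t + e * Complex.I)‖ ≤
      4 * rexp (2 * |z.re| * e) * rexp (-d * |t|) := by
    intro t ht
    have hre : ((t : ℂ) + e * Complex.I).re = t := by simp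
    have h := norm_phiKer_le hbb (e := e) z (w := t + e * Complex.I)
      (by simp [abs_of_pos he]) (by rwa [hre])
    rwa [hre] at h
  refine hcont.locallyIntegrable.integrable_of_isBigO_atBot_atTop
    (g := fun t => rexp (d * t)) (g' := fun t => rexp (-d * t)) ?_ ?_ ?_ ?_
  · refine Asymptotics.IsBigO.of_bound (4 * rexp (2 * |z.re| * e)) ?_
    filter_upwards [eventually_le_atBot (-max bb bb⁻¹), eventually_le_atBot 0] with t ht ht0
    have h := hbd t (by rw [abs_of_nonpos ht0]; linarith)
    rwa [abs_of_nonpos ht0, neg_mul_neg, ← Real.norm_of_nonneg (exp_pos (d * t)).le] at h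
  · exact ⟨Iic 0, Iic_mem_atBot 0, integrableOn_exp_mul_Iic hdpos 0⟩
  · refine Asymptotics.IsBigO.of_bound (4 * rexp (2 * |z.re| * e)) ?_
    filter_upwards [eventually_ge_atTop (max bb bb⁻¹), eventually_ge_atTop 0] with t ht ht0
    have h := hbd t (by rwa [abs_of_nonneg ht0])
    rwa [abs_of_nonneg ht0, ← Real.norm_of_nonneg (exp_pos (-d * t)).le] at h
  · exact ⟨Ioi 0, Ioi_mem_atTop 0, exp_neg_integrableOn_Ioi 0 hdpos⟩

/-- Laurent expansion at the origin of the symmetrised kernel. -/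
lemma exists_phiKer_add_phiKer_neg_expansion {bb : ℝ} (hbb : 0 < bb) {e : ℝ}
    (he1 : e * bb < π) (he2 : e * bb⁻¹ < π) (z : ℂ) :
    ∃ k : ℂ → ℂ, DifferentiableOn ℂ k {w | |w.im| ≤ e} ∧
      ∀ w, w ≠ 0 → |w.im| ≤ e → phiKer bb z w + phiKer bb (-z) w =
        1 / 2 * (w ^ 3)⁻¹ + -(z ^ 2 + ((bb : ℂ) ^ 2 + ((bb : ℂ) ^ 2)⁻¹) / 12) * w⁻¹ + k w := by
  obtain ⟨u, hu, hu0, hsinh⟩ := exists_sinh_expansion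
  obtain ⟨v, hv, hv0, hcos⟩ := exists_cos_expansion
  have hbc : (bb : ℂ) ≠ 0 := by exact_mod_cast hbb.ne'
  set S : ℂ → ℂ := fun w => 1 + (w * bb) ^ 2 * u (w * bb) with hS
  set R : ℂ → ℂ := fun w => 1 + (w / bb) ^ 2 * u (w / bb) with hR
  have hSsinh : ∀ w, Complex.sinh (w * bb) = w * bb * S w := fun w => hsinh _
  have hRsinh : ∀ w, Complex.sinh (w / bb) = w / bb * R w := fun w => hsinh _
  set Q : ℂ → ℂ := fun w => (4 * z ^ 2 * v (2 * z * w) - bb ^ 2 * u (w * bb)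
    - u (w / bb) / bb ^ 2 - w ^ 2 * u (w * bb) * u (w / bb)) / (2 * S w * R w) with hQ
  set U : Set ℂ := {w | |w.im| * bb < π ∧ |w.im| * bb⁻¹ < π} with hU
  have hUopen : IsOpen U := by
    have hc : Continuous fun w : ℂ => |w.im| := Complex.continuous_im.abs
    exact (isOpen_lt (hc.mul_const _) continuous_const).inter
      (isOpen_lt (hc.mul_const _) continuous_const)
  have hU0 : (0 : ℂ) ∈ U := by simp [hU, pi_pos]
  have hsub : {w : ℂ | |w.im| ≤ e} ⊆ U := fun w hw =>
    ⟨(mul_le_mul_of_nonneg_right hw hbb.le).trans_lt he1,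
      (mul_le_mul_of_nonneg_right hw (inv_pos.2 hbb).le).trans_lt he2⟩
  have hS0 : ∀ w ∈ U, S w ≠ 0 := by
    intro w hw h
    rcases eq_or_ne w 0 with rfl | hw0
    · simp [hS] at h
    · refine sinh_ne_zero_of_abs_im_lt_pi (mul_ne_zero hw0 hbc) ?_ (by rw [hSsinh, h, mul_zero])
      simpa [abs_mul, abs_of_pos hbb] using hw.1
  have hR0 : ∀ w ∈ U, R w ≠ 0 := by
    intro w hw h
    rcases eq_or_ne w 0 with rfl | hw0
    · simp [hR] at h
    · refine sinh_ne_zero_of_abs_im_lt_pi (div_ne_zero hw0 hbc) ?_ (by rw [hRsinh, h, mul_zero])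
      simpa [div_eq_mul_inv, ← Complex.ofReal_inv, abs_mul, abs_of_pos hbb] using hw.2
  have hQd : DifferentiableOn ℂ Q U := by
    have hSd : Differentiable ℂ S := by fun_prop
    have hRd : Differentiable ℂ R := by fun_prop
    refine DifferentiableOn.div (Differentiable.differentiableOn (by fun_prop))
      (Differentiable.differentiableOn (by fun_prop)) fun w hw => ?_
    exact mul_ne_zero (mul_ne_zero two_ne_zero (hS0 w hw)) (hR0 w hw)
  refine ⟨dslope Q 0, ((Complex.differentiableOn_dslope (hUopen.mem_nhds hU0)).2 hQd).mono hsub,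
    fun w hw him => ?_⟩
  have hwU := hsub him
  have hQ0 : Q 0 = -(z ^ 2 + ((bb : ℂ) ^ 2 + ((bb : ℂ) ^ 2)⁻¹) / 12) := by
    simp [hQ, hS, hR, hu0, hv0]
    field_simp
    ring
  have hk : dslope Q 0 w = (Q w - Q 0) * w⁻¹ := by
    rw [← smul_eq_mul, ← sub_smul_dslope, sub_zero, smul_eq_mul, smul_eq_mul]
    field_simp
  have hexp : Complex.exp (-2 * Complex.I * z * w) + Complex.exp (-2 * Complex.I * -z * w) =
      2 * (1 + (2 * z * w) ^ 2 * v (2 * z * w)) := by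
    rw [← hcos, Complex.two_cos]
    ring_nf
  have hQw : Q w * (2 * S w * R w) = 4 * z ^ 2 * v (2 * z * w) - bb ^ 2 * u (w * bb)
      - u (w / bb) / bb ^ 2 - w ^ 2 * u (w * bb) * u (w / bb) :=
    div_mul_cancel₀ _ (mul_ne_zero (mul_ne_zero two_ne_zero (hS0 w hwU)) (hR0 w hwU))
  have hSR : S w * R w = 1 + w ^ 2 * (bb ^ 2 * u (w * bb) + u (w / bb) / bb ^ 2 +
      w ^ 2 * u (w * bb) * u (w / bb)) := by
    simp only [hS, hR]
    field_simp
    ring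
  have hSw := hS0 w hwU
  have hRw := hR0 w hwU
  have hmain : phiKer bb z w + phiKer bb (-z) w = 1 / 2 * (w ^ 3)⁻¹ + Q w * w⁻¹ := by
    have hden : (1 / 2 * (w ^ 3)⁻¹ + Q w * w⁻¹) * (4 * (w * bb * S w) * (w / bb * R w) * w) =
        2 * (S w * R w) + 2 * w ^ 2 * (Q w * (2 * S w * R w)) := by
      clear_value S R Q
      field_simp
      ring
    rw [phiKer, phiKer, ← add_div, hexp, hSsinh, hRsinh, div_eq_iff (by
      simp [hw, hbc, hSw, hRw]), hden, hQw, hSR]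
    ring
  rw [hk, hmain, ← hQ0]
  ring

lemma integral_phiKer_add_integral_phiKer_neg {bb : ℝ} (hbb : 0 < bb) {e : ℝ} (he : 0 < e)
    (he1 : e * bb < π) (he2 : e * bb⁻¹ < π) {z : ℂ} (hz : 2 * |z.im| < bb + bb⁻¹) :
    (∫ t : ℝ, phiKer bb z (t + e * Complex.I)) + ∫ t : ℝ, phiKer bb (-z) (t + e * Complex.I) =
      π * Complex.I * (z ^ 2 + ((bb : ℂ) ^ 2 + ((bb : ℂ) ^ 2)⁻¹) / 12) := by
  have hz' : 2 * |(-z).im| < bb + bb⁻¹ := by simpa using hz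
  have hi := integrable_phiKer hbb he he1 he2 hz
  have hi' := integrable_phiKer hbb he he1 he2 hz'
  obtain ⟨k, hk, hexp⟩ := exists_phiKer_add_phiKer_neg_expansion hbb he1 he2 z
  have hdpos : 0 < bb + bb⁻¹ - 2 * |z.im| := by linarith
  have hB : Tendsto (fun T : ℝ => 2 * (4 * rexp (2 * |z.re| * e) *
      rexp (-(bb + bb⁻¹ - 2 * |z.im|) * T))) atTop (𝓝 0) := by
    have h := tendsto_exp_atBot.comp (tendsto_id.const_mul_atTop_of_neg (neg_neg_iff_pos.2 hdpos))
    simpa using (h.const_mul (4 * rexp (2 * |z.re| * e))).const_mul 2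
  rw [← integral_add hi hi']
  refine (integral_add_mul_I_of_odd (G := fun w => phiKer bb z w + phiKer bb (-z) w) he
    (fun w => ?_) hk hexp hB ?_ (hi.add hi')).trans (by ring)
  · simp only [phiKer_neg, neg_neg]
    ring
  · filter_upwards [eventually_ge_atTop (max bb bb⁻¹)] with T hT w hre him
    have h1 := norm_phiKer_le hbb z him (hre ▸ hT)
    have h2 := norm_phiKer_le hbb (-z) him (hre ▸ hT)
    rw [Complex.neg_re, Complex.neg_im, abs_neg, abs_neg] at h2
    rw [hre] at h1 h2
    exact (norm_add_le _ _).trans (by linarith)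

/-- The inversion relation for Faddeev's quantum dilogarithm:
`Φ_𝖻(z) Φ_𝖻(-z) = ζ_inv⁻¹ e^{iπz²}` with `ζ_inv = e^{iπ(1+2c_𝖻²)/6}`. -/
theorem Phi_inversion (bb : ℝ) (hbb : 0 < bb) (z : ℂ) (hz : |z.im| < (cB bb).im) :
    Phi bb z * Phi bb (-z) =
      (Complex.exp (π * Complex.I * (1 + 2 * cB bb ^ 2) / 6))⁻¹ *
        Complex.exp (π * Complex.I * z ^ 2) := by
  have hcim : (cB bb).im = (bb + bb⁻¹) / 2 := by
    have h : cB bb = ((bb + bb⁻¹) / 2 : ℝ) * Complex.I := by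
      rw [cB]
      push_cast
      ring
    rw [h]
    simp
  rw [hcim] at hz
  have hbc : (bb : ℂ) ≠ 0 := by exact_mod_cast hbb.ne'
  set e : ℝ := π * min bb bb⁻¹ / 2 with he_def
  have hmin : 0 < min bb bb⁻¹ := lt_min hbb (inv_pos.2 hbb)
  have he : 0 < e := by positivity
  have he1 : e * bb < π := by
    have h : min bb bb⁻¹ * bb ≤ bb⁻¹ * bb := by gcongr; exact min_le_right _ _
    rw [inv_mul_cancel₀ hbb.ne'] at h
    nlinarith [pi_pos]
  have he2 : e * bb⁻¹ < π := by
    have h : min bb bb⁻¹ * bb⁻¹ ≤ bb * bb⁻¹ := by gcongr; exact min_le_left _ _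
    rw [mul_inv_cancel₀ hbb.ne'] at h
    nlinarith [pi_pos]
  have hline : ∀ t : ℝ, (t : ℂ) + Complex.I * (π * (min bb bb⁻¹ : ℝ) / 2) =
      t + e * Complex.I := fun t => by
    rw [he_def]
    push_cast
    ring
  have hstrip : ∀ x : ℂ, |x.im| < (bb + bb⁻¹) / 2 →
      Phi bb x = Complex.exp (∫ t : ℝ, phiKer bb x (t + e * Complex.I)) := fun x hx => by
    obtain ⟨hx1, hx2⟩ := abs_lt.1 hx
    rw [Phi, if_neg hx1.not_ge, if_neg hx2.not_ge, PhiS]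
    simp only [hline]
  rw [hstrip z hz, hstrip (-z) (by simpa using hz), ← Complex.exp_add,
    integral_phiKer_add_integral_phiKer_neg hbb he he1 he2 (by linarith), ← Complex.exp_neg,
    ← Complex.exp_add]
  congr 1
  rw [cB]
  push_cast
  field_simp
  ring_nf
  rw [Complex.I_sq]
  ring
end
end
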